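/- arXiv:1308.5560 — 2 statements merged into one kernel-verified Lean document; each statement's English description precedes it below -/
import Mathlib

section
/- Let h ∈ ℝ[x₀,…,xₙ] be homogeneous of degree d ≥ 1, hyperbolic with respect to e ∈ ℝ^{n+1}, and assume h has no real singularities. Then there exists a homogeneous polynomial q ∈ ℝ[x₀,…,xₙ] that is hyperbolic with respect to e, a natural number N, and real symmetric N×N matrices A₀,…,Aₙ such that q·h = det(x₀A₀ + … + xₙAₙ) (an identity of polynomials, where the determinant is taken of the matrix with polynomial entries) and the real matrix e₀A₀ + … + eₙAₙ is positive definite. -/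
open MvPolynomial

/-- `h` is hyperbolic with respect to `e`: `h(e) ≠ 0` and for every `v`, every complex
root of the univariate polynomial `t ↦ h(t·e + v)` is real. -/
def Hyperbolic {n : ℕ} (h : MvPolynomial (Fin (n + 1)) ℝ) (e : Fin (n + 1) → ℝ) : Prop :=
  eval e h ≠ 0 ∧
    ∀ v : Fin (n + 1) → ℝ, ∀ z : ℂ,
      (aeval (fun i => z * (e i : ℂ) + (v i : ℂ)) h = 0) → z.im = 0

section Gaussian

open MeasureTheory

theorem integrable_pow_mul_gaussian (k : ℕ) :
    Integrable fun x : ℝ => x ^ k * Real.exp (-(1 / 2) * x ^ 2) := by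
  have h := integrable_rpow_mul_exp_neg_mul_sq (b := 1 / 2) (by norm_num) (s := k)
    (by have : (0 : ℝ) ≤ k := Nat.cast_nonneg k
        linarith)
  simpa only [Real.rpow_natCast] using h

/-- The `k`-th moment of the (unnormalized) Gaussian weight on `ℝ`. -/
noncomputable def gaussianMoment (k : ℕ) : ℝ :=
  ∫ x : ℝ, x ^ k * Real.exp (-(1 / 2) * x ^ 2)

theorem gaussianMoment_zero_pos : 0 < gaussianMoment 0 := by
  have : gaussianMoment 0 = √(Real.pi / (1 / 2)) := by
    simp only [gaussianMoment, pow_zero, one_mul]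
    exact integral_gaussian (1 / 2)
  rw [this]
  positivity

theorem gaussianMoment_succ (k : ℕ) : gaussianMoment (k + 1) = k * gaussianMoment (k - 1) := by
  have hderiv : ∀ x : ℝ, HasDerivAt (fun x : ℝ => x ^ k * Real.exp (-(1 / 2) * x ^ 2))
      (k * (x ^ (k - 1) * Real.exp (-(1 / 2) * x ^ 2)) -
        x ^ (k + 1) * Real.exp (-(1 / 2) * x ^ 2)) x := by
    intro x
    have h2 : HasDerivAt (fun x : ℝ => Real.exp (-(1 / 2) * x ^ 2))
        (Real.exp (-(1 / 2) * x ^ 2) * (-(1 / 2) * (2 * x))) x := by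
      have := ((hasDerivAt_pow 2 x).const_mul (-(1 / 2) : ℝ)).exp
      simpa using this
    convert! (hasDerivAt_pow k x).mul h2 using 1
    ring
  have hinteg : Integrable fun x : ℝ => k * (x ^ (k - 1) * Real.exp (-(1 / 2) * x ^ 2)) -
        x ^ (k + 1) * Real.exp (-(1 / 2) * x ^ 2) :=
    ((integrable_pow_mul_gaussian (k - 1)).const_mul _).sub (integrable_pow_mul_gaussian (k + 1))
  have h := integral_eq_zero_of_hasDerivAt_of_integrable hderiv hinteg
    (integrable_pow_mul_gaussian k)
  rw [integral_sub ((integrable_pow_mul_gaussian (k - 1)).const_mul _)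
    (integrable_pow_mul_gaussian (k + 1)), integral_const_mul] at h
  simp only [gaussianMoment]
  linarith

variable {n : ℕ}

theorem eval_monomial_mul_gaussian (α : Fin n →₀ ℕ) (a : ℝ) (u : Fin n → ℝ) :
    eval u (monomial α a) * ∏ i, Real.exp (-(1 / 2) * u i ^ 2) =
      a * ∏ i, u i ^ α i * Real.exp (-(1 / 2) * u i ^ 2) := by
  rw [eval_monomial, Finsupp.prod_fintype _ _ (fun i => pow_zero _), Finset.prod_mul_distrib,
    mul_assoc]

theorem integrable_eval_mul_gaussian (p : MvPolynomial (Fin n) ℝ) :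
    Integrable fun u : Fin n → ℝ => eval u p * ∏ i, Real.exp (-(1 / 2) * u i ^ 2) := by
  induction p using MvPolynomial.induction_on' with
  | monomial α a =>
    simp only [eval_monomial_mul_gaussian]
    refine Integrable.const_mul ?_ a
    exact Integrable.fintype_prod (μ := fun _ => volume)
      (f := fun i x => x ^ α i * Real.exp (-(1 / 2) * x ^ 2))
      (fun i => integrable_pow_mul_gaussian (α i))
  | add p q hp hq =>
    simp only [map_add, add_mul]
    exact hp.add hq

/-- Integration of polynomials against the (unnormalized) standard Gaussian weight. -/
noncomputable def gaussianIntegral (n : ℕ) : MvPolynomial (Fin n) ℝ →ₗ[ℝ] ℝ where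
  toFun p := ∫ u : Fin n → ℝ, eval u p * ∏ i, Real.exp (-(1 / 2) * u i ^ 2)
  map_add' p q := by
    simp only [map_add, add_mul]
    exact integral_add (integrable_eval_mul_gaussian p) (integrable_eval_mul_gaussian q)
  map_smul' c p := by
    simp only [smul_eval, mul_assoc, RingHom.id_apply, smul_eq_mul]
    exact integral_const_mul _ _

theorem gaussianIntegral_nonneg (p : MvPolynomial (Fin n) ℝ) (hp : ∀ u, 0 ≤ eval u p) :
    0 ≤ gaussianIntegral n p :=
  integral_nonneg fun u => mul_nonneg (hp u) (Finset.prod_nonneg fun _ _ => (Real.exp_pos _).le)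

theorem gaussianIntegral_monomial (α : Fin n →₀ ℕ) (a : ℝ) :
    gaussianIntegral n (monomial α a) = a * ∏ i, gaussianMoment (α i) := by
  change ∫ u : Fin n → ℝ, _ = _
  simp only [eval_monomial_mul_gaussian]
  rw [integral_const_mul, integral_fintype_prod_volume_eq_prod
    (fun i x => x ^ α i * Real.exp (-(1 / 2) * x ^ 2))]
  rfl

theorem gaussianIntegral_one_pos : 0 < gaussianIntegral n 1 := by
  have h := gaussianIntegral_monomial (0 : Fin n →₀ ℕ) 1
  rw [show (monomial (0 : Fin n →₀ ℕ)) (1 : ℝ) = 1 from rfl] at h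
  rw [h, one_mul]
  exact Finset.prod_pos fun _ _ => gaussianMoment_zero_pos

/-- Integration by parts. -/
theorem gaussianIntegral_X_mul (i : Fin n) (p : MvPolynomial (Fin n) ℝ) :
    gaussianIntegral n (X i * p) = gaussianIntegral n (pderiv i p) := by
  induction p using MvPolynomial.induction_on' with
  | monomial α a =>
    have hX : (X i : MvPolynomial (Fin n) ℝ) * monomial α a =
        monomial (Finsupp.single i 1 + α) a := by
      rw [X, monomial_mul, one_mul]
    rw [hX, pderiv_monomial, gaussianIntegral_monomial, gaussianIntegral_monomial,
      ← Finset.mul_prod_erase Finset.univ _ (Finset.mem_univ i),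
      ← Finset.mul_prod_erase Finset.univ
        (fun j => gaussianMoment ((α - Finsupp.single i 1 : Fin n →₀ ℕ) j))
        (Finset.mem_univ i)]
    have hprod : ∏ x ∈ Finset.univ.erase i,
        gaussianMoment ((Finsupp.single i 1 + α : Fin n →₀ ℕ) x) =
        ∏ x ∈ Finset.univ.erase i, gaussianMoment ((α - Finsupp.single i 1 : Fin n →₀ ℕ) x) := by
      refine Finset.prod_congr rfl fun j hj => ?_
      have hj : i ≠ j := (Finset.ne_of_mem_erase hj).symm
      simp [Finsupp.single_eq_of_ne hj.symm]
    rw [hprod]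
    simp only [Finsupp.add_apply, Finsupp.single_eq_same, Finsupp.tsub_apply]
    rw [add_comm 1 (α i), gaussianMoment_succ]
    ring
  | add p q hp hq => simp only [mul_add, map_add, hp, hq]

theorem gaussianIntegral_sum_X_sq_mul {D : ℕ} (F : MvPolynomial (Fin n) ℝ)
    (hF : F.IsHomogeneous D) :
    gaussianIntegral n ((∑ i, X i ^ 2) * F) = (n + D) * gaussianIntegral n F := by
  have h1 : (∑ i, X i ^ 2) * F = ∑ i, X i * (X i * F) := by
    rw [Finset.sum_mul]
    exact Finset.sum_congr rfl fun i _ => by ring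
  rw [h1, map_sum]
  simp only [gaussianIntegral_X_mul, Derivation.leibniz, pderiv_X_self, smul_eq_mul, mul_one,
    map_add]
  rw [Finset.sum_add_distrib]
  simp only [← gaussianIntegral_X_mul]
  have h2 : ∑ i, gaussianIntegral n (X i * pderiv i F) = D * gaussianIntegral n F := by
    rw [← map_sum, hF.sum_X_mul_pderiv, map_nsmul, nsmul_eq_mul]
  simp only [gaussianIntegral_X_mul] at h2 ⊢
  rw [h2]
  simp
  ring

end Gaussian

section Approximation

open Filter Topology

variable {n : ℕ}

/-- The linear form `u ↦ ⟨x, u⟩`. -/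
noncomputable def linearForm (x : Fin n → ℝ) : MvPolynomial (Fin n) ℝ := ∑ i, C (x i) * X i

theorem linearForm_isHomogeneous (x : Fin n → ℝ) : (linearForm x).IsHomogeneous 1 :=
  IsHomogeneous.sum _ _ _ fun i _ => by
    simpa using (isHomogeneous_C (Fin n) (x i)).mul (isHomogeneous_X ℝ i)

theorem pderiv_linearForm (x : Fin n → ℝ) (i : Fin n) : pderiv i (linearForm x) = C (x i) := by
  classical
  simp [linearForm, pderiv_X, Pi.single_apply]

/-- `p` is the limit of homogeneous polynomials `q N` such that integrating `q N` against the
`N`-th power of a linear form reproduces `p` up to a radial factor. -/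
def HasGaussianLift (s : ℕ) (p : MvPolynomial (Fin n) ℝ) : Prop :=
  ∃ q : ℕ → MvPolynomial (Fin n) ℝ, (∀ N, (q N).IsHomogeneous s) ∧
    (∀ φ : MvPolynomial (Fin n) ℝ →ₗ[ℝ] ℝ, Tendsto (fun N => φ (q N)) atTop (𝓝 (φ p))) ∧
    ∀ N x, gaussianIntegral n (linearForm x ^ N * q N) =
      N.descFactorial s * gaussianIntegral n (linearForm x ^ (N - s)) * eval x p

theorem HasGaussianLift.add {s : ℕ} {p p' : MvPolynomial (Fin n) ℝ} (h : HasGaussianLift s p)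
    (h' : HasGaussianLift s p') : HasGaussianLift s (p + p') := by
  obtain ⟨q, h1, h2, h3⟩ := h
  obtain ⟨q', h1', h2', h3'⟩ := h'
  refine ⟨fun N => q N + q' N, fun N => (h1 N).add (h1' N), fun φ => ?_, fun N x => ?_⟩
  · simpa only [map_add] using (h2 φ).add (h2' φ)
  · rw [mul_add, map_add, h3, h3', map_add]
    ring

theorem HasGaussianLift.smul {s : ℕ} {p : MvPolynomial (Fin n) ℝ} (h : HasGaussianLift s p)
    (c : ℝ) : HasGaussianLift s (c • p) := by
  obtain ⟨q, h1, h2, h3⟩ := h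
  refine ⟨fun N => c • q N, fun N => ?_, fun φ => ?_, fun N x => ?_⟩
  · exact (homogeneousSubmodule (Fin n) ℝ s).smul_mem c (h1 N)
  · simpa only [map_smul] using (h2 φ).const_smul c
  · rw [mul_smul_comm, map_smul, h3, smul_eval, smul_eq_mul]
    ring

theorem hasGaussianLift_zero (s : ℕ) : HasGaussianLift s (0 : MvPolynomial (Fin n) ℝ) :=
  ⟨fun _ => 0, fun _ => isHomogeneous_zero _ _ _, fun φ => tendsto_const_nhds, fun N x => by simp⟩

theorem hasGaussianLift_one : HasGaussianLift 0 (1 : MvPolynomial (Fin n) ℝ) :=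
  ⟨fun _ => 1, fun _ => isHomogeneous_one _ _, fun φ => tendsto_const_nhds, fun N x => by simp⟩

theorem HasGaussianLift.X_mul {s : ℕ} {p : MvPolynomial (Fin n) ℝ} (h : HasGaussianLift s p)
    (i : Fin n) : HasGaussianLift (s + 1) (X i * p) := by
  obtain ⟨q, h1, h2, h3⟩ := h
  have hn : (0 : ℝ) < n := by exact_mod_cast i.pos
  let c : ℕ → ℝ := fun N => ((n : ℝ) + ((N + (s - 1) : ℕ) : ℝ))⁻¹
  have hc : Tendsto c atTop (𝓝 0) := by
    refine tendsto_inv_atTop_zero.comp ?_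
    refine tendsto_atTop_add_const_left _ _ ?_
    exact tendsto_natCast_atTop_atTop.comp (tendsto_add_atTop_nat (s - 1))
  refine ⟨fun N => X i * q (N - 1) - c N • ((∑ j, X j ^ 2) * pderiv i (q (N - 1))),
    fun N => ?_, fun φ => ?_, fun N x => ?_⟩
  · refine IsHomogeneous.sub ?_ ?_
    · simpa [add_comm] using (isHomogeneous_X ℝ i).mul (h1 (N - 1))
    · refine (homogeneousSubmodule (Fin n) ℝ (s + 1)).smul_mem _ ?_
      rw [mem_homogeneousSubmodule]
      rcases Nat.eq_zero_or_pos s with rfl | hs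
      · have : q (N - 1) = C (coeff 0 (q (N - 1))) :=
          totalDegree_eq_zero_iff_eq_C.mp (Nat.le_zero.mp (h1 (N - 1)).totalDegree_le)
        rw [this, pderiv_C, mul_zero]
        exact isHomogeneous_zero _ _ _
      · have := (IsHomogeneous.sum Finset.univ (fun j : Fin n => (X j : MvPolynomial (Fin n) ℝ) ^ 2)
          2 fun j _ => by simpa using (isHomogeneous_X ℝ j).pow 2).mul
            ((h1 (N - 1)).pderiv (i := i))
        convert! this using 1
        omega
  · have hs : Tendsto (fun N : ℕ => N - 1) atTop atTop := tendsto_sub_atTop_nat 1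
    have t1 := (h2 (φ ∘ₗ LinearMap.mulLeft ℝ (X i))).comp hs
    have t2 := (h2 (φ ∘ₗ LinearMap.mulLeft ℝ (∑ j, X j ^ 2) ∘ₗ (pderiv i).toLinearMap)).comp hs
    have t3 := t1.sub (hc.mul t2)
    simp only [zero_mul, sub_zero] at t3
    refine t3.congr fun N => ?_
    simp [map_sub, map_smul]
  · have hD : gaussianIntegral n ((∑ j, X j ^ 2) * (linearForm x ^ N * pderiv i (q (N - 1)))) =
        (n + ((N + (s - 1) : ℕ) : ℝ)) *
          gaussianIntegral n (linearForm x ^ N * pderiv i (q (N - 1))) := by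
      refine gaussianIntegral_sum_X_sq_mul _ ?_
      simpa using ((linearForm_isHomogeneous x).pow N).mul (h1 (N - 1)).pderiv
    have hpos : (n + ((N + (s - 1) : ℕ) : ℝ)) ≠ 0 := by positivity
    have e1 : linearForm x ^ N * (X i * q (N - 1) -
        c N • ((∑ j, X j ^ 2) * pderiv i (q (N - 1)))) =
        X i * (linearForm x ^ N * q (N - 1)) -
        c N • ((∑ j, X j ^ 2) * (linearForm x ^ N * pderiv i (q (N - 1)))) := by
      simp only [smul_eq_C_mul]
      ring
    rw [e1, map_sub, map_smul, hD, gaussianIntegral_X_mul, smul_eq_mul, inv_mul_cancel_left₀ hpos,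
      Derivation.leibniz, Derivation.leibniz_pow, pderiv_linearForm, map_add]
    have e2 : q (N - 1) • N • linearForm x ^ (N - 1) • (C (x i) : MvPolynomial (Fin n) ℝ) =
        (N * x i : ℝ) • (linearForm x ^ (N - 1) * q (N - 1)) := by
      simp only [smul_eq_C_mul, smul_eq_mul, nsmul_eq_mul, C_mul, map_natCast]
      ring
    rw [e2, smul_eq_mul (linearForm x ^ N), map_smul (gaussianIntegral n) (N * x i : ℝ), h3,
      smul_eq_mul, map_mul (eval x), eval_X]
    rcases N with _ | N
    · simp
    · rw [Nat.succ_descFactorial_succ, show N + 1 - (s + 1) = N - s by omega]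
      simp only [Nat.add_sub_cancel]
      push_cast
      ring

theorem hasGaussianLift_monomial (s : ℕ) (α : Fin n →₀ ℕ) (hα : α.degree = s) :
    HasGaussianLift s (monomial α (1 : ℝ)) := by
  induction s generalizing α with
  | zero =>
    rw [Finsupp.degree_eq_zero_iff] at hα
    subst hα
    exact hasGaussianLift_one
  | succ s ih =>
    obtain ⟨i, hi⟩ : ∃ i, α i ≠ 0 := by
      by_contra! h0
      have : α = 0 := Finsupp.ext h0
      simp [this] at hα
    have hle : Finsupp.single i 1 ≤ α := by
      rw [Finsupp.single_le_iff]
      omega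
    have hadd : Finsupp.single i 1 + (α - Finsupp.single i 1) = α := add_tsub_cancel_of_le hle
    have hdeg : (α - Finsupp.single i 1).degree = s := by
      have := congrArg Finsupp.degree hadd
      rw [map_add, Finsupp.degree_single, hα] at this
      omega
    have := (ih _ hdeg).X_mul i
    rwa [X, monomial_mul, one_mul, hadd] at this

theorem IsHomogeneous.hasGaussianLift {s : ℕ} {p : MvPolynomial (Fin n) ℝ}
    (hp : p.IsHomogeneous s) : HasGaussianLift s p := by
  rw [p.as_sum]
  refine Finset.sum_induction _ (HasGaussianLift s) (fun _ _ => HasGaussianLift.add)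
    (hasGaussianLift_zero s) fun α hα => ?_
  have h1 : monomial α (coeff α p) = coeff α p • monomial α (1 : ℝ) := by
    rw [smul_monomial, smul_eq_mul, mul_one]
  rw [h1]
  refine (hasGaussianLift_monomial s α ?_).smul _
  rw [Finsupp.degree_eq_weight_one]
  exact hp (mem_support_iff.mp hα)

theorem gaussianIntegral_linearForm_pow (k : ℕ) :
    ∃ μ : ℝ, 0 < μ ∧ ∀ x : Fin n → ℝ,
      gaussianIntegral n (linearForm x ^ (2 * k)) = μ * (∑ i, x i ^ 2) ^ k := by
  induction k with
  | zero => exact ⟨gaussianIntegral n 1, gaussianIntegral_one_pos, fun x => by simp⟩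
  | succ k ih =>
    obtain ⟨μ, hμ, h⟩ := ih
    refine ⟨(2 * k + 1) * μ, by positivity, fun x => ?_⟩
    have e1 : linearForm x ^ (2 * (k + 1)) =
        ∑ i, x i • (X i * linearForm x ^ (2 * k + 1)) := by
      rw [show 2 * (k + 1) = 2 * k + 1 + 1 by ring, pow_succ' _ (2 * k + 1)]
      nth_rewrite 1 [linearForm]
      rw [Finset.sum_mul]
      exact Finset.sum_congr rfl fun i _ => by rw [smul_eq_C_mul, mul_assoc]
    have e2 : ∀ i, gaussianIntegral n (X i * linearForm x ^ (2 * k + 1)) =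
        (2 * k + 1) * x i * (μ * (∑ i, x i ^ 2) ^ k) := by
      intro i
      rw [gaussianIntegral_X_mul, Derivation.leibniz_pow, pderiv_linearForm, ← h]
      have : (2 * k + 1) • linearForm x ^ (2 * k + 1 - 1) • (C (x i) : MvPolynomial (Fin n) ℝ) =
          ((2 * k + 1) * x i : ℝ) • linearForm x ^ (2 * k) := by
        simp only [smul_eq_C_mul, smul_eq_mul, nsmul_eq_mul, C_mul, map_natCast, C_add,
          Nat.add_sub_cancel, Nat.cast_add, Nat.cast_mul, C_1, Nat.cast_one, Nat.cast_ofNat]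
        rw [show (C (2 : ℝ) : MvPolynomial (Fin n) ℝ) = 2 from map_ofNat C 2]
        ring
      rw [this, map_smul, smul_eq_mul]
    rw [e1, map_sum]
    simp only [map_smul, e2, smul_eq_mul]
    rw [pow_succ, ← mul_assoc, Finset.mul_sum]
    exact Finset.sum_congr rfl fun i _ => by ring

end Approximation

section Perturbation

open Filter Topology

variable {n d : ℕ}

theorem MvPolynomial.IsHomogeneous.eval_smul_eq {s : ℕ} {q : MvPolynomial (Fin n) ℝ}
    (hq : q.IsHomogeneous s) (u : Fin n → ℝ) (c : ℝ) : eval (c • u) q = c ^ s * eval u q := by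
  rw [eval_eq', eval_eq', Finset.mul_sum]
  refine Finset.sum_congr rfl fun α hα => ?_
  have h1 : α.degree = s := by
    rw [Finsupp.degree_eq_weight_one]
    exact hq (mem_support_iff.mp hα)
  simp only [Pi.smul_apply, smul_eq_mul, mul_pow, Finset.prod_mul_distrib]
  rw [Finset.prod_pow_eq_pow_sum, ← Finsupp.degree_eq_sum, h1]
  ring

theorem MvPolynomial.IsHomogeneous.abs_eval_le {s : ℕ} {q : MvPolynomial (Fin n) ℝ}
    (hq : q.IsHomogeneous s) {u : Fin n → ℝ} (hu : ∀ i, |u i| ≤ 1) :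
    |eval u q| ≤ ∑ α ∈ Finset.univ.finsuppAntidiag s, |coeff α q| := by
  rw [eval_eq']
  refine (Finset.abs_sum_le_sum_abs _ _).trans ?_
  refine (Finset.sum_le_sum (g := fun α => |coeff α q|) fun α _ => ?_).trans
    (Finset.sum_le_sum_of_subset_of_nonneg (fun α hα => ?_) fun _ _ _ => abs_nonneg _)
  · rw [abs_mul, Finset.abs_prod]
    refine mul_le_of_le_one_right (abs_nonneg _) (Finset.prod_le_one (fun _ _ => abs_nonneg _)
      fun i _ => ?_)
    rw [abs_pow]
    exact pow_le_one₀ (abs_nonneg _) (hu i)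
  · rw [Finset.mem_finsuppAntidiag]
    refine ⟨?_, Finset.subset_univ _⟩
    have h1 : α.degree = s := by
      rw [Finsupp.degree_eq_weight_one]
      exact hq (mem_support_iff.mp hα)
    rw [← h1, Finsupp.degree_eq_sum]

theorem abs_le_one_of_sum_sq_eq_one {ι : Type*} [Fintype ι] {u : ι → ℝ} (hu : ∑ i, u i ^ 2 = 1)
    (i : ι) : |u i| ≤ 1 := by
  rw [← sq_le_one_iff_abs_le_one, ← hu]
  exact Finset.single_le_sum (f := fun i => u i ^ 2) (fun j _ => sq_nonneg _) (Finset.mem_univ i)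

theorem exists_smul_of_sum_sq {ι : Type*} [Fintype ι] [Nonempty ι] (u : ι → ℝ) :
    ∃ (ρ : ℝ) (ω : ι → ℝ), ∑ i, ω i ^ 2 = 1 ∧ u = ρ • ω := by
  classical
  by_cases h : ∑ i, u i ^ 2 = 0
  · obtain ⟨i⟩ := ‹Nonempty ι›
    refine ⟨0, Pi.single i 1, ?_, ?_⟩
    · simp [Pi.single_apply]
    · rw [Finset.sum_eq_zero_iff_of_nonneg fun _ _ => sq_nonneg _] at h
      ext j
      simpa using h j (Finset.mem_univ j)
  · have hpos : 0 < ∑ i, u i ^ 2 :=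
      lt_of_le_of_ne (Finset.sum_nonneg fun _ _ => sq_nonneg _) (Ne.symm h)
    have hs : √(∑ i, u i ^ 2) ≠ 0 := (Real.sqrt_pos.mpr hpos).ne'
    refine ⟨√(∑ i, u i ^ 2), (√(∑ i, u i ^ 2))⁻¹ • u, ?_, by rw [smul_inv_smul₀ hs]⟩
    simp only [Pi.smul_apply, smul_eq_mul, mul_pow, inv_pow, ← Finset.mul_sum,
      Real.sq_sqrt hpos.le]
    exact inv_mul_cancel₀ h

theorem eventually_form_nonneg (hn : 0 < n) (hd : 0 < d) (w : Fin d → ℕ)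
    (A : ℕ → Fin d → Fin d → MvPolynomial (Fin n) ℝ) (B : Fin d → Fin d → MvPolynomial (Fin n) ℝ)
    (hA : ∀ m i j, (A m i j).IsHomogeneous (w i + w j))
    (hB : ∀ i j, (B i j).IsHomogeneous (w i + w j))
    (hlim : ∀ i j, ∀ φ : MvPolynomial (Fin n) ℝ →ₗ[ℝ] ℝ,
      Tendsto (fun m => φ (A m i j)) atTop (𝓝 (φ (B i j))))
    {δ : ℝ} (hδ : 0 < δ) (hpos : ∀ u : Fin n → ℝ, ∑ i, u i ^ 2 = 1 → ∀ y : Fin d → ℝ,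
      ∑ i, y i ^ 2 = 1 → δ ≤ ∑ i, ∑ j, y i * y j * eval u (B i j)) :
    ∀ᶠ m in atTop, ∀ (u : Fin n → ℝ) (y : Fin d → ℝ),
      0 ≤ ∑ i, ∑ j, y i * y j * eval u (A m i j) := by
  have : Nonempty (Fin n) := ⟨⟨0, hn⟩⟩
  have : Nonempty (Fin d) := ⟨⟨0, hd⟩⟩
  have herr : Tendsto (fun m => ∑ i, ∑ j, ∑ α ∈ Finset.univ.finsuppAntidiag (w i + w j),
      |coeff α (A m i j - B i j)|) atTop (𝓝 0) := by
    rw [show (0 : ℝ) = ∑ i : Fin d, ∑ j : Fin d,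
      ∑ α ∈ (Finset.univ : Finset (Fin n)).finsuppAntidiag (w i + w j), 0 by simp]
    refine tendsto_finsetSum _ fun i _ => tendsto_finsetSum _ fun j _ =>
      tendsto_finsetSum _ fun α _ => ?_
    have h := ((hlim i j (lcoeff ℝ α)).sub_const (lcoeff ℝ α (B i j))).abs
    simpa using h
  filter_upwards [herr.eventually_lt_const hδ] with m hm
  have key : ∀ u : Fin n → ℝ, ∑ i, u i ^ 2 = 1 → ∀ y : Fin d → ℝ, ∑ i, y i ^ 2 = 1 →
      0 ≤ ∑ i, ∑ j, y i * y j * eval u (A m i j) := by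
    intro u hu y hy
    have h1 : |∑ i, ∑ j, y i * y j * eval u (A m i j - B i j)| ≤
        ∑ i, ∑ j, ∑ α ∈ Finset.univ.finsuppAntidiag (w i + w j), |coeff α (A m i j - B i j)| := by
      refine (Finset.abs_sum_le_sum_abs _ _).trans (Finset.sum_le_sum fun i _ => ?_)
      refine (Finset.abs_sum_le_sum_abs _ _).trans (Finset.sum_le_sum fun j _ => ?_)
      rw [abs_mul, abs_mul]
      refine (mul_le_of_le_one_left (abs_nonneg _) ?_).trans
        (((hA m i j).sub (hB i j)).abs_eval_le fun i => abs_le_one_of_sum_sq_eq_one hu i)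
      exact mul_le_one₀ (abs_le_one_of_sum_sq_eq_one hy i) (abs_nonneg _)
        (abs_le_one_of_sum_sq_eq_one hy j)
    have h2 := hpos u hu y hy
    have h3 : ∑ i, ∑ j, y i * y j * eval u (A m i j - B i j) =
        ∑ i, ∑ j, y i * y j * eval u (A m i j) - ∑ i, ∑ j, y i * y j * eval u (B i j) := by
      simp only [map_sub, mul_sub, Finset.sum_sub_distrib]
    have h4 := (abs_le.mp h1).1
    linarith
  intro u y
  obtain ⟨ρ, ω, hω, rfl⟩ := exists_smul_of_sum_sq u
  obtain ⟨c, η, hη, hcη⟩ := exists_smul_of_sum_sq fun i => ρ ^ w i * y i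
  have h1 : ∑ i, ∑ j, y i * y j * eval (ρ • ω) (A m i j) =
      c ^ 2 * ∑ i, ∑ j, η i * η j * eval ω (A m i j) := by
    simp only [Finset.mul_sum]
    refine Finset.sum_congr rfl fun i _ => Finset.sum_congr rfl fun j _ => ?_
    have e1 : eval (ρ • ω) (A m i j) = ρ ^ (w i + w j) * eval ω (A m i j) := by
      exact (hA m i j).eval_smul_eq ω ρ
    have e2 : ρ ^ w i * y i = c * η i := congrFun hcη i
    have e3 : ρ ^ w j * y j = c * η j := congrFun hcη j
    rw [e1, pow_add]
    linear_combination (ρ ^ w j * y j * e2 + c * η i * e3) * eval ω (A m i j)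
  rw [h1]
  exact mul_nonneg (sq_nonneg c) (key ω hω η hη)

end Perturbation

section Representation

open Filter Topology

variable {n d : ℕ}

theorem tendsto_descFactorial_div_pow (k : ℕ) :
    Tendsto (fun m : ℕ => (m.descFactorial k : ℝ) / (m : ℝ) ^ k) atTop (𝓝 1) := by
  induction k with
  | zero => simp
  | succ k ih =>
    have h1 : Tendsto (fun m : ℕ => 1 - (k : ℝ) / m) atTop (𝓝 (1 - 0)) :=
      tendsto_const_nhds.sub (tendsto_const_div_atTop_nhds_zero_nat _)
    have h2 := h1.mul ih
    rw [sub_zero, one_mul] at h2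
    refine h2.congr' ?_
    filter_upwards [eventually_ge_atTop (k + 1)] with m hm
    have hm0 : (m : ℝ) ≠ 0 := by
      have : m ≠ 0 := by omega
      exact_mod_cast this
    rw [Nat.descFactorial_succ, Nat.cast_mul, Nat.cast_sub (by omega)]
    field_simp
    ring

theorem isCompact_sum_sq_eq_one {ι : Type*} [Fintype ι] :
    IsCompact {u : ι → ℝ | ∑ i, u i ^ 2 = 1} := by
  refine (isCompact_Icc (a := fun _ : ι => (-1 : ℝ)) (b := fun _ => 1)).of_isClosed_subset
    (isClosed_eq (by fun_prop) continuous_const) fun u hu => ?_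
  have h := fun i => abs_le.mp (abs_le_one_of_sum_sq_eq_one hu i)
  exact ⟨fun i => (h i).1, fun i => (h i).2⟩

theorem exists_form_lower_bound (B : Fin d → Fin d → MvPolynomial (Fin n) ℝ)
    (hpos : ∀ x : Fin n → ℝ, x ≠ 0 → ∀ y : Fin d → ℝ, y ≠ 0 →
      0 < ∑ i, ∑ j, y i * y j * eval x (B i j)) :
    ∃ δ : ℝ, 0 < δ ∧ ∀ u : Fin n → ℝ, ∑ i, u i ^ 2 = 1 → ∀ y : Fin d → ℝ,
      ∑ i, y i ^ 2 = 1 → δ ≤ ∑ i, ∑ j, y i * y j * eval u (B i j) := by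
  have hne : ∀ {k : ℕ} (u : Fin k → ℝ), ∑ i, u i ^ 2 = 1 → u ≠ 0 := by
    rintro k u hu rfl
    simp at hu
  obtain ⟨δ, hδ, h⟩ := ((isCompact_sum_sq_eq_one (ι := Fin n)).prod
    (isCompact_sum_sq_eq_one (ι := Fin d))).exists_forall_le' (a := 0)
      (f := fun p : (Fin n → ℝ) × (Fin d → ℝ) => ∑ i, ∑ j, p.2 i * p.2 j * eval p.1 (B i j))
      (by
        refine Continuous.continuousOn ?_
        refine continuous_finsetSum _ fun i _ => continuous_finsetSum _ fun j _ => ?_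
        have : Continuous fun p : (Fin n → ℝ) × (Fin d → ℝ) => eval p.1 (B i j) :=
          (MvPolynomial.continuous_eval (B i j)).comp continuous_fst
        fun_prop)
      fun p hp => hpos p.1 (hne _ hp.1) p.2 (hne _ hp.2)
  exact ⟨δ, hδ, fun u hu y hy => h (u, y) ⟨hu, hy⟩⟩

theorem exists_gaussian_representation_of_lower_bound (hn : 0 < n) (hd : 0 < d)
    (B : Fin d → Fin d → MvPolynomial (Fin n) ℝ)
    (hB : ∀ i j, (B i j).IsHomogeneous ((d - 1 - (i : ℕ)) + (d - 1 - (j : ℕ))))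
    {ε : ℝ} (hε : 0 < ε) (hpos : ∀ u : Fin n → ℝ, ∑ i, u i ^ 2 = 1 → ∀ y : Fin d → ℝ,
      ∑ i, y i ^ 2 = 1 → 2 * ε ≤ ∑ i, ∑ j, y i * y j * eval u (B i j)) :
    ∃ m, d ≤ m ∧ ∃ κ : ℝ, 0 < κ ∧ ∃ B' : Fin d → Fin d → MvPolynomial (Fin n) ℝ,
      (∀ (u : Fin n → ℝ) (y : Fin d → ℝ), 0 ≤ ∑ i, ∑ j, y i * y j * eval u (B' i j)) ∧
      ∃ f : (Fin n → ℝ) → ℝ, ∀ (x : Fin n → ℝ) (i j : Fin d),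
        gaussianIntegral n (linearForm x ^ ((m - (i : ℕ)) + (m - (j : ℕ))) * B' i j) +
          (if i = j then κ * (∑ l, x l ^ 2) ^ (m - (i : ℕ)) else 0) = f x * eval x (B i j) := by
  let P : Fin d → Fin d → MvPolynomial (Fin n) ℝ := fun i j =>
    B i j - if i = j then C ε * (∑ l, X l ^ 2) ^ (d - 1 - (i : ℕ)) else 0
  have hP : ∀ i j, (P i j).IsHomogeneous ((d - 1 - (i : ℕ)) + (d - 1 - (j : ℕ))) := by
    intro i j
    refine (hB i j).sub ?_
    split_ifs with hij
    · subst hij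
      have h2 : (∑ l : Fin n, (X l : MvPolynomial (Fin n) ℝ) ^ 2).IsHomogeneous 2 :=
        IsHomogeneous.sum _ _ _ fun l _ => by simpa using (isHomogeneous_X ℝ l).pow 2
      convert! (isHomogeneous_C (Fin n) ε).mul (h2.pow (d - 1 - (i : ℕ))) using 1
      omega
    · exact isHomogeneous_zero _ _ _
  have hPpos : ∀ u : Fin n → ℝ, ∑ i, u i ^ 2 = 1 → ∀ y : Fin d → ℝ, ∑ i, y i ^ 2 = 1 →
      ε ≤ ∑ i, ∑ j, y i * y j * eval u (P i j) := by
    intro u hu y hy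
    have h1 : ∑ i, ∑ j, y i * y j * eval u (P i j) =
        ∑ i, ∑ j, y i * y j * eval u (B i j) - ε := by
      have h2 : ∀ i j, y i * y j * eval u (P i j) =
          y i * y j * eval u (B i j) - if i = j then y i ^ 2 * ε else 0 := by
        intro i j
        simp only [P]
        split_ifs with hij
        · subst hij
          simp only [map_sub, map_mul, eval_C, map_pow, map_sum, eval_X, hu, one_pow]
          ring
        · simp
      simp only [h2, Finset.sum_sub_distrib, Finset.sum_ite_eq, Finset.mem_univ, if_true]
      rw [← Finset.sum_mul, hy, one_mul]
    have := hpos u hu y hy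
    linarith
  choose q hq1 hq2 hq3 using fun i j => IsHomogeneous.hasGaussianLift (hP i j)
  have hev := eventually_form_nonneg hn hd (fun i => d - 1 - (i : ℕ))
    (fun m i j => (((2 * m).descFactorial ((i : ℕ) + j) : ℝ) / ((2 * m : ℕ) : ℝ) ^ ((i : ℕ) + j)) •
      q i j ((m - (i : ℕ)) + (m - (j : ℕ)))) P
    (fun m i j => (homogeneousSubmodule (Fin n) ℝ _).smul_mem _ (hq1 i j _)) hP
    (fun i j φ => by
      have t1 : Tendsto (fun m : ℕ => 2 * m) atTop atTop :=
        tendsto_atTop_mono (fun m => by simp only [id]; omega) tendsto_id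
      have t2 : Tendsto (fun m : ℕ => (m - (i : ℕ)) + (m - (j : ℕ))) atTop atTop :=
        tendsto_atTop_mono (fun m => Nat.le_add_right _ _) (tendsto_sub_atTop_nat (i : ℕ))
      have t3 := ((tendsto_descFactorial_div_pow ((i : ℕ) + j)).comp t1).mul
        ((hq2 i j φ).comp t2)
      rw [one_mul] at t3
      refine t3.congr fun m => ?_
      simp) hε hPpos
  obtain ⟨m, hm, hdm⟩ := (hev.and (eventually_ge_atTop d)).exists
  obtain ⟨μ, hμ, hμ'⟩ := gaussianIntegral_linearForm_pow (n := n) (m - (d - 1))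
  have hc : (0 : ℝ) < (2 * m).descFactorial (2 * (d - 1)) := by
    exact_mod_cast Nat.descFactorial_pos.mpr (by omega)
  have hm0 : ((2 * m : ℕ) : ℝ) ≠ 0 := by
    have : 2 * m ≠ 0 := by omega
    exact_mod_cast this
  refine ⟨m, hdm, (2 * m).descFactorial (2 * (d - 1)) * μ * ε, by positivity,
    fun i j => ((2 * m).descFactorial ((i : ℕ) + j) : ℝ) • q i j ((m - (i : ℕ)) + (m - (j : ℕ))),
    fun u y => ?_, fun x => (2 * m).descFactorial (2 * (d - 1)) *
      (μ * (∑ l, x l ^ 2) ^ (m - (d - 1))), fun x i j => ?_⟩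
  · refine (hm u fun i => ((2 * m : ℕ) : ℝ) ^ (i : ℕ) * y i).trans_eq ?_
    refine Finset.sum_congr rfl fun i _ => Finset.sum_congr rfl fun j _ => ?_
    simp only [smul_eval, pow_add]
    field_simp
  · have hi := i.isLt
    have hj := j.isLt
    have hN : (m - (i : ℕ)) + (m - (j : ℕ)) - ((d - 1 - (i : ℕ)) + (d - 1 - (j : ℕ))) =
        2 * (m - (d - 1)) := by omega
    have hdesc : ((2 * m).descFactorial ((i : ℕ) + j) : ℝ) *
        (((m - (i : ℕ)) + (m - (j : ℕ))).descFactorial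
          ((d - 1 - (i : ℕ)) + (d - 1 - (j : ℕ))) : ℕ) = (2 * m).descFactorial (2 * (d - 1)) := by
      have := Nat.descFactorial_mul_descFactorial (n := 2 * m) (k := (i : ℕ) + j)
        (m := 2 * (d - 1)) (by omega)
      rw [← this, mul_comm, Nat.cast_mul]
      congr 3 <;> omega
    rw [mul_smul_comm, map_smul, hq3, hN, hμ', smul_eq_mul, ← mul_assoc, ← mul_assoc, hdesc]
    have hr : (∑ l, x l ^ 2) ^ (m - (i : ℕ)) =
        (∑ l, x l ^ 2) ^ (m - (d - 1)) * (∑ l, x l ^ 2) ^ (d - 1 - (i : ℕ)) := by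
      rw [← pow_add]
      congr 1
      omega
    simp only [P]
    split_ifs with hij
    · simp only [map_sub, map_mul, eval_C, map_pow, map_sum, eval_X, hr]
      ring
    · simp

/-- A positive definite matrix of forms is, up to a radial factor, given by integrating a
positive semidefinite matrix of polynomials against powers of linear forms. -/
theorem exists_gaussian_representation (hn : 0 < n) (hd : 0 < d)
    (B : Fin d → Fin d → MvPolynomial (Fin n) ℝ)
    (hB : ∀ i j, (B i j).IsHomogeneous ((d - 1 - (i : ℕ)) + (d - 1 - (j : ℕ))))
    (hsymm : ∀ i j, B i j = B j i)
    (hpos : ∀ x : Fin n → ℝ, x ≠ 0 → ∀ y : Fin d → ℝ, y ≠ 0 →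
      0 < ∑ i, ∑ j, y i * y j * eval x (B i j)) :
    ∃ m, d ≤ m ∧ ∃ κ : ℝ, 0 < κ ∧ ∃ B' : Fin d → Fin d → MvPolynomial (Fin n) ℝ,
      (∀ i j, B' i j = B' j i) ∧
      (∀ (u : Fin n → ℝ) (y : Fin d → ℝ), 0 ≤ ∑ i, ∑ j, y i * y j * eval u (B' i j)) ∧
      ∃ f : (Fin n → ℝ) → ℝ, ∀ (x : Fin n → ℝ) (i j : Fin d),
        gaussianIntegral n (linearForm x ^ ((m - (i : ℕ)) + (m - (j : ℕ))) * B' i j) +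
          (if i = j then κ * (∑ l, x l ^ 2) ^ (m - (i : ℕ)) else 0) = f x * eval x (B i j) := by
  obtain ⟨δ, hδ, hlow⟩ := exists_form_lower_bound B hpos
  obtain ⟨m, hm, κ, hκ, B', hB', f, hf⟩ := exists_gaussian_representation_of_lower_bound hn hd B hB
    (half_pos hδ)
    (fun u hu y hy => by simpa only [mul_div_cancel₀ δ two_ne_zero] using hlow u hu y hy)
  refine ⟨m, hm, κ, hκ, fun i j => (1 / 2 : ℝ) • (B' i j + B' j i), fun i j => by
      simp only [add_comm],
    fun u y => ?_, f, fun x i j => ?_⟩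
  · have h1 : ∑ i, ∑ j, y i * y j * eval u (B' j i) = ∑ i, ∑ j, y i * y j * eval u (B' i j) := by
      rw [Finset.sum_comm]
      exact Finset.sum_congr rfl fun i _ => Finset.sum_congr rfl fun j _ => by ring
    refine (hB' u y).trans_eq ?_
    simp only [smul_eval, map_add]
    have h2 : ∀ i j, y i * y j * (1 / 2 * (eval u (B' i j) + eval u (B' j i))) =
        1 / 2 * (y i * y j * eval u (B' i j)) + 1 / 2 * (y i * y j * eval u (B' j i)) := by
      intro i j
      ring
    simp only [h2, Finset.sum_add_distrib, ← Finset.mul_sum, h1]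
    ring
  · have h1 := hf x i j
    have h2 := hf x j i
    rw [hsymm j i, add_comm (m - (j : ℕ))] at h2
    rw [mul_smul_comm, mul_add, map_smul, map_add, smul_eq_mul]
    split_ifs at h1 h2 ⊢ with hij hji
    · subst hij
      linarith
    · exact absurd hij.symm hji
    · rename_i hji
      exact absurd hji.symm hij
    · linarith

end Representation

section Bezoutian

/-- The coefficient of `t ^ i * t' ^ j` in `(t ^ a * t' ^ b - t ^ b * t' ^ a) / (t - t')`. -/
def bezoutCoeff (a b i j : ℕ) : ℤ :=
  if i + j + 1 = a + b then (if b ≤ i ∧ i < a then 1 else if a ≤ i ∧ i < b then -1 else 0) else 0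

theorem bezoutCoeff_antisymm (a b i j : ℕ) : bezoutCoeff a b i j = -bezoutCoeff b a i j := by
  unfold bezoutCoeff
  split_ifs <;> first | rfl | omega

theorem bezoutCoeff_comm (a b i j : ℕ) : bezoutCoeff a b i j = bezoutCoeff a b j i := by
  unfold bezoutCoeff
  split_ifs <;> first | rfl | omega

variable {R : Type*} [CommRing R]

theorem sub_mul_sum_bezoutCoeff_of_le {a b d : ℕ} (hab : b ≤ a) (ha : a ≤ d) (t t' : R) :
    (t - t') * ∑ i ∈ Finset.range d, ∑ j ∈ Finset.range d,
      (bezoutCoeff a b i j : R) * (t ^ i * t' ^ j) = t ^ a * t' ^ b - t ^ b * t' ^ a := by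
  have h1 : ∑ i ∈ Finset.range d, ∑ j ∈ Finset.range d,
      (bezoutCoeff a b i j : R) * (t ^ i * t' ^ j) =
      ∑ i ∈ Finset.Ico b a, t ^ i * t' ^ (a - 1 - i) * t' ^ b := by
    have h2 : Finset.Ico b a ⊆ Finset.range d := by
      intro i hi
      rw [Finset.mem_Ico] at hi
      rw [Finset.mem_range]
      omega
    rw [← Finset.sum_subset h2]
    · refine Finset.sum_congr rfl fun i hi => ?_
      rw [Finset.mem_Ico] at hi
      rw [Finset.sum_eq_single (a - 1 - i + b)]
      · rw [bezoutCoeff, if_pos (by omega), if_pos hi, pow_add]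
        push_cast
        ring
      · intro j _ hj
        rw [bezoutCoeff, if_neg (by omega)]
        simp
      · intro hj
        rw [Finset.mem_range] at hj
        omega
    · intro i _ hi
      rw [Finset.mem_Ico] at hi
      refine Finset.sum_eq_zero fun j _ => ?_
      have h3 : bezoutCoeff a b i j = 0 := by
        unfold bezoutCoeff
        split_ifs <;> first | rfl | omega
      rw [h3, Int.cast_zero, zero_mul]
  rw [h1, ← Finset.sum_mul, ← mul_assoc, mul_geom_sum₂_Ico _ _ hab, sub_mul, mul_assoc, ← pow_add,
    Nat.sub_add_cancel hab]

theorem sub_mul_sum_bezoutCoeff {a b d : ℕ} (ha : a ≤ d) (hb : b ≤ d) (t t' : R) :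
    (t - t') * ∑ i ∈ Finset.range d, ∑ j ∈ Finset.range d,
      (bezoutCoeff a b i j : R) * (t ^ i * t' ^ j) = t ^ a * t' ^ b - t ^ b * t' ^ a := by
  rcases le_total b a with hab | hab
  · exact sub_mul_sum_bezoutCoeff_of_le hab ha t t'
  · have h := sub_mul_sum_bezoutCoeff_of_le hab hb t t'
    simp only [bezoutCoeff_antisymm b a] at h
    simp only [Int.cast_neg, neg_mul, Finset.sum_neg_distrib] at h
    linear_combination -h

/-- The Bezout matrix of `∑ a ≤ d, c a * t ^ a` and its derivative. -/
def bezoutian (d : ℕ) (c : ℕ → R) (i j : ℕ) : R :=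
  ∑ a ∈ Finset.range (d + 1), ∑ b ∈ Finset.range d,
    c a * ((b + 1) * c (b + 1)) * bezoutCoeff a b i j

theorem bezoutian_comm (d : ℕ) (c : ℕ → R) (i j : ℕ) : bezoutian d c i j = bezoutian d c j i := by
  simp only [bezoutian, bezoutCoeff_comm _ _ i j]

theorem map_bezoutian {S : Type*} [CommRing S] (φ : R →+* S) (d : ℕ) (c : ℕ → R) (i j : ℕ) :
    φ (bezoutian d c i j) = bezoutian d (fun a => φ (c a)) i j := by
  simp [bezoutian]

theorem sub_mul_sum_bezoutian (d : ℕ) (c : ℕ → R) (t t' : R) :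
    (t - t') * ∑ i : Fin d, ∑ j : Fin d, bezoutian d c i j * (t ^ (i : ℕ) * t' ^ (j : ℕ)) =
      (∑ a ∈ Finset.range (d + 1), c a * t ^ a) *
        (∑ b ∈ Finset.range d, (b + 1) * c (b + 1) * t' ^ b) -
      (∑ b ∈ Finset.range d, (b + 1) * c (b + 1) * t ^ b) *
        (∑ a ∈ Finset.range (d + 1), c a * t' ^ a) := by
  have h1 : ∑ i : Fin d, ∑ j : Fin d, bezoutian d c i j * (t ^ (i : ℕ) * t' ^ (j : ℕ)) =
      ∑ a ∈ Finset.range (d + 1), ∑ b ∈ Finset.range d, c a * ((b + 1) * c (b + 1)) *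
        ∑ i ∈ Finset.range d, ∑ j ∈ Finset.range d,
          (bezoutCoeff a b i j : R) * (t ^ i * t' ^ j) := by
    have h2 : ∀ F : ℕ → ℕ → R, ∑ i ∈ Finset.range d, ∑ j ∈ Finset.range d, F i j =
        ∑ i : Fin d, ∑ j : Fin d, F i j := by
      intro F
      rw [Finset.sum_range]
      exact Finset.sum_congr rfl fun i _ => Finset.sum_range _
    simp only [h2, bezoutian, Finset.sum_mul, Finset.mul_sum]
    rw [Finset.sum_congr rfl fun i _ => Finset.sum_comm]
    rw [Finset.sum_comm]
    refine Finset.sum_congr rfl fun a _ => ?_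
    rw [Finset.sum_congr rfl fun i _ => Finset.sum_comm]
    rw [Finset.sum_comm]
    refine Finset.sum_congr rfl fun b _ => Finset.sum_congr rfl fun i _ =>
      Finset.sum_congr rfl fun j _ => by ring
  rw [h1, Finset.mul_sum, Finset.sum_mul_sum, mul_comm (∑ b ∈ Finset.range d, _) _,
    Finset.sum_mul_sum, ← Finset.sum_sub_distrib]
  refine Finset.sum_congr rfl fun a ha => ?_
  rw [Finset.mul_sum, ← Finset.sum_sub_distrib]
  refine Finset.sum_congr rfl fun b hb => ?_
  rw [Finset.mem_range] at ha hb
  have := sub_mul_sum_bezoutCoeff (a := a) (b := b) (d := d) (by omega) (by omega) t t'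
  linear_combination c a * ((b + 1) * c (b + 1)) * this

theorem bezoutian_isHomogeneous {σ : Type*} (d : ℕ) (c : ℕ → MvPolynomial σ R)
    (hc : ∀ a ≤ d, (c a).IsHomogeneous (d - a)) (i j : Fin d) :
    (bezoutian d c i j).IsHomogeneous ((d - 1 - (i : ℕ)) + (d - 1 - (j : ℕ))) := by
  refine IsHomogeneous.sum _ _ _ fun a ha => IsHomogeneous.sum _ _ _ fun b hb => ?_
  rw [Finset.mem_range] at ha hb
  by_cases hij : (i : ℕ) + j + 1 = a + b
  · have h1 : (C ((b + 1) * bezoutCoeff a b i j : R) * (c a * c (b + 1)) :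
        MvPolynomial σ R).IsHomogeneous (0 + ((d - a) + (d - (b + 1)))) :=
      (isHomogeneous_C _ _).mul ((hc a (by omega)).mul (hc (b + 1) (by omega)))
    have hi := i.isLt
    have hj := j.isLt
    convert! h1 using 1
    · simp
      ring
    · omega
  · rw [bezoutCoeff, if_neg hij]
    simpa using isHomogeneous_zero σ R _

theorem sum_bezoutian_self (P : Polynomial ℝ) {d : ℕ} (hP : P.natDegree ≤ d) {τ : ℝ}
    (hτ : P.eval τ = 0) :
    ∑ i : Fin d, ∑ j : Fin d, bezoutian d P.coeff i j * (τ ^ (i : ℕ) * τ ^ (j : ℕ)) =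
      P.derivative.eval τ ^ 2 := by
  have h0 : ∀ t, P.eval t = ∑ a ∈ Finset.range (d + 1), P.coeff a * t ^ a := fun t =>
    Polynomial.eval_eq_sum_range' (by omega) t
  have h1 : ∀ t, P.derivative.eval t = ∑ b ∈ Finset.range d, (b + 1) * P.coeff (b + 1) * t ^ b := by
    intro t
    rcases Nat.eq_zero_or_pos d with rfl | hd
    · rw [Polynomial.derivative_of_natDegree_zero (by omega)]
      simp
    · rw [Polynomial.eval_eq_sum_range' (n := d)
        (lt_of_le_of_lt (Polynomial.natDegree_derivative_le P) (by omega))]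
      refine Finset.sum_congr rfl fun b _ => ?_
      rw [Polynomial.coeff_derivative]
      ring
  have key : (Polynomial.X - Polynomial.C τ) * ∑ i : Fin d, ∑ j : Fin d,
      Polynomial.C (bezoutian d P.coeff i j * τ ^ (j : ℕ)) * Polynomial.X ^ (i : ℕ) =
      P * Polynomial.C (P.derivative.eval τ) := by
    refine Polynomial.funext fun t => ?_
    have h2 := sub_mul_sum_bezoutian d P.coeff t τ
    rw [← h0, ← h0, ← h1, ← h1, hτ] at h2
    simp only [Polynomial.eval_mul, Polynomial.eval_sub, Polynomial.eval_X, Polynomial.eval_C,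
      Polynomial.eval_finsetSum, Polynomial.eval_pow]
    rw [mul_zero, sub_zero] at h2
    rw [← h2]
    congr 1
    exact Finset.sum_congr rfl fun i _ => Finset.sum_congr rfl fun j _ => by ring
  have h3 := congrArg (fun Q => Polynomial.eval τ (Polynomial.derivative Q)) key
  simp only [Polynomial.derivative_mul, Polynomial.derivative_sub, Polynomial.derivative_X,
    Polynomial.derivative_C, Polynomial.eval_add, Polynomial.eval_mul, Polynomial.eval_sub,
    Polynomial.eval_X, Polynomial.eval_C, sub_self, zero_mul, add_zero, sub_zero, one_mul,
    mul_zero, Polynomial.eval_finsetSum, Polynomial.eval_pow] at h3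
  rw [pow_two, ← h3]
  exact Finset.sum_congr rfl fun i _ => Finset.sum_congr rfl fun j _ => by ring

theorem sum_bezoutian_ne (P : Polynomial ℝ) {d : ℕ} (hP : P.natDegree ≤ d) {t t' : ℝ}
    (ht : P.eval t = 0) (ht' : P.eval t' = 0) (hne : t ≠ t') :
    ∑ i : Fin d, ∑ j : Fin d, bezoutian d P.coeff i j * (t ^ (i : ℕ) * t' ^ (j : ℕ)) = 0 := by
  have h := sub_mul_sum_bezoutian d P.coeff t t'
  rw [← Polynomial.eval_eq_sum_range' (by omega), ← Polynomial.eval_eq_sum_range' (by omega),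
    ht, ht', zero_mul, mul_zero, sub_zero] at h
  exact (mul_eq_zero.mp h).resolve_left (sub_ne_zero.mpr hne)

theorem bezoutian_posDef (P : Polynomial ℝ) {d : ℕ} (hP : P.natDegree ≤ d) (τ : Fin d → ℝ)
    (hinj : Function.Injective τ) (hτ : ∀ k, P.eval (τ k) = 0)
    (hτ' : ∀ k, P.derivative.eval (τ k) ≠ 0) (y : Fin d → ℝ) (hy : y ≠ 0) :
    0 < ∑ i, ∑ j, y i * y j * bezoutian d P.coeff i j := by
  have hV : IsUnit (Matrix.vandermonde τ) := by
    rw [Matrix.isUnit_iff_isUnit_det, isUnit_iff_ne_zero]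
    exact Matrix.det_vandermonde_ne_zero_iff.mpr hinj
  obtain ⟨z, rfl⟩ := (Matrix.vecMul_surjective_iff_isUnit.mpr hV) y
  have hz : z ≠ 0 := by
    rintro rfl
    simp at hy
  have hyi : ∀ i, (Matrix.vecMul z (Matrix.vandermonde τ)) i = ∑ k, z k * τ k ^ (i : ℕ) := by
    intro i
    simp [Matrix.vecMul, dotProduct, Matrix.vandermonde_apply]
  have h1 : ∑ i, ∑ j, (Matrix.vecMul z (Matrix.vandermonde τ)) i *
      (Matrix.vecMul z (Matrix.vandermonde τ)) j * bezoutian d P.coeff i j =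
      ∑ k, ∑ l, z k * z l * ∑ i : Fin d, ∑ j : Fin d,
        bezoutian d P.coeff i j * (τ k ^ (i : ℕ) * τ l ^ (j : ℕ)) := by
    simp only [hyi, Finset.sum_mul, Finset.mul_sum]
    rw [Finset.sum_congr rfl fun i _ => (Finset.sum_congr rfl fun j _ => Finset.sum_comm).trans
      Finset.sum_comm, Finset.sum_comm, Finset.sum_congr rfl fun k _ =>
      (Finset.sum_congr rfl fun i _ => Finset.sum_comm).trans Finset.sum_comm]
    exact Finset.sum_congr rfl fun k _ => Finset.sum_congr rfl fun l _ =>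
      Finset.sum_congr rfl fun i _ => Finset.sum_congr rfl fun j _ => by ring
  have h2 : ∀ k, ∑ l, z k * z l * ∑ i : Fin d, ∑ j : Fin d,
        bezoutian d P.coeff i j * (τ k ^ (i : ℕ) * τ l ^ (j : ℕ)) =
      (z k * P.derivative.eval (τ k)) ^ 2 := by
    intro k
    rw [Finset.sum_eq_single k]
    · rw [sum_bezoutian_self P hP (hτ k)]
      ring
    · intro l _ hl
      rw [sum_bezoutian_ne P hP (hτ k) (hτ l) fun h => hl (hinj h).symm, mul_zero]
    · simp
  rw [h1, Finset.sum_congr rfl fun k _ => h2 k]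
  obtain ⟨k, hk⟩ := Function.ne_iff.mp hz
  exact Finset.sum_pos' (fun _ _ => sq_nonneg _)
    ⟨k, Finset.mem_univ k, by
      have := mul_ne_zero hk (hτ' k)
      positivity⟩

end Bezoutian

section Kernels

variable {Z : Type*} {n : ℕ}

/-- The kernel `(p, p') ↦ f p * g p'`, bilinearly in `f` and `g`. -/
def tensorKernel (Z : Type*) : (Z → ℝ) →ₗ[ℝ] (Z → ℝ) →ₗ[ℝ] (Z → Z → ℝ) :=
  LinearMap.mk₂ ℝ (fun f g p p' => f p * g p')
    (fun f f' g => by ext; simp [add_mul]) (fun c f g => by ext; simp [mul_assoc])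
    (fun f g g' => by ext; simp [mul_add]) (fun c f g => by ext; simp [mul_left_comm])

@[simp] theorem tensorKernel_apply (f g : Z → ℝ) (p p' : Z) :
    tensorKernel Z f g p p' = f p * g p' := rfl

/-- The function `t ^ i * x ^ A`. -/
def monomialFun (t : Z → ℝ) (x : Z → Fin n → ℝ) (i : ℕ) (A : Fin n →₀ ℕ) : Z → ℝ :=
  fun p => t p ^ i * ∏ k, x p k ^ A k

/-- The span of the functions `t ^ i * x ^ A` of total degree `m` with `i < d`. -/
def formSpan (t : Z → ℝ) (x : Z → Fin n → ℝ) (d m : ℕ) : Submodule ℝ (Z → ℝ) :=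
  Submodule.span ℝ {f | ∃ i A, i < d ∧ i + A.degree = m ∧ f = monomialFun t x i A}

/-- The span of the kernels `f p * g p'` with `f`, `g` in `formSpan t x d m`. -/
def kernelSpan (t : Z → ℝ) (x : Z → Fin n → ℝ) (d m : ℕ) : Submodule ℝ (Z → Z → ℝ) :=
  Submodule.map₂ (tensorKernel Z) (formSpan t x d m) (formSpan t x d m)

/-- The span of the kernels of degree `m + 1` divisible by some `x k * x' l - x l * x' k`. -/
def minorSpan (t : Z → ℝ) (x : Z → Fin n → ℝ) (d m : ℕ) : Submodule ℝ (Z → Z → ℝ) :=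
  Submodule.span ℝ {K | ∃ k l f g, f ∈ formSpan t x d m ∧ g ∈ formSpan t x d m ∧
    K = fun p p' => (x p k * x p' l - x p l * x p' k) * (f p * g p')}

variable {t : Z → ℝ} {x : Z → Fin n → ℝ} {d m : ℕ}

theorem monomialFun_mem {i : ℕ} {A : Fin n →₀ ℕ} (hi : i < d) (hA : i + A.degree = m) :
    monomialFun t x i A ∈ formSpan t x d m :=
  Submodule.subset_span ⟨i, A, hi, hA, rfl⟩

theorem monomialFun_add_single (i : ℕ) (A : Fin n →₀ ℕ) (k : Fin n) (p : Z) :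
    monomialFun t x i (A + Finsupp.single k 1) p = x p k * monomialFun t x i A p := by
  have h : ∏ l, x p l ^ (A + Finsupp.single k 1 : Fin n →₀ ℕ) l = x p k * ∏ l, x p l ^ A l := by
    simp only [Finsupp.add_apply, pow_add, Finset.prod_mul_distrib]
    rw [mul_comm]
    congr 1
    rw [Finset.prod_eq_single k]
    · simp
    · intro l _ hl
      simp [Finsupp.single_eq_of_ne hl]
    · simp
  rw [monomialFun, monomialFun, h]
  ring

theorem tensorKernel_sub_mem_minorSpan {i j : ℕ} (hi : i < d) (hj : j < d)
    (A B A' B' : Fin n →₀ ℕ) (hA : i + A.degree = m + 1) (hB : j + B.degree = m + 1)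
    (hA' : i + A'.degree = m + 1) (hAB : A + B = A' + B') :
    tensorKernel Z (monomialFun t x i A) (monomialFun t x j B) -
      tensorKernel Z (monomialFun t x i A') (monomialFun t x j B') ∈ minorSpan t x d m := by
  induction hN : (A' - A).degree generalizing A B with
  | zero =>
    rw [Finsupp.degree_eq_zero_iff, tsub_eq_zero_iff_le] at hN
    have h1 : A' = A := by
      have h2 := congrArg Finsupp.degree (add_tsub_cancel_of_le hN)
      rw [map_add] at h2
      have h3 : (A - A').degree = 0 := by omega
      rw [Finsupp.degree_eq_zero_iff, tsub_eq_zero_iff_le] at h3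
      exact le_antisymm hN h3
    subst h1
    rw [add_left_cancel hAB, sub_self]
    exact Submodule.zero_mem _
  | succ N ih =>
    obtain ⟨k, hk⟩ : ∃ k, A k < A' k := by
      by_contra! h
      rw [tsub_eq_zero_of_le (show A' ≤ A from h)] at hN
      simp at hN
    obtain ⟨l, hl⟩ : ∃ l, A' l < A l := by
      by_contra! h
      have h2 := congrArg Finsupp.degree (add_tsub_cancel_of_le (show A ≤ A' from h))
      rw [map_add] at h2
      omega
    have hkl : k ≠ l := by
      rintro rfl
      omega
    have hABk := DFunLike.congr_fun hAB k
    have hABl := DFunLike.congr_fun hAB l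
    simp only [Finsupp.add_apply] at hABk hABl
    have hlA : Finsupp.single l 1 ≤ A := by
      rw [Finsupp.single_le_iff]
      omega
    have hkB : Finsupp.single k 1 ≤ B := by
      rw [Finsupp.single_le_iff]
      omega
    obtain ⟨A₀, rfl⟩ := exists_add_of_le hlA
    obtain ⟨B₀, rfl⟩ := exists_add_of_le hkB
    rw [add_comm (Finsupp.single l 1)] at *
    rw [add_comm (Finsupp.single k 1)] at *
    simp only [map_add, Finsupp.degree_single] at hA hB
    have h1 := ih (A₀ + Finsupp.single k 1) (B₀ + Finsupp.single l 1)
      (by simpa using hA) (by simpa using hB) (by rw [← hAB]; abel) (by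
        have h3 : A' - (A₀ + Finsupp.single l 1) =
            A' - (A₀ + Finsupp.single k 1) + Finsupp.single k 1 := by
          ext r
          simp only [Finsupp.tsub_apply, Finsupp.add_apply, Finsupp.single_apply] at hk hl ⊢
          rw [if_neg hkl.symm] at hk
          rw [if_pos trivial] at hl
          by_cases hrk : k = r
          · subst hrk
            rw [if_neg hkl.symm, if_pos rfl]
            omega
          · by_cases hrl : l = r
            · subst hrl
              rw [if_neg hrk, if_pos rfl]
              omega
            · rw [if_neg hrk, if_neg hrl]
              omega
        rw [h3, map_add, Finsupp.degree_single] at hN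
        omega)
    have h2 : tensorKernel Z (monomialFun t x i (A₀ + Finsupp.single l 1))
          (monomialFun t x j (B₀ + Finsupp.single k 1)) -
        tensorKernel Z (monomialFun t x i (A₀ + Finsupp.single k 1))
          (monomialFun t x j (B₀ + Finsupp.single l 1)) ∈ minorSpan t x d m := by
      refine Submodule.subset_span ⟨l, k, monomialFun t x i A₀, monomialFun t x j B₀,
        monomialFun_mem hi (by omega), monomialFun_mem hj (by omega), ?_⟩
      ext p p'
      simp only [Pi.sub_apply, tensorKernel_apply, monomialFun_add_single]
      ring
    have h3 := add_mem h2 h1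
    rwa [sub_add_sub_cancel] at h3

theorem MvPolynomial.eq_zero_of_eval_eq_zero_off_zero (hn : 0 < n) (P : MvPolynomial (Fin n) ℝ)
    (hP : ∀ u : Fin n → ℝ, u ≠ 0 → eval u P = 0) : P = 0 := by
  have h : X ⟨0, hn⟩ * P = 0 := by
    refine MvPolynomial.funext fun u => ?_
    by_cases hu : u = 0
    · simp [hu]
    · simp [hP u hu]
  exact (mul_eq_zero.mp h).resolve_left (X_ne_zero _)

theorem finsupp_eq_zero_of_eval_eq_zero (hn : 0 < n)
    (hroots : ∀ u : Fin n → ℝ, u ≠ 0 → ∃ τ : Fin d → ℝ, Function.Injective τ ∧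
      ∀ k, ∃ p, t p = τ k ∧ x p = u)
    (e : (Fin d × Fin d × (Fin n →₀ ℕ)) →₀ ℝ)
    (he : ∀ p p', x p = x p' → Finsupp.linearCombination ℝ
      (fun l : Fin d × Fin d × (Fin n →₀ ℕ) =>
        t p ^ (l.1 : ℕ) * t p' ^ (l.2.1 : ℕ) * ∏ k, x p k ^ l.2.2 k) e = 0) : e = 0 := by
  classical
  let P : Fin d → Fin d → MvPolynomial (Fin n) ℝ := fun i j => Finsupp.linearCombination ℝ
    (fun l : Fin d × Fin d × (Fin n →₀ ℕ) =>
      if l.1 = i ∧ l.2.1 = j then monomial l.2.2 (1 : ℝ) else 0) e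
  have hcoeff : ∀ i j C, coeff C (P i j) = e (i, j, C) := by
    intro i j C
    simp only [P, Finsupp.linearCombination_apply, Finsupp.sum, coeff_sum, coeff_smul]
    rw [Finset.sum_eq_single (i, j, C)]
    · simp
    · rintro ⟨i', j', C'⟩ _ hl
      split_ifs with hij
      · obtain ⟨rfl, rfl⟩ := hij
        rw [coeff_monomial, if_neg, smul_zero]
        rintro rfl
        exact hl rfl
      · simp
    · intro hl
      rw [Finsupp.notMem_support_iff.mp hl, zero_smul]
  have heval : ∀ p p', x p = x p' →
      ∑ i, ∑ j, eval (x p) (P i j) * (t p ^ (i : ℕ) * t p' ^ (j : ℕ)) = 0 := by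
    intro p p' hpp'
    rw [← he p p' hpp']
    simp only [P, Finsupp.linearCombination_apply, Finsupp.sum, map_sum, smul_eval, Finset.sum_mul]
    rw [Finset.sum_congr rfl fun i _ => Finset.sum_comm, Finset.sum_comm]
    refine Finset.sum_congr rfl fun l _ => ?_
    rw [Finset.sum_eq_single l.1, Finset.sum_eq_single l.2.1]
    · rw [if_pos ⟨rfl, rfl⟩, eval_monomial, Finsupp.prod_fintype _ _ fun _ => pow_zero _]
      simp only [smul_eq_mul]
      ring
    · intro j _ hj
      rw [if_neg fun h => hj h.2.symm]
      simp
    · simp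
    · intro i _ hi
      refine Finset.sum_eq_zero fun j _ => ?_
      rw [if_neg fun h => hi h.1.symm]
      simp
    · simp
  have hP : ∀ i j, P i j = 0 := by
    intro i j
    refine eq_zero_of_eval_eq_zero_off_zero hn _ fun u hu => ?_
    obtain ⟨τ, hτ, hp⟩ := hroots u hu
    have h1 : ∀ k l, ∑ i, (∑ j, eval u (P i j) * τ l ^ (j : ℕ)) * τ k ^ (i : ℕ) = 0 := by
      intro k l
      obtain ⟨p, hp1, hp2⟩ := hp k
      obtain ⟨p', hp1', hp2'⟩ := hp l
      rw [← heval p p' (hp2.trans hp2'.symm), hp1, hp1', hp2]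
      refine Finset.sum_congr rfl fun i _ => ?_
      rw [Finset.sum_mul]
      exact Finset.sum_congr rfl fun j _ => by ring
    have h2 : ∀ l, (fun i => ∑ j, eval u (P i j) * τ l ^ (j : ℕ)) = 0 := fun l =>
      Matrix.eq_zero_of_forall_index_sum_mul_pow_eq_zero hτ fun k => h1 k l
    have h3 : (fun j => eval u (P i j)) = 0 :=
      Matrix.eq_zero_of_forall_index_sum_mul_pow_eq_zero hτ fun l => congrFun (h2 l) i
    exact congrFun h3 j
  ext ⟨i, j, C⟩
  rw [← hcoeff, hP, coeff_zero, Finsupp.zero_apply]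

theorem mem_minorSpan_of_eq_zero (hn : 0 < n)
    (hroots : ∀ u : Fin n → ℝ, u ≠ 0 → ∃ τ : Fin d → ℝ, Function.Injective τ ∧
      ∀ k, ∃ p, t p = τ k ∧ x p = u)
    (K : Z → Z → ℝ) (hK : K ∈ kernelSpan t x d (m + 1))
    (hzero : ∀ p p', x p = x p' → K p p' = 0) : K ∈ minorSpan t x d m := by
  let I := {q : (Fin d × (Fin n →₀ ℕ)) × (Fin d × (Fin n →₀ ℕ)) //
    (q.1.1 : ℕ) + q.1.2.degree = m + 1 ∧ (q.2.1 : ℕ) + q.2.2.degree = m + 1}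
  let κ : I → Z → Z → ℝ := fun q => tensorKernel Z
    (monomialFun t x q.1.1.1 q.1.1.2) (monomialFun t x q.1.2.1 q.1.2.2)
  let π : I → Fin d × Fin d × (Fin n →₀ ℕ) := fun q => (q.1.1.1, q.1.2.1, q.1.1.2 + q.1.2.2)
  have hspan : K ∈ Submodule.span ℝ (Set.range κ) := by
    rw [kernelSpan, formSpan, Submodule.map₂_span_span] at hK
    refine Submodule.span_mono ?_ hK
    rintro _ ⟨_, ⟨i, A, hi, hA, rfl⟩, _, ⟨j, B, hj, hB, rfl⟩, rfl⟩
    exact ⟨⟨((⟨i, hi⟩, A), (⟨j, hj⟩, B)), hA, hB⟩, rfl⟩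
  rw [← Finsupp.range_linearCombination] at hspan
  obtain ⟨f, rfl⟩ := hspan
  have he : Finsupp.mapDomain π f = 0 := by
    refine finsupp_eq_zero_of_eval_eq_zero hn hroots _ fun p p' hpp' => ?_
    rw [Finsupp.linearCombination_mapDomain, ← hzero p p' hpp']
    simp only [Finsupp.linearCombination_apply, Finsupp.sum, Finset.sum_apply, Pi.smul_apply]
    refine Finset.sum_congr rfl fun q _ => ?_
    simp only [Function.comp_apply, π, κ, tensorKernel_apply, monomialFun, Finsupp.add_apply,
      pow_add, Finset.prod_mul_distrib, ← hpp']
    congr 1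
    ring
  have hfac : Function.FactorsThrough (fun q => (minorSpan t x d m).mkQ (κ q)) π := by
    rintro ⟨⟨⟨i, A⟩, ⟨j, B⟩⟩, hA, hB⟩ ⟨⟨⟨i', A'⟩, ⟨j', B'⟩⟩, hA', hB'⟩ h
    simp only [π, Prod.mk.injEq] at h
    obtain ⟨rfl, rfl, h⟩ := h
    exact (Submodule.Quotient.eq _).mpr
      (tensorKernel_sub_mem_minorSpan i.isLt j.isLt A B A' B' hA hB hA' h)
  rw [← Submodule.Quotient.mk_eq_zero, ← Submodule.mkQ_apply, Finsupp.apply_linearCombination]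
  have h2 : (minorSpan t x d m).mkQ ∘ κ =
      Function.extend π (fun q => (minorSpan t x d m).mkQ (κ q)) 0 ∘ π := by
    ext1 q
    exact (hfac.extend_apply 0 q).symm
  rw [h2, ← Finsupp.linearCombination_mapDomain, he, map_zero]

end Kernels

section KernelDecomposition

variable {Z : Type*} {n : ℕ} {t : Z → ℝ} {x : Z → Fin n → ℝ} {d m : ℕ}

theorem tensorKernel_mem {f g : Z → ℝ} (hf : f ∈ formSpan t x d m) (hg : g ∈ formSpan t x d m) :
    tensorKernel Z f g ∈ kernelSpan t x d m :=
  Submodule.apply_mem_map₂ _ hf hg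

theorem kernelSpan_swap {K : Z → Z → ℝ} (hK : K ∈ kernelSpan t x d m) :
    (fun p p' => K p' p) ∈ kernelSpan t x d m := by
  let S : (Z → Z → ℝ) →ₗ[ℝ] (Z → Z → ℝ) :=
    { toFun := fun K p p' => K p' p, map_add' := fun _ _ => rfl, map_smul' := fun _ _ => rfl }
  have h : kernelSpan t x d m ≤ (kernelSpan t x d m).comap S := by
    refine Submodule.map₂_le.mpr fun f hf g hg => ?_
    rw [Submodule.mem_comap]
    convert! tensorKernel_mem hg hf using 1
    ext p p'
    exact mul_comm _ _
  exact h hK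

theorem kernelSpan_mul {m' : ℕ} {u v : Z → ℝ}
    (hu : ∀ f ∈ formSpan t x d m, (fun p => u p * f p) ∈ formSpan t x d m')
    (hv : ∀ f ∈ formSpan t x d m, (fun p => v p * f p) ∈ formSpan t x d m') {K : Z → Z → ℝ}
    (hK : K ∈ kernelSpan t x d m) : (fun p p' => u p * v p' * K p p') ∈ kernelSpan t x d m' := by
  let S : (Z → Z → ℝ) →ₗ[ℝ] (Z → Z → ℝ) :=
    { toFun := fun K p p' => u p * v p' * K p p'
      map_add' := fun _ _ => by ext; simp [mul_add]
      map_smul' := fun _ _ => by ext; simp [mul_left_comm] }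
  have h : kernelSpan t x d m ≤ (kernelSpan t x d m').comap S := by
    refine Submodule.map₂_le.mpr fun f hf g hg => ?_
    rw [Submodule.mem_comap]
    convert! tensorKernel_mem (hu f hf) (hv g hg) using 1
    ext p p'
    simp only [S, LinearMap.coe_mk, AddHom.coe_mk, tensorKernel_apply]
    ring
  exact h hK

theorem formSpan_mul_of_forall {m' : ℕ} {u : Z → ℝ}
    (hu : ∀ i A, i < d → i + A.degree = m →
      (fun p => u p * monomialFun t x i A p) ∈ formSpan t x d m') :
    ∀ f ∈ formSpan t x d m, (fun p => u p * f p) ∈ formSpan t x d m' := by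
  let S : (Z → ℝ) →ₗ[ℝ] (Z → ℝ) :=
    { toFun := fun f p => u p * f p
      map_add' := fun _ _ => by ext; simp [mul_add]
      map_smul' := fun _ _ => by ext; simp [mul_left_comm] }
  have h : formSpan t x d m ≤ (formSpan t x d m').comap S := by
    refine Submodule.span_le.mpr ?_
    rintro _ ⟨i, A, hi, hA, rfl⟩
    exact hu i A hi hA
  exact fun f hf => h hf

theorem formSpan_x_mul (k : Fin n) :
    ∀ f ∈ formSpan t x d m, (fun p => x p k * f p) ∈ formSpan t x d (m + 1) := by
  refine formSpan_mul_of_forall fun i A hi hA => ?_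
  simp only [← monomialFun_add_single]
  exact monomialFun_mem hi (by rw [map_add, Finsupp.degree_single]; omega)

theorem pow_mul_eval_mem_formSpan {i r : ℕ} (hi : i < d) {q : MvPolynomial (Fin n) ℝ}
    (hq : q.IsHomogeneous r) (hm : i + r = m) :
    (fun p => t p ^ i * eval (x p) q) ∈ formSpan t x d m := by
  have h : (fun p => t p ^ i * eval (x p) q) =
      ∑ A ∈ q.support, coeff A q • monomialFun t x i A := by
    ext p
    rw [eval_eq', Finset.mul_sum, Finset.sum_apply]
    refine Finset.sum_congr rfl fun A _ => ?_
    simp only [Pi.smul_apply, smul_eq_mul, monomialFun]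
    ring
  rw [h]
  refine Submodule.sum_mem _ fun A hA => Submodule.smul_mem _ _ (monomialFun_mem hi ?_)
  rw [← hm, Finsupp.degree_eq_weight_one]
  congr 1
  exact hq (mem_support_iff.mp hA)

theorem formSpan_t_mul (g : ℕ → MvPolynomial (Fin n) ℝ)
    (hg : ∀ a < d, (g a).IsHomogeneous (d - a))
    (hrel : ∀ p, t p ^ d = ∑ a ∈ Finset.range d, eval (x p) (g a) * t p ^ a) :
    ∀ f ∈ formSpan t x d m, (fun p => t p * f p) ∈ formSpan t x d (m + 1) := by
  refine formSpan_mul_of_forall fun i A hi hA => ?_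
  by_cases hid : i + 1 < d
  · convert! monomialFun_mem (t := t) (x := x) (A := A) hid (show i + 1 + A.degree = m + 1 by omega)
      using 1
    ext p
    simp only [monomialFun]
    ring
  · obtain rfl : d = i + 1 := by omega
    have h : (fun p => t p * monomialFun t x i A p) = ∑ a ∈ Finset.range (i + 1),
        fun p => t p ^ a * eval (x p) (g a * monomial A 1) := by
      ext p
      rw [monomialFun, ← mul_assoc, ← pow_succ', hrel, Finset.sum_mul, Finset.sum_apply]
      refine Finset.sum_congr rfl fun a _ => ?_
      rw [map_mul, eval_monomial, Finsupp.prod_fintype _ _ fun _ => pow_zero _]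
      ring
    rw [h]
    refine Submodule.sum_mem _ fun a ha => ?_
    rw [Finset.mem_range] at ha
    exact pow_mul_eval_mem_formSpan ha ((hg a ha).mul (isHomogeneous_monomial 1 rfl)) (by omega)

theorem exists_eq_sum_of_mem_minorSpan {K : Z → Z → ℝ} (hK : K ∈ minorSpan t x d m) :
    ∃ b : Fin n → Fin n → Z → Z → ℝ, (∀ k l, b k l ∈ kernelSpan t x d m) ∧
      ∀ p p', K p p' = ∑ k, ∑ l, (x p k * x p' l - x p l * x p' k) * b k l p p' := by
  classical
  induction hK using Submodule.span_induction with
  | mem K hK =>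
    obtain ⟨k, l, f, g, hf, hg, rfl⟩ := hK
    refine ⟨fun k' l' => if k' = k ∧ l' = l then tensorKernel Z f g else 0,
      fun k' l' => ?_, fun p p' => ?_⟩
    · dsimp only
      split_ifs
      · exact tensorKernel_mem hf hg
      · exact Submodule.zero_mem _
    · dsimp only
      rw [Finset.sum_eq_single k, Finset.sum_eq_single l]
      · rw [if_pos ⟨rfl, rfl⟩]
        rfl
      · intro l' _ hl
        rw [if_neg fun h => hl h.2]
        simp
      · simp
      · intro k' _ hk
        refine Finset.sum_eq_zero fun l' _ => ?_
        rw [if_neg fun h => hk h.1]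
        simp
      · simp
  | zero => exact ⟨fun _ _ => 0, fun _ _ => Submodule.zero_mem _, fun p p' => by simp⟩
  | add K K' _ _ h h' =>
    obtain ⟨b, hb, hb'⟩ := h
    obtain ⟨c, hc, hc'⟩ := h'
    refine ⟨fun k l => b k l + c k l, fun k l => add_mem (hb k l) (hc k l), fun p p' => ?_⟩
    simp only [Pi.add_apply, mul_add, Finset.sum_add_distrib, hb', hc']
  | smul r K _ h =>
    obtain ⟨b, hb, hb'⟩ := h
    refine ⟨fun k l => r • b k l, fun k l => Submodule.smul_mem _ _ (hb k l), fun p p' => ?_⟩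
    simp only [Pi.smul_apply, smul_eq_mul, hb', Finset.mul_sum]
    exact Finset.sum_congr rfl fun k _ => Finset.sum_congr rfl fun l _ => by ring

theorem exists_antisymm_of_mem_minorSpan {K : Z → Z → ℝ} (hK : K ∈ minorSpan t x d m)
    (hanti : ∀ p p', K p' p = -K p p') :
    ∃ b : Fin n → Fin n → Z → Z → ℝ, (∀ k l, b k l ∈ kernelSpan t x d m) ∧
      (∀ k l p p', b k l p' p = b k l p p') ∧ (∀ k l p p', b l k p p' = -b k l p p') ∧
      ∀ p p', K p p' = ∑ k, ∑ l, x p k * x p' l * b k l p p' := by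
  obtain ⟨b, hb, hK⟩ := exists_eq_sum_of_mem_minorSpan hK
  have h1 : ∀ p p', K p p' = ∑ k, ∑ l, x p k * x p' l * (b k l p p' - b l k p p') := by
    intro p p'
    simp only [hK, mul_sub, sub_mul, Finset.sum_sub_distrib]
    congr 1
    exact Finset.sum_comm
  refine ⟨fun k l p p' => (1 / 2 : ℝ) * ((b k l p p' - b l k p p') + (b k l p' p - b l k p' p)),
    fun k l => ?_, fun k l p p' => by ring, fun k l p p' => by ring, fun p p' => ?_⟩
  · exact Submodule.smul_mem _ (1 / 2 : ℝ) (add_mem (sub_mem (hb k l) (hb l k))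
      (sub_mem (kernelSpan_swap (hb k l)) (kernelSpan_swap (hb l k))))
  · have h2 : K p p' = ∑ k, ∑ l, x p k * x p' l * (b k l p' p - b l k p' p) := by
      rw [← neg_neg (K p p'), ← hanti, h1, Finset.sum_comm, ← Finset.sum_neg_distrib]
      refine Finset.sum_congr rfl fun k _ => ?_
      rw [← Finset.sum_neg_distrib]
      exact Finset.sum_congr rfl fun l _ => by ring
    have h3 : K p p' = (1 / 2) * (K p p' + K p p') := by ring
    rw [h3]
    nth_rewrite 1 [h1]
    rw [h2, ← Finset.sum_add_distrib, Finset.mul_sum]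
    refine Finset.sum_congr rfl fun k _ => ?_
    rw [← Finset.sum_add_distrib, Finset.mul_sum]
    exact Finset.sum_congr rfl fun l _ => by ring

theorem exists_symmetric_kernels (hn : 0 < n)
    (hroots : ∀ u : Fin n → ℝ, u ≠ 0 → ∃ τ : Fin d → ℝ, Function.Injective τ ∧
      ∀ k, ∃ p, t p = τ k ∧ x p = u)
    (ht : ∀ f ∈ formSpan t x d m, (fun p => t p * f p) ∈ formSpan t x d (m + 1))
    {G : Z → Z → ℝ} (hG : G ∈ kernelSpan t x d m) (hsymm : ∀ p p', G p' p = G p p')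
    (hdiag : ∀ p p', x p = x p' → (t p - t p') * G p p' = 0) :
    ∃ a : Fin n → Z → Z → ℝ, (∀ k, a k ∈ kernelSpan t x d (m + 1)) ∧
      (∀ k p p', a k p' p = a k p p') ∧
      ∀ p p', ∑ k, x p k * a k p p' = t p * ((∑ k, x p k * x p' k) * G p p') := by
  have hx := fun k => formSpan_x_mul (t := t) (x := x) (d := d) (m := m) k
  have hH : ∀ j, ∃ b : Fin n → Fin n → Z → Z → ℝ, (∀ k l, b k l ∈ kernelSpan t x d m) ∧
      (∀ k l p p', b k l p' p = b k l p p') ∧ (∀ k l p p', b l k p p' = -b k l p p') ∧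
      ∀ p p', t p * x p' j * G p p' - x p j * t p' * G p p' =
        ∑ k, ∑ l, x p k * x p' l * b k l p p' := by
    intro j
    refine exists_antisymm_of_mem_minorSpan
      (K := fun p p' => t p * x p' j * G p p' - x p j * t p' * G p p')
      (mem_minorSpan_of_eq_zero hn hroots _ (sub_mem (kernelSpan_mul ht (hx j) hG)
        (kernelSpan_mul (hx j) ht hG)) fun p p' hpp' => ?_) fun p p' => ?_
    · have := hdiag p p' hpp'
      rw [hpp']
      linear_combination x p' j * this
    · simp only [hsymm p p']
      ring
  choose b hb1 hb2 hb3 hb4 using hH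
  refine ⟨fun k p p' => (1 / 2 : ℝ) * ((t p * x p' k * G p p' + x p k * t p' * G p p') +
    ∑ j, ∑ l, (x p j * x p' l * b j k l p p' + x p l * x p' j * b j k l p p')),
    fun k => ?_, fun k p p' => ?_, fun p p' => ?_⟩
  · have h1 : (fun p p' => ∑ j, ∑ l, (x p j * x p' l * b j k l p p' +
        x p l * x p' j * b j k l p p')) ∈ kernelSpan t x d (m + 1) := by
      have h2 : (∑ j, ∑ l, ((fun p p' => x p j * x p' l * b j k l p p') +
          fun p p' => x p l * x p' j * b j k l p p')) ∈ kernelSpan t x d (m + 1) :=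
        Submodule.sum_mem _ fun j _ => Submodule.sum_mem _ fun l _ =>
          add_mem (kernelSpan_mul (hx j) (hx l) (hb1 j k l))
            (kernelSpan_mul (hx l) (hx j) (hb1 j k l))
      convert! h2 using 1
      ext p p'
      simp only [Finset.sum_apply, Pi.add_apply]
    exact Submodule.smul_mem _ (1 / 2 : ℝ) (add_mem (add_mem (kernelSpan_mul ht (hx k) hG)
      (kernelSpan_mul (hx k) ht hG)) h1)
  · simp only [hb2 _ _ _ p p', hsymm p p']
    congr 2
    · ring
    · exact Finset.sum_congr rfl fun j _ => Finset.sum_congr rfl fun l _ => by ring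
  · have h1 : ∑ k, ∑ j, ∑ l, x p k * (x p l * x p' j * b j k l p p') = 0 := by
      rw [Finset.sum_comm]
      refine Finset.sum_eq_zero fun j _ => ?_
      have h2 : ∑ k, ∑ l, x p k * (x p l * x p' j * b j k l p p') =
          -∑ k, ∑ l, x p k * (x p l * x p' j * b j k l p p') := by
        nth_rewrite 1 [Finset.sum_comm]
        rw [← Finset.sum_neg_distrib]
        refine Finset.sum_congr rfl fun k _ => ?_
        rw [← Finset.sum_neg_distrib]
        refine Finset.sum_congr rfl fun l _ => ?_
        rw [hb3 j k l]
        ring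
      linarith
    have h3 : ∑ k, ∑ j, ∑ l, x p k * (x p j * x p' l * b j k l p p') =
        ∑ j, x p j * (t p * x p' j * G p p' - x p j * t p' * G p p') := by
      rw [Finset.sum_comm]
      refine Finset.sum_congr rfl fun j _ => ?_
      rw [hb4, Finset.mul_sum]
      refine Finset.sum_congr rfl fun k _ => ?_
      rw [Finset.mul_sum]
      exact Finset.sum_congr rfl fun l _ => by ring
    have h4 : ∀ k, x p k * ((1 / 2 : ℝ) * ((t p * x p' k * G p p' + x p k * t p' * G p p') +
        ∑ j, ∑ l, (x p j * x p' l * b j k l p p' + x p l * x p' j * b j k l p p'))) =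
        (1 / 2 : ℝ) * (x p k * (t p * x p' k * G p p' + x p k * t p' * G p p')) +
        ((1 / 2 : ℝ) * (∑ j, ∑ l, x p k * (x p j * x p' l * b j k l p p')) +
          (1 / 2 : ℝ) * (∑ j, ∑ l, x p k * (x p l * x p' j * b j k l p p'))) := by
      intro k
      simp only [Finset.sum_add_distrib, ← Finset.mul_sum]
      ring
    rw [Finset.sum_congr rfl fun k _ => h4 k, Finset.sum_add_distrib, Finset.sum_add_distrib,
      ← Finset.mul_sum, ← Finset.mul_sum, ← Finset.mul_sum, h1, h3, mul_zero, add_zero,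
      ← mul_add, ← Finset.sum_add_distrib, Finset.mul_sum, Finset.sum_mul, Finset.mul_sum]
    exact Finset.sum_congr rfl fun k _ => by ring

end KernelDecomposition

section GaussianKernel

variable {Z : Type*} {n d m : ℕ}

/-- Words `(i, σ)` of total degree `m`, indexing the monomials `t ^ i * ∏ a, x (σ a)`. -/
abbrev Word (n d m : ℕ) : Type := (i : Fin d) × (Fin (m - (i : ℕ)) → Fin n)

/-- The function `t ^ i * ∏ a, x (σ a)`. -/
def wordFun (t : Z → ℝ) (x : Z → Fin n → ℝ) (w : Word n d m) : Z → ℝ :=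
  fun p => t p ^ (w.1 : ℕ) * ∏ a, x p (w.2 a)

/-- The Gram-type matrix of the Gaussian integral weighted by a matrix of polynomials. -/
noncomputable def gaussianMatrix (m : ℕ) (B : Fin d → Fin d → MvPolynomial (Fin n) ℝ) :
    Matrix (Word n d m) (Word n d m) ℝ :=
  Matrix.of fun w w' => gaussianIntegral n ((∏ a, X (w.2 a)) * (∏ b, X (w'.2 b)) * B w.1 w'.1)

theorem gaussianMatrix_posSemidef (B : Fin d → Fin d → MvPolynomial (Fin n) ℝ)
    (hsymm : ∀ i j, B i j = B j i)
    (hpos : ∀ (u : Fin n → ℝ) (y : Fin d → ℝ), 0 ≤ ∑ i, ∑ j, y i * y j * eval u (B i j)) :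
    (gaussianMatrix m B).PosSemidef := by
  refine Matrix.PosSemidef.of_dotProduct_mulVec_nonneg ?_ fun c => ?_
  · ext w w'
    simp only [Matrix.conjTranspose_apply, star_trivial, gaussianMatrix, Matrix.of_apply]
    rw [hsymm, mul_comm (∏ a, X (w'.2 a))]
  · have h1 : star c ⬝ᵥ (gaussianMatrix m B).mulVec c = gaussianIntegral n
        (∑ w, ∑ w', (c w * c w') • ((∏ a, X (w.2 a)) * (∏ b, X (w'.2 b)) * B w.1 w'.1)) := by
      simp only [dotProduct, Matrix.mulVec, star_trivial, gaussianMatrix, Matrix.of_apply, map_sum,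
        map_smul, smul_eq_mul, Finset.mul_sum]
      exact Finset.sum_congr rfl fun w _ => Finset.sum_congr rfl fun w' _ => by ring
    rw [h1]
    refine gaussianIntegral_nonneg _ fun u => ?_
    refine (hpos u fun i => ∑ σ : Fin (m - (i : ℕ)) → Fin n,
      c ⟨i, σ⟩ * ∏ a, u (σ a)).trans_eq ?_
    simp only [map_sum, smul_eval, map_mul, map_prod, eval_X, Fintype.sum_sigma, Finset.sum_mul,
      Finset.mul_sum]
    refine Finset.sum_congr rfl fun i _ => ?_
    symm
    rw [Finset.sum_comm]
    refine Finset.sum_congr rfl fun j _ => ?_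
    rw [Finset.sum_comm]
    exact Finset.sum_congr rfl fun σ _ => Finset.sum_congr rfl fun ρ _ => by ring

theorem exists_word_prod (u : Z → Fin n → ℝ) (r : ℕ) (A : Fin n →₀ ℕ) (hA : A.degree = r) :
    ∃ σ : Fin r → Fin n, ∀ p, ∏ k, u p k ^ A k = ∏ a, u p (σ a) := by
  induction r generalizing A with
  | zero =>
    rw [Finsupp.degree_eq_zero_iff] at hA
    subst hA
    exact ⟨Fin.elim0, fun p => by simp⟩
  | succ r ih =>
    obtain ⟨k, hk⟩ : ∃ k, A k ≠ 0 := by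
      by_contra! h0
      have : A = 0 := Finsupp.ext h0
      simp [this] at hA
    obtain ⟨A₀, rfl⟩ := exists_add_of_le (show Finsupp.single k 1 ≤ A by
      rw [Finsupp.single_le_iff]
      omega)
    rw [map_add, Finsupp.degree_single] at hA
    obtain ⟨σ, hσ⟩ := ih A₀ (by omega)
    refine ⟨Fin.cons k σ, fun p => ?_⟩
    have := monomialFun_add_single (t := fun _ => 1) (x := u) 0 A₀ k p
    simp only [monomialFun, pow_zero, one_mul] at this
    rw [add_comm, this, hσ, Fin.prod_univ_succ]
    simp

variable {t : Z → ℝ} {x : Z → Fin n → ℝ}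

theorem wordFun_mem (hm : d ≤ m) (w : Word n d m) : wordFun t x w ∈ formSpan t x d m := by
  have h := pow_mul_eval_mem_formSpan (t := t) (x := x) (m := m) w.1.isLt
    (IsHomogeneous.prod Finset.univ (fun a => (X (w.2 a) : MvPolynomial (Fin n) ℝ)) (fun _ => 1)
      fun a _ => isHomogeneous_X ℝ (w.2 a)) (by
        have := w.1.isLt
        simp
        omega)
  convert! h using 1
  ext p
  simp [wordFun]

theorem formSpan_succ_le (hm : d ≤ m) :
    formSpan t x d (m + 1) ≤ Submodule.span ℝ (Set.range fun (ω : Fin n × Word n d m) p =>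
      x p ω.1 * wordFun t x ω.2 p) := by
  refine Submodule.span_mono ?_
  rintro _ ⟨i, A, hi, hA, rfl⟩
  obtain ⟨k, hk⟩ : ∃ k, A k ≠ 0 := by
    by_contra! h0
    have : A = 0 := Finsupp.ext h0
    simp [this] at hA
    omega
  obtain ⟨A₀, rfl⟩ := exists_add_of_le (show Finsupp.single k 1 ≤ A by
    rw [Finsupp.single_le_iff]
    omega)
  rw [map_add, Finsupp.degree_single] at hA
  obtain ⟨σ, hσ⟩ := exists_word_prod x (m - i) A₀ (by omega)
  refine ⟨(k, ⟨⟨i, hi⟩, σ⟩), ?_⟩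
  ext p
  rw [add_comm, monomialFun_add_single, monomialFun, hσ]
  rfl

theorem linearForm_pow (u : Fin n → ℝ) (r : ℕ) :
    linearForm u ^ r = ∑ σ : Fin r → Fin n, (∏ a, u (σ a)) • ∏ a, X (σ a) := by
  rw [linearForm, Fintype.sum_pow]
  refine Finset.sum_congr rfl fun σ _ => ?_
  rw [Finset.prod_mul_distrib, smul_eq_C_mul, map_prod]

theorem sum_gaussianMatrix_wordFun (B : Fin d → Fin d → MvPolynomial (Fin n) ℝ) (κ : ℝ)
    {p p' : Z} (hpp' : x p = x p') :
    ∑ w : Word n d m, ∑ w',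
      (gaussianMatrix m B + κ • (1 : Matrix (Word n d m) (Word n d m) ℝ)) w w' *
      (wordFun t x w p * wordFun t x w' p') =
    ∑ i : Fin d, ∑ j : Fin d, (gaussianIntegral n
        (linearForm (x p) ^ ((m - (i : ℕ)) + (m - (j : ℕ))) * B i j) +
      (if i = j then κ * (∑ l, x p l ^ 2) ^ (m - (i : ℕ)) else 0)) *
        (t p ^ (i : ℕ) * t p' ^ (j : ℕ)) := by
  have h1 : ∑ w : Word n d m, ∑ w', gaussianMatrix m B w w' *
      (wordFun t x w p * wordFun t x w' p') = ∑ i : Fin d, ∑ j : Fin d, gaussianIntegral n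
        (linearForm (x p) ^ ((m - (i : ℕ)) + (m - (j : ℕ))) * B i j) *
        (t p ^ (i : ℕ) * t p' ^ (j : ℕ)) := by
    rw [Fintype.sum_sigma]
    refine Finset.sum_congr rfl fun i _ => ?_
    simp only [Fintype.sum_sigma]
    rw [Finset.sum_comm]
    refine Finset.sum_congr rfl fun j _ => ?_
    rw [pow_add, linearForm_pow, linearForm_pow, Finset.sum_mul_sum]
    simp only [Finset.sum_mul, map_sum]
    refine Finset.sum_congr rfl fun σ _ => Finset.sum_congr rfl fun ρ _ => ?_
    rw [smul_mul_smul_comm, smul_mul_assoc, map_smul]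
    simp only [gaussianMatrix, Matrix.of_apply, wordFun, smul_eq_mul, ← hpp']
    ring
  have h2 : ∑ w : Word n d m, ∑ w', (κ • (1 : Matrix (Word n d m) (Word n d m) ℝ)) w w' *
      (wordFun t x w p * wordFun t x w' p') = ∑ i : Fin d, ∑ j : Fin d,
      (if i = j then κ * (∑ l, x p l ^ 2) ^ (m - (i : ℕ)) else 0) *
        (t p ^ (i : ℕ) * t p' ^ (j : ℕ)) := by
    simp only [Matrix.smul_apply, Matrix.one_apply, smul_eq_mul, mul_ite, mul_one, mul_zero,
      ite_mul, zero_mul, Finset.sum_ite_eq, Finset.mem_univ, if_true]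
    rw [Fintype.sum_sigma]
    refine Finset.sum_congr rfl fun i _ => ?_
    rw [Fintype.sum_pow, Finset.mul_sum, Finset.sum_mul]
    refine Finset.sum_congr rfl fun σ _ => ?_
    simp only [wordFun, ← hpp', pow_two, Finset.prod_mul_distrib]
    ring
  simp only [Matrix.add_apply, add_mul, Finset.sum_add_distrib] at h1 h2 ⊢
  rw [h1, h2]

end GaussianKernel

section Pencil

variable {Z Ω : Type*} [Fintype Ω] {n d m : ℕ} {t : Z → ℝ} {x : Z → Fin n → ℝ}

theorem exists_symm_matrix_of_mem_kernelSpan (ψ : Ω → Z → ℝ)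
    (hψ : formSpan t x d m ≤ Submodule.span ℝ (Set.range ψ)) {K : Z → Z → ℝ}
    (hK : K ∈ kernelSpan t x d m) (hsymm : ∀ p p', K p' p = K p p') :
    ∃ a : Matrix Ω Ω ℝ, a.IsSymm ∧
      ∀ p p', K p p' = ∑ ω, ∑ ω', a ω ω' * (ψ ω p * ψ ω' p') := by
  have h1 := Submodule.map₂_le_map₂ hψ hψ hK
  rw [Submodule.map₂_span_span, Set.image2_range, Submodule.mem_span_range_iff_exists_fun] at h1
  obtain ⟨c, hc⟩ := h1
  have h2 : ∀ p p', K p p' = ∑ ω, ∑ ω', c (ω, ω') * (ψ ω p * ψ ω' p') := fun p p' => by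
    rw [← hc, Fintype.sum_prod_type]
    simp [Finset.sum_apply]
  refine ⟨Matrix.of fun ω ω' => (c (ω, ω') + c (ω', ω)) / 2, ?_, fun p p' => ?_⟩
  · ext ω ω'
    simp [add_comm]
  · have h3 : K p p' = ∑ ω, ∑ ω', c (ω', ω) * (ψ ω p * ψ ω' p') := by
      rw [← hsymm, h2, Finset.sum_comm]
      exact Finset.sum_congr rfl fun ω _ => Finset.sum_congr rfl fun ω' _ => by ring
    have h4 : K p p' = (K p p' + K p p') / 2 := by ring
    rw [h4]
    nth_rewrite 1 [h2]
    rw [h3, ← Finset.sum_add_distrib, Finset.sum_div]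
    refine Finset.sum_congr rfl fun ω _ => ?_
    rw [← Finset.sum_add_distrib, Finset.sum_div]
    exact Finset.sum_congr rfl fun ω' _ => by simp only [Matrix.of_apply]; ring

theorem exists_posDef_pencil_of_forms (ψ : Z → Ω → ℝ) (hψ : ∀ p, ψ p ≠ 0) {P : Matrix Ω Ω ℝ}
    (hP : P.PosDef) {a : Fin n → Matrix Ω Ω ℝ} (ha : ∀ k, (a k).IsSymm)
    (h : ∀ p p', ψ p' ⬝ᵥ (t p • P - ∑ k, x p k • a k).mulVec (ψ p) = 0) :
    ∃ (N : ℕ) (A₀ : Matrix (Fin N) (Fin N) ℝ) (A : Fin n → Matrix (Fin N) (Fin N) ℝ),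
      A₀.PosDef ∧ (∀ k, (A k).IsSymm) ∧ ∀ p, (t p • A₀ + ∑ k, x p k • A k).det = 0 := by
  classical
  set U := Submodule.span ℝ (Set.range ψ) with hU
  let b := Module.finBasis ℝ U
  let Y : Matrix Ω (Fin (Module.finrank ℝ U)) ℝ := Matrix.of fun ω j => (b j : Ω → ℝ) ω
  have hY : ∀ c, Y.mulVec c = ((b.equivFun.symm c : U) : Ω → ℝ) := fun c => by
    ext ω
    simp [Y, Matrix.mulVec, dotProduct, Module.Basis.equivFun_symm_apply, Finset.sum_apply,
      mul_comm]
  have hinj : Function.Injective Y.mulVec := fun c c' hcc => by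
    rw [hY, hY] at hcc
    exact b.equivFun.symm.injective (Subtype.ext hcc)
  refine ⟨_, Y.conjTranspose * P * Y, fun k => -(Y.conjTranspose * a k * Y),
    hP.conjTranspose_mul_mul_same hinj, fun k => ?_, fun p => ?_⟩
  · simp only [Matrix.IsSymm, Matrix.conjTranspose_eq_transpose_of_trivial, Matrix.transpose_neg,
      Matrix.transpose_mul, Matrix.transpose_transpose, (ha k).eq, Matrix.mul_assoc]
  · have hmem : ψ p ∈ U := Submodule.subset_span ⟨p, rfl⟩
    let c := b.equivFun ⟨ψ p, hmem⟩
    have hc : Y.mulVec c = ψ p := by simp [hY, c]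
    rw [← Matrix.exists_mulVec_eq_zero_iff]
    refine ⟨c, fun h0 => hψ p ?_, ?_⟩
    · rw [← hc, h0, Matrix.mulVec_zero]
    · have h1 : t p • (Y.conjTranspose * P * Y) + ∑ k, x p k • -(Y.conjTranspose * a k * Y) =
          Y.conjTranspose * (t p • P - ∑ k, x p k • a k) * Y := by
        simp only [smul_neg, Finset.sum_neg_distrib, Matrix.mul_sub, Matrix.sub_mul,
          Matrix.mul_sum, Matrix.sum_mul, Matrix.mul_smul, Matrix.smul_mul, ← sub_eq_add_neg]
      rw [h1, ← Matrix.mulVec_mulVec, hc, ← Matrix.mulVec_mulVec]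
      set v := (t p • P - ∑ k, x p k • a k).mulVec (ψ p)
      have h2 : ∀ u ∈ U, u ⬝ᵥ v = 0 := fun u hu => by
        induction hu using Submodule.span_induction with
        | mem u hu =>
          obtain ⟨p', rfl⟩ := hu
          exact h p p'
        | zero => exact zero_dotProduct v
        | add u u' _ _ hu hu' => rw [add_dotProduct, hu, hu', add_zero]
        | smul r u _ hu => rw [smul_dotProduct, hu, smul_zero]
      ext j
      simpa [Matrix.mulVec, Y, dotProduct] using h2 _ (b j).2

end Pencil

section Pencil

variable {Z : Type*} {n d : ℕ} {t : Z → ℝ} {x : Z → Fin n → ℝ}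

theorem exists_posDef_pencil (hn : 0 < n) (hd : 0 < d) (hx : ∀ p, x p ≠ 0)
    (hroots : ∀ u : Fin n → ℝ, u ≠ 0 → ∃ τ : Fin d → ℝ, Function.Injective τ ∧
      ∀ k, ∃ p, t p = τ k ∧ x p = u)
    (ht : ∀ m, ∀ f ∈ formSpan t x d m, (fun p => t p * f p) ∈ formSpan t x d (m + 1))
    (B : Fin d → Fin d → MvPolynomial (Fin n) ℝ)
    (hB : ∀ i j, (B i j).IsHomogeneous ((d - 1 - (i : ℕ)) + (d - 1 - (j : ℕ))))
    (hsymm : ∀ i j, B i j = B j i)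
    (hpos : ∀ u : Fin n → ℝ, u ≠ 0 → ∀ y : Fin d → ℝ, y ≠ 0 →
      0 < ∑ i, ∑ j, y i * y j * eval u (B i j))
    (hdiag : ∀ p p', x p = x p' → t p ≠ t p' →
      ∑ i : Fin d, ∑ j : Fin d, eval (x p) (B i j) * (t p ^ (i : ℕ) * t p' ^ (j : ℕ)) = 0) :
    ∃ (N : ℕ) (A₀ : Matrix (Fin N) (Fin N) ℝ) (A : Fin n → Matrix (Fin N) (Fin N) ℝ),
      A₀.PosDef ∧ (∀ k, (A k).IsSymm) ∧ ∀ p, (t p • A₀ + ∑ k, x p k • A k).det = 0 := by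
  obtain ⟨m, hdm, κ, hκ, B', hB's, hB'p, f, hf⟩ :=
    exists_gaussian_representation hn hd B hB hsymm hpos
  set P : Matrix (Word n d m) (Word n d m) ℝ :=
    gaussianMatrix m B' + κ • (1 : Matrix (Word n d m) (Word n d m) ℝ) with hPdef
  have hP : P.PosDef := 
    Matrix.PosDef.posSemidef_add (gaussianMatrix_posSemidef B' hB's hB'p)
      (Matrix.PosDef.one.smul hκ)
  have hPs : ∀ w w', P w w' = P w' w := fun w w' => by
    have := hP.isHermitian.apply w' w
    simpa using this
  let G : Z → Z → ℝ := ∑ w, ∑ w', P w w' • tensorKernel Z (wordFun t x w) (wordFun t x w')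
  have hGapp : ∀ p p', G p p' = ∑ w, ∑ w', P w w' * (wordFun t x w p * wordFun t x w' p') :=
    fun p p' => by simp [G, Finset.sum_apply]
  have hG : G ∈ kernelSpan t x d m := Submodule.sum_mem _ fun w _ => Submodule.sum_mem _ fun w' _ =>
    Submodule.smul_mem _ _ (Submodule.apply_mem_map₂ _ (wordFun_mem hdm w) (wordFun_mem hdm w'))
  have hGs : ∀ p p', G p' p = G p p' := fun p p' => by
    rw [hGapp, hGapp, Finset.sum_comm]
    exact Finset.sum_congr rfl fun w _ => Finset.sum_congr rfl fun w' _ => by rw [hPs]; ring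
  have hGd : ∀ p p', x p = x p' → (t p - t p') * G p p' = 0 := fun p p' hpp' => by
    rcases eq_or_ne (t p) (t p') with htt | htt
    · rw [htt, sub_self, zero_mul]
    · rw [hGapp, hPdef, sum_gaussianMatrix_wordFun B' κ hpp']
      simp only [hf, mul_assoc, ← Finset.mul_sum]
      rw [hdiag p p' hpp' htt, mul_zero, mul_zero]
  obtain ⟨a, ha, has, hat⟩ := exists_symmetric_kernels hn hroots (ht m) hG hGs hGd
  let ψ : Z → Fin n × Word n d m → ℝ := fun p ω => x p ω.1 * wordFun t x ω.2 p
  choose b hbs hb using fun k => exists_symm_matrix_of_mem_kernelSpan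
    (fun ω p => ψ p ω) (formSpan_succ_le hdm) (ha k) (has k)
  refine exists_posDef_pencil_of_forms ψ (fun p h0 => ?_)
    (Matrix.PosDef.one.kronecker hP (x := (1 : Matrix (Fin n) (Fin n) ℝ))) hbs fun p p' => ?_
  · obtain ⟨k, hk⟩ := Function.ne_iff.mp (hx p)
    have := congrFun h0 (k, ⟨⟨0, hd⟩, fun _ => k⟩)
    simp only [ψ, wordFun, pow_zero, one_mul, Finset.prod_const, Pi.zero_apply, mul_eq_zero] at this
    exact this.elim hk (pow_ne_zero _ hk)
  · have h1 : ψ p' ⬝ᵥ (Matrix.kroneckerMap (· * ·) (1 : Matrix (Fin n) (Fin n) ℝ) P).mulVec (ψ p) =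
        (∑ k, x p k * x p' k) * G p p' := by
      rw [hGapp, Finset.sum_mul]
      simp only [dotProduct, Matrix.mulVec, Fintype.sum_prod_type, Matrix.kroneckerMap_apply,
        Matrix.one_apply, ite_mul, one_mul, zero_mul, Finset.sum_ite_irrel, Finset.sum_const_zero,
        Finset.sum_ite_eq, Finset.mem_univ, if_true, ψ]
      refine Finset.sum_congr rfl fun k _ => ?_
      simp only [Finset.mul_sum]
      rw [Finset.sum_comm]
      exact Finset.sum_congr rfl fun w _ => Finset.sum_congr rfl fun w' _ => by rw [hPs]; ring
    have h2 : ∀ k, ψ p' ⬝ᵥ (b k).mulVec (ψ p) = a k p p' := fun k => by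
      rw [← has, hb]
      simp only [dotProduct, Matrix.mulVec, Finset.mul_sum]
      exact Finset.sum_congr rfl fun w _ => Finset.sum_congr rfl fun w' _ => by ring
    rw [Matrix.sub_mulVec, Matrix.smul_mulVec, Matrix.sum_mulVec, dotProduct_sub, dotProduct_smul,
      dotProduct_sum]
    simp only [Matrix.smul_mulVec, dotProduct_smul, h2, smul_eq_mul]
    rw [h1]
    rw [hat, sub_self]

end Pencil

section RealRooted

open Polynomial

theorem Polynomial.Splits.sq_coeff_sub_nonneg {P : ℝ[X]} (hP : P.Splits) :
    0 ≤ P.coeff 1 ^ 2 - 2 * P.coeff 0 * P.coeff 2 := by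
  induction hN : P.natDegree generalizing P with
  | zero =>
    rw [coeff_eq_zero_of_natDegree_lt (n := 2) (by omega), mul_zero, sub_zero]
    positivity
  | succ N ih =>
    obtain ⟨τ, hτ⟩ := hP.exists_eval_eq_zero (fun h => by
      rw [natDegree_eq_zero_iff_degree_le_zero.mpr h.le] at hN
      omega)
    obtain ⟨Q, rfl⟩ := dvd_iff_isRoot.mpr hτ
    have hQ0 : Q ≠ 0 := by
      rintro rfl
      simp at hN
    rw [natDegree_mul (X_sub_C_ne_zero τ) hQ0, natDegree_X_sub_C] at hN
    have h := ih (splits_X_sub_C_mul_iff.mp hP) (by omega)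
    have e0 : ((X - C τ) * Q).coeff 0 = -τ * Q.coeff 0 := by simp [mul_coeff_zero]
    have e1 : ((X - C τ) * Q).coeff 1 = Q.coeff 0 - τ * Q.coeff 1 := by
      simp [sub_mul, coeff_X_mul]
    have e2 : ((X - C τ) * Q).coeff 2 = Q.coeff 1 - τ * Q.coeff 2 := by
      simp [sub_mul, coeff_X_mul]
    rw [e0, e1, e2]
    nlinarith [sq_nonneg (Q.coeff 0), mul_nonneg (sq_nonneg τ) h]

theorem Polynomial.Splits.sq_coeff_zero_le {P : ℝ[X]} (hP : P.Splits) {τ : ℝ}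
    (hτ : P.IsRoot τ) :
    P.coeff 0 ^ 2 ≤ τ ^ 2 * (P.coeff 1 ^ 2 - 2 * P.coeff 0 * P.coeff 2) := by
  obtain ⟨Q, rfl⟩ := dvd_iff_isRoot.mpr hτ
  have h := (splits_X_sub_C_mul_iff.mp hP).sq_coeff_sub_nonneg
  have e0 : ((X - C τ) * Q).coeff 0 = -τ * Q.coeff 0 := by simp [mul_coeff_zero]
  have e1 : ((X - C τ) * Q).coeff 1 = Q.coeff 0 - τ * Q.coeff 1 := by
    simp [sub_mul, coeff_X_mul]
  have e2 : ((X - C τ) * Q).coeff 2 = Q.coeff 1 - τ * Q.coeff 2 := by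
    simp [sub_mul, coeff_X_mul]
  rw [e0, e1, e2]
  nlinarith [mul_nonneg (mul_nonneg (sq_nonneg τ) (sq_nonneg τ)) h]

theorem Polynomial.Splits.pow_natDegree_le {P : ℝ[X]} (hP : P.Splits) {c M : ℝ} (hc : 0 ≤ c)
    (h : ∀ τ, P.IsRoot τ → c ≤ τ ^ 2 * M) :
    P.leadingCoeff ^ 2 * c ^ P.natDegree ≤ P.coeff 0 ^ 2 * M ^ P.natDegree := by
  have h1 : (P.roots.map fun _ => c).prod ≤ (P.roots.map fun τ => τ ^ 2 * M).prod :=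
    Multiset.prod_map_le_prod_map₀ _ _ (fun _ _ => hc) fun τ hτ => h τ (isRoot_of_mem_roots hτ)
  rw [Multiset.map_const', Multiset.prod_replicate, Multiset.prod_map_mul, Multiset.prod_map_pow,
    Multiset.map_const', Multiset.prod_replicate, Multiset.map_id',
    ← hP.natDegree_eq_card_roots] at h1
  refine (mul_le_mul_of_nonneg_left h1 (sq_nonneg P.leadingCoeff)).trans_eq ?_
  rw [hP.coeff_zero_eq_leadingCoeff_mul_prod_roots, mul_pow, mul_pow, ← pow_mul,
    mul_comm P.natDegree 2, pow_mul]
  ring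

theorem Polynomial.eval_le_eval_of_eventually {l : Filter ℝ} [l.NeBot] (hl : l ≤ nhds 0)
    {f g : ℝ[X]} (h : ∀ᶠ s in l, f.eval s ≤ g.eval s) : f.eval 0 ≤ g.eval 0 :=
  le_of_tendsto_of_tendsto ((f.continuous.tendsto 0).mono_left hl)
    ((g.continuous.tendsto 0).mono_left hl) h

/-- A family of real-rooted polynomials in `t` of constant degree, depending polynomially on a
parameter `s`, whose member at `s = 0` has a double root at `t = 0`, is singular there. -/
theorem Polynomial.derivative_coeff_zero_eval_zero (Φ : ℝ[X][X]) {c : ℝ} (hc : c ≠ 0) {d : ℕ}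
    (hΦ : ∀ s, (Φ.map (evalRingHom s)).Splits)
    (hd : ∀ s, (Φ.map (evalRingHom s)).natDegree = d)
    (hlc : ∀ s, (Φ.map (evalRingHom s)).leadingCoeff = c)
    (h0 : (Φ.coeff 0).eval 0 = 0) (h1 : (Φ.coeff 1).eval 0 = 0) :
    (Φ.coeff 0).derivative.eval 0 = 0 := by
  have hX : ∀ p : ℝ[X], p.eval 0 = 0 → ∃ q, p = X * q := fun p hp => by
    obtain ⟨q, hq⟩ := dvd_iff_isRoot.mpr (show p.IsRoot 0 from hp)
    exact ⟨q, by simpa using hq⟩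
  obtain ⟨p, hp⟩ := hX _ h0
  obtain ⟨q, hq⟩ := hX _ h1
  have hnn : ∀ s, 0 ≤ s ^ 2 * q.eval s ^ 2 - 2 * (s * p.eval s) * (Φ.coeff 2).eval s := fun s => by
    have := (hΦ s).sq_coeff_sub_nonneg
    simpa [coeff_map, hp, hq, mul_pow] using this
  have ha : (Φ.coeff 0).derivative.eval 0 = p.eval 0 := by simp [hp]
  rw [ha]
  by_contra hp0
  have h2 : (Φ.coeff 2).eval 0 = 0 := by
    have hle : (2 * p * Φ.coeff 2).eval 0 ≤ (X * q ^ 2).eval 0 := by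
      refine eval_le_eval_of_eventually (l := nhdsWithin 0 (Set.Ioi 0)) nhdsWithin_le_nhds ?_
      filter_upwards [self_mem_nhdsWithin] with s hs
      have := hnn s
      simp only [eval_mul, eval_pow, eval_X, eval_ofNat]
      rw [Set.mem_Ioi] at hs
      nlinarith
    have hge : (X * q ^ 2).eval 0 ≤ (2 * p * Φ.coeff 2).eval 0 := by
      refine eval_le_eval_of_eventually (l := nhdsWithin 0 (Set.Iio 0)) nhdsWithin_le_nhds ?_
      filter_upwards [self_mem_nhdsWithin] with s hs
      have := hnn s
      simp only [eval_mul, eval_pow, eval_X, eval_ofNat]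
      rw [Set.mem_Iio] at hs
      nlinarith
    have := le_antisymm hle hge
    simpa [hp0] using this
  obtain ⟨r, hr⟩ := hX _ h2
  have hle : (C (c ^ 2) * (p ^ 2) ^ d).eval 0 ≤
      ((X * p) ^ 2 * (q ^ 2 - 2 * p * r) ^ d).eval 0 := by
    refine eval_le_eval_of_eventually (l := nhdsWithin 0 {0}ᶜ) nhdsWithin_le_nhds ?_
    filter_upwards [self_mem_nhdsWithin] with s hs
    rw [Set.mem_compl_singleton_iff] at hs
    have := (hΦ s).pow_natDegree_le (c := p.eval s ^ 2)
      (M := q.eval s ^ 2 - 2 * p.eval s * r.eval s) (sq_nonneg _) fun τ hτ => by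
        have := (hΦ s).sq_coeff_zero_le hτ
        simp only [coeff_map, hp, hq, hr, coe_evalRingHom, eval_mul, eval_X] at this
        have hs2 : 0 < s ^ 2 := by positivity
        refine le_of_mul_le_mul_left ?_ hs2
        linarith
    rw [hd, hlc] at this
    simpa [hp] using this
  have : 0 < c ^ 2 * (p.eval 0 ^ 2) ^ d := by positivity
  simp at hle
  linarith

end RealRooted

section Lines

variable {σ R A : Type*} [CommRing R]

theorem MvPolynomial.derivative_aeval [Fintype σ] (h : MvPolynomial σ R)
    (f : σ → Polynomial R) :
    Polynomial.derivative (aeval f h) =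
      ∑ i, aeval f (pderiv i h) * Polynomial.derivative (f i) := by
  classical
  induction h using MvPolynomial.induction_on with
  | C a => simp
  | add p q hp hq => simp [hp, hq, add_mul, Finset.sum_add_distrib]
  | mul_X p j hp =>
    have h1 : ∀ i, aeval f (pderiv i (p * X j)) =
        aeval f (pderiv i p) * f j + aeval f p * if i = j then 1 else 0 := fun i => by
      rw [Derivation.leibniz, pderiv_X, map_add, smul_eq_mul, smul_eq_mul, map_mul, map_mul,
        aeval_X, Pi.single_apply, apply_ite (aeval f), map_one, map_zero,
        if_congr (eq_comm : j = i ↔ i = j) rfl rfl]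
      ring
    simp only [h1, add_mul, Finset.sum_add_distrib, mul_ite, mul_one, mul_zero, ite_mul, zero_mul,
      Finset.sum_ite_eq', Finset.mem_univ, if_true]
    have h2 : ∑ i, aeval f (pderiv i p) * f j * Polynomial.derivative (f i) =
        (∑ i, aeval f (pderiv i p) * Polynomial.derivative (f i)) * f j := by
      rw [Finset.sum_mul]
      exact Finset.sum_congr rfl fun i _ => mul_right_comm _ _ _
    rw [h2, map_mul, aeval_X, Polynomial.derivative_mul, hp]

/-- The restriction of `h` to the line `t ↦ t • e + v`. -/
noncomputable def linePolynomial [CommRing A] [Algebra R A] (h : MvPolynomial σ R) (e v : σ → A) :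
    Polynomial A :=
  aeval (fun i => Polynomial.C (e i) * Polynomial.X + Polynomial.C (v i)) h

theorem map_linePolynomial {B : Type*} [CommRing A] [CommRing B] [Algebra R A] [Algebra R B]
    (φ : A →ₐ[R] B) (h : MvPolynomial σ R) (e v : σ → A) :
    (linePolynomial h e v).map (φ : A →+* B) =
      linePolynomial h (fun i => φ (e i)) (fun i => φ (v i)) := by
  have h1 := MvPolynomial.comp_aeval
    (fun i => Polynomial.C (e i) * Polynomial.X + Polynomial.C (v i)) (Polynomial.mapAlgHom φ)
  simpa [linePolynomial] using DFunLike.congr_fun h1 h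

theorem eval_linePolynomial [CommRing A] [Algebra R A] (h : MvPolynomial σ R) (e v : σ → A)
    (z : A) : (linePolynomial h e v).eval z = aeval (fun i => z * e i + v i) h := by
  have := MvPolynomial.comp_aeval (fun i => Polynomial.C (e i) * Polynomial.X + Polynomial.C (v i))
    ((Polynomial.aeval z : Polynomial A →ₐ[A] A).restrictScalars R)
  have h1 := DFunLike.congr_fun this h
  simp only [AlgHom.comp_apply, AlgHom.restrictScalars_apply, Polynomial.coe_aeval_eq_eval,
    Polynomial.eval_add, Polynomial.eval_mul, Polynomial.eval_C, Polynomial.eval_X] at h1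
  simpa only [linePolynomial, mul_comm] using h1

theorem natDegree_linePolynomial_le [CommRing A] [Algebra R A] {h : MvPolynomial σ R} {d : ℕ}
    (hh : h.IsHomogeneous d) (e v : σ → A) :
    (linePolynomial h e v).natDegree ≤ d ∧ (linePolynomial h e v).coeff d = aeval e h := by
  classical
  have key : ∀ α : σ →₀ ℕ, ∀ s : Finset σ,
      (∏ i ∈ s, (Polynomial.C (e i) * Polynomial.X + Polynomial.C (v i)) ^ α i).natDegree ≤
        ∑ i ∈ s, α i ∧
      (∏ i ∈ s, (Polynomial.C (e i) * Polynomial.X + Polynomial.C (v i)) ^ α i).coeff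
        (∑ i ∈ s, α i) = ∏ i ∈ s, e i ^ α i := fun α s => by
    induction s using Finset.induction_on with
    | empty => simp
    | insert i s hi ih =>
      have h1 : (Polynomial.C (e i) * Polynomial.X + Polynomial.C (v i)).natDegree ≤ 1 :=
        Polynomial.natDegree_linear_le
      have h2 := Polynomial.natDegree_pow_le_of_le (α i) h1
      have h3 := Polynomial.coeff_pow_of_natDegree_le h1 (m := α i)
      rw [mul_one] at h2 h3
      rw [Finset.prod_insert hi, Finset.sum_insert hi, Finset.prod_insert hi]
      refine ⟨Polynomial.natDegree_mul_le_of_le h2 ih.1, ?_⟩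
      rw [Polynomial.coeff_mul_add_eq_of_natDegree_le h2 ih.1, ih.2, h3]
      simp
  have hdeg : ∀ α ∈ h.support, ∑ i ∈ α.support, α i = d := fun α hα => by
    change α.degree = d
    rw [Finsupp.degree_eq_weight_one]
    exact hh (mem_support_iff.mp hα)
  rw [linePolynomial, aeval_def, eval₂_eq, aeval_def, eval₂_eq]
  constructor
  · refine Polynomial.natDegree_sum_le_of_forall_le _ _ fun α hα => ?_
    refine (Polynomial.natDegree_C_mul_le _ _).trans ?_
    exact (key α α.support).1.trans (hdeg α hα).le
  · rw [Polynomial.finsetSum_coeff]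
    refine Finset.sum_congr rfl fun α hα => ?_
    have := (key α α.support).2
    rw [hdeg α hα] at this
    rw [Polynomial.algebraMap_apply, Polynomial.coeff_C_mul, this]

end Lines

section SimpleRoots

theorem eval_derivative_linePolynomial {σ R : Type*} [Fintype σ] [CommRing R] (h : MvPolynomial σ R)
    (e v : σ → R) (z : R) :
    (Polynomial.derivative (linePolynomial h e v)).eval z =
      ∑ i, eval (fun i => z * e i + v i) (pderiv i h) * e i := by
  have h1 : ∀ p : MvPolynomial σ R, (aeval (fun i => Polynomial.C (e i) * Polynomial.X +
      Polynomial.C (v i)) p).eval z = eval (fun i => z * e i + v i) p := fun p => by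
    rw [← aeval_eq_eval]
    exact eval_linePolynomial p e v z
  rw [linePolynomial, MvPolynomial.derivative_aeval, Polynomial.eval_finsetSum]
  refine Finset.sum_congr rfl fun i _ => ?_
  rw [Polynomial.eval_mul, h1]
  simp

variable {n d : ℕ} {h : MvPolynomial (Fin (n + 1)) ℝ} {e : Fin (n + 1) → ℝ}

theorem Hyperbolic.splits_linePolynomial (hh : Hyperbolic h e) (v : Fin (n + 1) → ℝ) :
    (linePolynomial h e v).Splits := by
  refine Polynomial.Splits.of_splits_map (algebraMap ℝ ℂ) (IsAlgClosed.splits _) fun z hz => ?_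
  have h1 := Polynomial.isRoot_of_mem_roots hz
  have h2 := map_linePolynomial (Algebra.ofId ℝ ℂ) h e v
  rw [show ((Algebra.ofId ℝ ℂ : ℝ →ₐ[ℝ] ℂ) : ℝ →+* ℂ) = algebraMap ℝ ℂ from rfl] at h2
  rw [Polynomial.IsRoot.def, h2, eval_linePolynomial] at h1
  exact ⟨z.re, Complex.ext rfl (hh.2 v z h1).symm⟩

theorem Hyperbolic.leadingCoeff_linePolynomial (hh : Hyperbolic h e) (hhom : h.IsHomogeneous d)
    (v : Fin (n + 1) → ℝ) :
    (linePolynomial h e v).natDegree = d ∧ (linePolynomial h e v).leadingCoeff = eval e h := by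
  obtain ⟨h1, h2⟩ := natDegree_linePolynomial_le hhom e v
  rw [aeval_eq_eval] at h2
  have h3 : (linePolynomial h e v).natDegree = d :=
    Polynomial.natDegree_eq_of_le_of_coeff_ne_zero h1 (h2 ▸ hh.1)
  exact ⟨h3, by rw [Polynomial.leadingCoeff, h3, h2]⟩

theorem Hyperbolic.eval_derivative_linePolynomial_ne_zero (hh : Hyperbolic h e)
    (hhom : h.IsHomogeneous d)
    (hsmooth : ∀ v : Fin (n + 1) → ℝ, v ≠ 0 → ∃ i, eval v (pderiv i h) ≠ 0)
    {v : Fin (n + 1) → ℝ} {z : ℝ} (hz : z • e + v ≠ 0) (h0 : (linePolynomial h e v).eval z = 0) :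
    (Polynomial.derivative (linePolynomial h e v)).eval z ≠ 0 := by
  intro h1
  obtain ⟨i, hi⟩ := hsmooth _ hz
  set w := z • e + v with hw
  set y : Fin (n + 1) → ℝ := Pi.single i 1 with hy
  have hwz : (fun j => z * e j + v j) = w := rfl
  rw [eval_linePolynomial, aeval_eq_eval, hwz] at h0
  rw [eval_derivative_linePolynomial, hwz] at h1
  let Φ : Polynomial (Polynomial ℝ) := linePolynomial h (fun j => Polynomial.C (e j))
    (fun j => Polynomial.C (y j) * Polynomial.X + Polynomial.C (w j))
  have hΦ : ∀ s, Φ.map (Polynomial.evalRingHom s) = linePolynomial h e (fun j => y j * s + w j) :=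
    fun s => by
    have := map_linePolynomial (Polynomial.aeval s : Polynomial ℝ →ₐ[ℝ] ℝ) h
      (fun j => Polynomial.C (e j))
      (fun j => Polynomial.C (y j) * Polynomial.X + Polynomial.C (w j))
    simpa [Polynomial.coe_aeval_eq_evalRingHom, Polynomial.coe_aeval_eq_eval] using this
  have hΦ0 : Φ.coeff 0 = linePolynomial h y w := by
    rw [Polynomial.coeff_zero_eq_eval_zero, eval_linePolynomial]
    simp [linePolynomial]
  have h2 := Polynomial.derivative_coeff_zero_eval_zero Φ hh.1 (d := d)
    (fun s => (hΦ s) ▸ hh.splits_linePolynomial _)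
    (fun s => (hΦ s) ▸ (hh.leadingCoeff_linePolynomial hhom _).1)
    (fun s => (hΦ s) ▸ (hh.leadingCoeff_linePolynomial hhom _).2)
    (by simpa [hΦ0, eval_linePolynomial, aeval_eq_eval] using h0) (by
      have h3 : (Φ.map (Polynomial.evalRingHom 0)).coeff 1 =
          (Polynomial.derivative (linePolynomial h e w)).eval 0 := by
        rw [hΦ, ← Polynomial.coeff_zero_eq_eval_zero, Polynomial.coeff_derivative]
        simp
      rw [eval_derivative_linePolynomial] at h3
      simpa [Polynomial.coeff_map, h1] using h3)
  rw [hΦ0, eval_derivative_linePolynomial] at h2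
  apply hi
  simpa [hy, Pi.single_apply] using h2

theorem Hyperbolic.exists_simple_roots (hh : Hyperbolic h e) (hhom : h.IsHomogeneous d)
    (hsmooth : ∀ v : Fin (n + 1) → ℝ, v ≠ 0 → ∃ i, eval v (pderiv i h) ≠ 0)
    {v : Fin (n + 1) → ℝ} (hv : ∀ z : ℝ, z • e + v ≠ 0) :
    ∃ τ : Fin d → ℝ, Function.Injective τ ∧ ∀ k, (linePolynomial h e v).eval (τ k) = 0 ∧
      (Polynomial.derivative (linePolynomial h e v)).eval (τ k) ≠ 0 := by
  classical
  set P := linePolynomial h e v with hP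
  obtain ⟨hdeg, hlc⟩ := hh.leadingCoeff_linePolynomial hhom v
  have hP0 : P ≠ 0 := fun h0 => hh.1 (by rw [← hlc, ← hP, h0, Polynomial.leadingCoeff_zero])
  have hroot : ∀ z, P.eval z = 0 → (Polynomial.derivative P).eval z ≠ 0 := fun z hz =>
    hh.eval_derivative_linePolynomial_ne_zero hhom hsmooth (hv z) hz
  have hnodup : P.roots.Nodup := by
    rw [Multiset.nodup_iff_count_le_one]
    intro z
    rw [Polynomial.count_roots]
    by_contra! h1
    obtain ⟨h2, h3⟩ := (Polynomial.one_lt_rootMultiplicity_iff_isRoot hP0).mp h1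
    exact hroot z h2 h3
  have hcard : P.roots.toFinset.card = d := by
    rw [Multiset.toFinset_card_of_nodup hnodup,
      ← (hh.splits_linePolynomial v).natDegree_eq_card_roots, hdeg]
  refine ⟨fun k => ((Finset.equivFinOfCardEq hcard).symm k : ℝ),
    Subtype.val_injective.comp (Equiv.injective _), fun k => ?_⟩
  have h1 := ((Finset.equivFinOfCardEq hcard).symm k).2
  rw [Multiset.mem_toFinset, Polynomial.mem_roots hP0] at h1
  exact ⟨h1, hroot _ h1⟩

end SimpleRoots

section StandardDirection

variable {n d : ℕ} {h : MvPolynomial (Fin (n + 1)) ℝ}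

theorem map_eval_finSuccEquiv (h : MvPolynomial (Fin (n + 1)) ℝ) (u : Fin n → ℝ) :
    (finSuccEquiv ℝ n h).map (eval u) = linePolynomial h (Pi.single 0 1) (Fin.cons 0 u) := by
  refine Polynomial.funext fun z => ?_
  rw [← eval_eq_eval_mv_eval', eval_linePolynomial, aeval_eq_eval]
  congr 2
  ext i
  refine Fin.cases ?_ (fun j => ?_) i <;> simp

theorem finSuccEquiv_natDegree_le (hhom : h.IsHomogeneous d) :
    (finSuccEquiv ℝ n h).natDegree ≤ d ∧
      (finSuccEquiv ℝ n h).coeff d = C (eval (Pi.single 0 1) h) := by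
  refine ⟨Polynomial.natDegree_le_iff_coeff_eq_zero.mpr fun a ha => ?_, ?_⟩ <;>
    refine MvPolynomial.funext fun u => ?_ <;>
    rw [← Polynomial.coeff_map, map_eval_finSuccEquiv]
  · rw [map_zero]
    exact Polynomial.coeff_eq_zero_of_natDegree_lt
      ((natDegree_linePolynomial_le hhom _ _).1.trans_lt ha)
  · rw [(natDegree_linePolynomial_le hhom _ _).2, eval_C, aeval_eq_eval]

theorem dvd_of_eval_cons_eq_zero (hn : 0 < n) (hhom : h.IsHomogeneous d)
    (hc : eval (Pi.single 0 1) h ≠ 0) (D : MvPolynomial (Fin (n + 1)) ℝ)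
    (hD : ∀ u : Fin n → ℝ, u ≠ 0 → ∃ τ : Fin d → ℝ, Function.Injective τ ∧
      ∀ k, eval (Fin.cons (τ k) u) h = 0 ∧ eval (Fin.cons (τ k) u) D = 0) : h ∣ D := by
  obtain ⟨hdeg, hcoeff⟩ := finSuccEquiv_natDegree_le hhom
  set c := eval (Pi.single 0 1) h
  set H := finSuccEquiv ℝ n h with hH
  set F := Polynomial.C (C c⁻¹) * H with hF
  have hFdeg : F.natDegree ≤ d := (Polynomial.natDegree_C_mul_le _ _).trans hdeg
  have hFd : F.coeff d = 1 := by
    rw [hF, Polynomial.coeff_C_mul, hcoeff, ← map_mul, inv_mul_cancel₀ hc, map_one]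
  have hFm : F.Monic := Polynomial.monic_of_natDegree_le_of_coeff_eq_one d hFdeg hFd
  have hFnat : F.natDegree = d :=
    Polynomial.natDegree_eq_of_le_of_coeff_ne_zero hFdeg (by rw [hFd]; exact one_ne_zero)
  set R := finSuccEquiv ℝ n D %ₘ F with hR
  have hdiv := Polynomial.modByMonic_add_div (finSuccEquiv ℝ n D) F
  have hRd : ∀ a, d ≤ a → R.coeff a = 0 := fun a ha => by
    refine Polynomial.coeff_eq_zero_of_degree_lt
      ((Polynomial.degree_modByMonic_lt _ hFm).trans_le ?_)
    rw [Polynomial.degree_eq_natDegree hFm.ne_zero, hFnat]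
    exact_mod_cast ha
  have hR0 : R = 0 := by
    ext1 a
    rw [Polynomial.coeff_zero]
    refine eq_zero_of_eval_eq_zero_off_zero hn _ fun u hu => ?_
    obtain ⟨τ, hinj, hτ⟩ := hD u hu
    rw [← Polynomial.coeff_map]
    suffices h0 : R.map (eval u) = 0 by rw [h0, Polynomial.coeff_zero]
    refine Polynomial.eq_zero_of_degree_lt_of_eval_finset_eq_zero (Finset.univ.image τ) ?_ ?_
    · rw [Finset.card_image_of_injective _ hinj, Finset.card_univ, Fintype.card_fin,
        Polynomial.degree_lt_iff_coeff_zero]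
      intro a ha
      rw [Polynomial.coeff_map, hRd a ha, map_zero]
    · simp only [Finset.mem_image, Finset.mem_univ, true_and, forall_exists_index,
        forall_apply_eq_imp_iff]
      intro k
      have h1 := congrArg (fun p => (p.map (eval u)).eval (τ k)) hdiv
      have h2 : (F.map (eval u)).eval (τ k) = 0 := by
        rw [hF, Polynomial.map_mul, Polynomial.eval_mul, hH, ← eval_eq_eval_mv_eval', (hτ k).1,
          mul_zero]
      simp only [Polynomial.map_add, Polynomial.map_mul, Polynomial.eval_add, Polynomial.eval_mul,
        h2, zero_mul, add_zero, ← eval_eq_eval_mv_eval', (hτ k).2] at h1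
      exact h1
  rw [← hR, hR0, zero_add] at hdiv
  rw [← map_dvd_iff (finSuccEquiv ℝ n), ← hdiv, ← hH]
  exact (show H ∣ F from dvd_mul_left _ _).mul_right _

theorem exists_dvd_det (hn : 0 < n) (hd : 0 < d) (hhom : h.IsHomogeneous d)
    (hh : Hyperbolic h (Pi.single 0 1))
    (hsmooth : ∀ v : Fin (n + 1) → ℝ, v ≠ 0 → ∃ i, eval v (pderiv i h) ≠ 0) :
    ∃ (N : ℕ) (A : Fin (n + 1) → Matrix (Fin N) (Fin N) ℝ), (A 0).PosDef ∧ (∀ i, (A i).IsSymm) ∧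
      h ∣ Matrix.det (∑ i, (X i : MvPolynomial (Fin (n + 1)) ℝ) • (A i).map C) := by
  obtain ⟨hdeg, hcoeff⟩ := finSuccEquiv_natDegree_le hhom
  have hc0 := hh.1
  set c := eval (Pi.single 0 1) h
  set H := finSuccEquiv ℝ n h with hH
  have hHhom : ∀ a ≤ d, (H.coeff a).IsHomogeneous (d - a) := fun a ha =>
    hhom.finSuccEquiv_coeff_isHomogeneous a (d - a) (by omega)
  have hPdeg : ∀ u, (H.map (eval u)).natDegree ≤ d := fun u =>
    Polynomial.natDegree_map_le.trans hdeg
  have hsimple : ∀ u : Fin n → ℝ, u ≠ 0 → ∃ τ : Fin d → ℝ, Function.Injective τ ∧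
      ∀ k, (H.map (eval u)).eval (τ k) = 0 ∧
        (Polynomial.derivative (H.map (eval u))).eval (τ k) ≠ 0 := fun u hu => by
    rw [hH, map_eval_finSuccEquiv]
    refine hh.exists_simple_roots hhom hsmooth fun z h0 => hu ?_
    ext j
    simpa using congrFun h0 j.succ
  let Z := {p : ℝ × (Fin n → ℝ) // p.2 ≠ 0 ∧ (H.map (eval p.2)).eval p.1 = 0}
  let t : Z → ℝ := fun p => p.1.1
  let x : Z → Fin n → ℝ := fun p => p.1.2
  let B : Fin d → Fin d → MvPolynomial (Fin n) ℝ := fun i j => bezoutian d H.coeff i j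
  have hB : ∀ u i j, eval u (B i j) = bezoutian d (H.map (eval u)).coeff i j := fun u i j => by
    simp only [B, map_bezoutian]
    congr 1
    ext a
    rw [Polynomial.coeff_map]
  have hrel : ∀ p : Z, t p ^ d =
      ∑ a ∈ Finset.range d, eval (x p) (C (-c⁻¹) * H.coeff a) * t p ^ a := fun p => by
    have h1 := p.2.2
    rw [Polynomial.eval_eq_sum_range' (n := d + 1) (by have := hPdeg p.1.2; omega),
      Finset.sum_range_succ, Polynomial.coeff_map, hcoeff, eval_C] at h1
    simp only [Polynomial.coeff_map] at h1
    simp only [map_mul, eval_C, mul_assoc, ← Finset.mul_sum]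
    rw [eq_neg_of_add_eq_zero_left h1]
    field_simp
    rfl
  obtain ⟨N, A₀, A, hA₀, hA, hdet⟩ := exists_posDef_pencil (t := t) (x := x) hn hd
    (fun p => p.2.1)
    (fun u hu => by
      obtain ⟨τ, hinj, hτ⟩ := hsimple u hu
      exact ⟨τ, hinj, fun k => ⟨⟨(τ k, u), hu, (hτ k).1⟩, rfl, rfl⟩⟩)
    (fun m => formSpan_t_mul (fun a => C (-c⁻¹) * H.coeff a)
      (fun a ha => by simpa using (isHomogeneous_C (Fin n) (-c⁻¹)).mul (hHhom a ha.le)) hrel)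
    B (fun i j => bezoutian_isHomogeneous d H.coeff hHhom i j)
    (fun i j => bezoutian_comm d H.coeff i j)
    (fun u hu y hy => by
      obtain ⟨τ, hinj, hτ⟩ := hsimple u hu
      simp only [hB]
      exact bezoutian_posDef _ (hPdeg u) τ hinj (fun k => (hτ k).1) (fun k => (hτ k).2) y hy)
    (fun p p' hpp' htt' => by
      simp only [hB]
      refine sum_bezoutian_ne _ (hPdeg _) p.2.2 ?_ htt'
      rw [hpp']
      exact p'.2.2)
  refine ⟨N, Fin.cons A₀ A, hA₀, fun i => ?_, ?_⟩
  · refine Fin.cases ?_ (fun j => ?_) i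
    · simpa using hA₀.isHermitian
    · exact hA j
  · refine dvd_of_eval_cons_eq_zero hn hhom hc0 _ fun u hu => ?_
    obtain ⟨τ, hinj, hτ⟩ := hsimple u hu
    refine ⟨τ, hinj, fun k => ⟨?_, ?_⟩⟩
    · rw [eval_eq_eval_mv_eval']
      exact (hτ k).1
    · have h1 := hdet ⟨(τ k, u), hu, (hτ k).1⟩
      rw [RingHom.map_det]
      convert! h1 using 2
      ext a b
      simp [Matrix.sum_apply, Fin.sum_univ_succ, t, x]

end StandardDirection

section LinearSubstitution

variable {m : ℕ}

/-- The polynomial `x ↦ p (M x)`. -/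
noncomputable def linearSubst (M : Matrix (Fin m) (Fin m) ℝ) :
    MvPolynomial (Fin m) ℝ →ₐ[ℝ] MvPolynomial (Fin m) ℝ :=
  bind₁ fun i => linearForm (M i)

theorem aeval_linearSubst {B : Type*} [CommRing B] [Algebra ℝ B] (M : Matrix (Fin m) (Fin m) ℝ)
    (p : MvPolynomial (Fin m) ℝ) (z : Fin m → B) :
    aeval z (linearSubst M p) = aeval (fun i => ∑ j, algebraMap ℝ B (M i j) * z j) p := by
  rw [linearSubst, aeval_bind₁]
  simp [linearForm]

theorem eval_linearSubst (M : Matrix (Fin m) (Fin m) ℝ) (p : MvPolynomial (Fin m) ℝ)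
    (z : Fin m → ℝ) : eval z (linearSubst M p) = eval (M.mulVec z) p := by
  simpa [aeval_eq_eval] using! aeval_linearSubst M p z

theorem MvPolynomial.IsHomogeneous.linearSubst {p : MvPolynomial (Fin m) ℝ} {d : ℕ}
    (hp : p.IsHomogeneous d) (M : Matrix (Fin m) (Fin m) ℝ) :
    (linearSubst M p).IsHomogeneous d := by
  simpa using! hp.aeval (fun i => linearForm (M i)) fun i => linearForm_isHomogeneous (M i)

theorem linePolynomial_linearSubst (M : Matrix (Fin m) (Fin m) ℝ) (p : MvPolynomial (Fin m) ℝ)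
    (y v : Fin m → ℝ) :
    linePolynomial (linearSubst M p) y v = linePolynomial p (M.mulVec y) (M.mulVec v) := by
  refine Polynomial.funext fun z => ?_
  rw [eval_linePolynomial, eval_linePolynomial, aeval_eq_eval, aeval_eq_eval]
  refine (eval_linearSubst _ _ _).trans ?_
  have : (fun i => z * y i + v i) = z • y + v := rfl
  rw [this, Matrix.mulVec_add, Matrix.mulVec_smul]
  rfl

theorem aeval_det_pencil {B : Type*} [CommRing B] [Algebra ℝ B] {N : ℕ}
    (A : Fin m → Matrix (Fin N) (Fin N) ℝ) (z : Fin m → B) :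
    aeval z (Matrix.det (∑ i, (X i : MvPolynomial (Fin m) ℝ) • (A i).map C)) =
      Matrix.det (∑ i, z i • (A i).map (algebraMap ℝ B)) := by
  rw [AlgHom.map_det]
  congr 1
  ext a b
  simp [Matrix.sum_apply]

theorem eval_det_pencil {N : ℕ} (A : Fin m → Matrix (Fin N) (Fin N) ℝ) (z : Fin m → ℝ) :
    eval z (Matrix.det (∑ i, (X i : MvPolynomial (Fin m) ℝ) • (A i).map C)) =
      Matrix.det (∑ i, z i • A i) := by
  rw [← aeval_eq_eval]
  exact aeval_det_pencil A z

theorem exists_matrix_mulVec_eq {e e' : Fin m → ℝ} (he : e ≠ 0) (he' : e' ≠ 0) :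
    ∃ M M' : Matrix (Fin m) (Fin m) ℝ, M * M' = 1 ∧ M' * M = 1 ∧ M.mulVec e' = e := by
  obtain ⟨L, hL⟩ := SeparatingDual.exists_continuousLinearEquiv_apply_eq (R := ℝ) he' he
  refine ⟨LinearMap.toMatrix' L.toLinearEquiv.toLinearMap,
    LinearMap.toMatrix' L.symm.toLinearEquiv.toLinearMap, ?_, ?_, ?_⟩
  · rw [← LinearMap.toMatrix'_comp, ← LinearMap.toMatrix'_id]
    congr 1
    ext; simp
  · rw [← LinearMap.toMatrix'_comp, ← LinearMap.toMatrix'_id]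
    congr 1
    ext; simp
  · rw [LinearMap.toMatrix'_mulVec]
    exact hL

end LinearSubstitution

section Direction

variable {n d : ℕ} {h : MvPolynomial (Fin (n + 1)) ℝ} {e : Fin (n + 1) → ℝ}

theorem Hyperbolic.linearSubst {M : Matrix (Fin (n + 1)) (Fin (n + 1)) ℝ}
    {e' : Fin (n + 1) → ℝ} (hh : Hyperbolic h e) (he : M.mulVec e' = e) :
    Hyperbolic (linearSubst M h) e' := by
  refine ⟨by rw [eval_linearSubst, he]; exact hh.1, fun v z hz => hh.2 (M.mulVec v) z ?_⟩
  rw [aeval_linearSubst] at hz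
  rw [← hz]
  congr 2
  ext i
  rw [← he]
  simp [Matrix.mulVec, dotProduct, mul_add, Finset.sum_add_distrib, Finset.mul_sum,
    mul_left_comm]

theorem exists_eval_pderiv_linearSubst_ne {M M' : Matrix (Fin (n + 1)) (Fin (n + 1)) ℝ}
    (hM : M * M' = 1) (hM' : M' * M = 1)
    (hsmooth : ∀ v : Fin (n + 1) → ℝ, v ≠ 0 → ∃ i, eval v (pderiv i h) ≠ 0)
    (v : Fin (n + 1) → ℝ) (hv : v ≠ 0) : ∃ i, eval v (pderiv i (linearSubst M h)) ≠ 0 := by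
  by_contra! hcon
  obtain ⟨i, hi⟩ := hsmooth (M.mulVec v) fun h0 => hv (by
    simpa [Matrix.mulVec_mulVec, hM'] using congrArg M'.mulVec h0)
  refine hi ?_
  have h1 := eval_derivative_linePolynomial (linearSubst M h) (M'.mulVec (Pi.single i 1)) v 0
  rw [linePolynomial_linearSubst, eval_derivative_linePolynomial, Matrix.mulVec_mulVec, hM,
    Matrix.one_mulVec] at h1
  simpa [hcon, Pi.single_apply] using h1

theorem exists_posDef_dvd_det (hd : 0 < d) (hhom : h.IsHomogeneous d) (hh : Hyperbolic h e)
    (hsmooth : ∀ v : Fin (n + 1) → ℝ, v ≠ 0 → ∃ i, eval v (pderiv i h) ≠ 0) :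
    ∃ (N : ℕ) (A : Fin (n + 1) → Matrix (Fin N) (Fin N) ℝ), (∑ i, e i • A i).PosDef ∧
      (∀ i, (A i).IsSymm) ∧
      h ∣ Matrix.det (∑ i, (X i : MvPolynomial (Fin (n + 1)) ℝ) • (A i).map C) := by
  have he : e ≠ 0 := by
    rintro rfl
    have h1 := hhom.eval_smul_eq 0 0
    rw [zero_pow hd.ne', zero_mul, smul_zero] at h1
    exact hh.1 h1
  rcases Nat.eq_zero_or_pos n with rfl | hn
  · have he0 : e 0 ≠ 0 := fun h0 => he <| funext fun i => by
      rw [Subsingleton.elim (α := Fin 1) i 0, h0]; rfl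
    refine ⟨d, fun _ => (e 0)⁻¹ • 1, ?_, fun _ => by simp [Matrix.IsSymm], ?_⟩
    · simpa [smul_smul, he0] using Matrix.PosDef.one
    · refine ⟨C (eval e h)⁻¹, MvPolynomial.funext fun z => ?_⟩
      have hz : z = (z 0 * (e 0)⁻¹) • e := by
        ext i
        rw [Subsingleton.elim (α := Fin 1) i 0]
        simp [he0]
      have h1 := hhom.eval_smul_eq e (z 0 * (e 0)⁻¹)
      rw [← hz] at h1
      rw [eval_det_pencil, map_mul, eval_C, h1, mul_inv_cancel_right₀ hh.1]
      simp [smul_smul]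
  · obtain ⟨M, M', hM, hM', hMe⟩ := exists_matrix_mulVec_eq he
      (Pi.single_ne_zero_iff.2 one_ne_zero : (Pi.single 0 1 : Fin (n + 1) → ℝ) ≠ 0)
    obtain ⟨N, A, hA0, hA, hdvd⟩ := exists_dvd_det hn hd (hhom.linearSubst M)
      (hh.linearSubst hMe) (exists_eval_pderiv_linearSubst_ne hM hM' hsmooth)
    have hsum : ∀ z : Fin (n + 1) → ℝ,
        ∑ j, z j • ∑ i, M' i j • A i = ∑ i, M'.mulVec z i • A i := fun z => by
      simp only [Finset.smul_sum, smul_smul, Matrix.mulVec, dotProduct, Finset.sum_smul]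
      rw [Finset.sum_comm]
      simp only [mul_comm]
    refine ⟨N, fun j => ∑ i, M' i j • A i, ?_, fun j => ?_, ?_⟩
    · rw [hsum, ← hMe, Matrix.mulVec_mulVec, hM', Matrix.one_mulVec]
      simpa [Pi.single_apply, ite_smul] using hA0
    · simp only [Matrix.IsSymm, Matrix.transpose_sum, Matrix.transpose_smul, (hA _).eq]
    · convert! map_dvd (linearSubst M') hdvd
      · refine MvPolynomial.funext fun z => ?_
        rw [eval_linearSubst, eval_linearSubst, Matrix.mulVec_mulVec, hM, Matrix.one_mulVec]
      · refine MvPolynomial.funext fun z => ?_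
        rw [eval_linearSubst, eval_det_pencil, eval_det_pencil, hsum]

end Direction

section Determinant

variable {m N : ℕ}

theorem isHomogeneous_det_pencil (A : Fin m → Matrix (Fin N) (Fin N) ℝ) :
    (Matrix.det (∑ i, (X i : MvPolynomial (Fin m) ℝ) • (A i).map C) :
      MvPolynomial (Fin m) ℝ).IsHomogeneous N := by
  rw [Matrix.det_apply]
  refine IsHomogeneous.sum _ _ _ fun σ _ => ?_
  have h1 : (∏ k, (∑ i, (X i : MvPolynomial (Fin m) ℝ) • (A i).map (C (σ := Fin m)))
      (σ k) k).IsHomogeneous (∑ _k : Fin N, 1) := by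
    refine IsHomogeneous.prod _ _ _ fun k _ => ?_
    rw [Matrix.sum_apply]
    refine IsHomogeneous.sum _ _ _ fun i _ => ?_
    simpa using (isHomogeneous_X ℝ i).mul (isHomogeneous_C (Fin m) (A i (σ k) k))
  rw [Finset.sum_const, Finset.card_univ, Fintype.card_fin, smul_eq_mul, mul_one] at h1
  rcases Int.units_eq_one_or (Equiv.Perm.sign σ) with hs | hs
  · simpa [hs] using h1
  · simpa [hs] using h1.neg

theorem MvPolynomial.exists_isHomogeneous_of_dvd {σ R : Type*} [CommRing R]
    {h D : MvPolynomial σ R} {d N : ℕ} (hh : h.IsHomogeneous d) (hD : D.IsHomogeneous N)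
    (hdvd : h ∣ D) : ∃ q : MvPolynomial σ R, q.IsHomogeneous (N - d) ∧ q * h = D := by
  let : GradedAlgebra (homogeneousSubmodule σ R) := gradedAlgebra
  obtain ⟨q, rfl⟩ := hdvd
  have h1 := DirectSum.coe_decompose_mul_of_right_mem (𝒜 := homogeneousSubmodule σ R) (a := q) N hh
  rw [mul_comm q, DirectSum.decompose_of_mem_same (homogeneousSubmodule σ R) hD] at h1
  split_ifs at h1
  · exact ⟨_, (DirectSum.decompose (homogeneousSubmodule σ R) q (N - d)).2, h1.symm⟩
  · exact ⟨0, isHomogeneous_zero _ _ _, by rw [zero_mul, h1]⟩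

theorem Matrix.PosDef.im_eq_zero_of_det_eq_zero {P S : Matrix (Fin N) (Fin N) ℝ} (hP : P.PosDef)
    (hS : S.IsSymm) {z : ℂ}
    (hz : (z • P.map (algebraMap ℝ ℂ) + S.map (algebraMap ℝ ℂ)).det = 0) : z.im = 0 := by
  obtain ⟨u, hu, h0⟩ := Matrix.exists_mulVec_eq_zero_iff.2 hz
  let a : Fin N → ℝ := fun i => (u i).re
  let b : Fin N → ℝ := fun i => (u i).im
  let T := z.re • P + S
  have hTsymm : T.IsSymm := by
    have := hP.isHermitian
    simp only [Matrix.IsHermitian, Matrix.conjTranspose_eq_transpose_of_trivial] at this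
    simp [T, Matrix.IsSymm, this, hS.eq]
  have hre : T.mulVec a = z.im • P.mulVec b := by
    ext i
    have := congrArg Complex.re (congrFun h0 i)
    simp only [Matrix.mulVec, dotProduct, Matrix.add_apply, Matrix.smul_apply, Matrix.map_apply,
      Complex.re_sum, Pi.zero_apply, Complex.zero_re] at this
    rw [← sub_eq_zero, ← this]
    simp only [T, a, b, Matrix.mulVec, dotProduct, Pi.smul_apply, smul_eq_mul, Finset.mul_sum,
      ← Finset.sum_sub_distrib, Matrix.add_apply, Matrix.smul_apply]
    refine Finset.sum_congr rfl fun j _ => ?_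
    simp
    ring
  have him : T.mulVec b = -(z.im • P.mulVec a) := by
    ext i
    have := congrArg Complex.im (congrFun h0 i)
    simp only [Matrix.mulVec, dotProduct, Matrix.add_apply, Matrix.smul_apply, Matrix.map_apply,
      Complex.im_sum, Pi.zero_apply, Complex.zero_im] at this
    rw [← sub_eq_zero, ← this]
    simp only [T, a, b, Matrix.mulVec, dotProduct, Pi.smul_apply, Pi.neg_apply, smul_eq_mul,
      sub_neg_eq_add, Finset.mul_sum, ← Finset.sum_add_distrib, Matrix.add_apply,
      Matrix.smul_apply]
    refine Finset.sum_congr rfl fun j _ => ?_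
    simp
    ring
  have hcomm : b ⬝ᵥ T.mulVec a = a ⬝ᵥ T.mulVec b := by
    rw [Matrix.dotProduct_mulVec, ← Matrix.mulVec_transpose, hTsymm.eq, dotProduct_comm]
  rw [hre, him, dotProduct_neg, dotProduct_smul, dotProduct_smul, smul_eq_mul, smul_eq_mul] at hcomm
  have hnonneg : ∀ w : Fin N → ℝ, 0 ≤ w ⬝ᵥ P.mulVec w := fun w => by
    simpa using hP.posSemidef.dotProduct_mulVec_nonneg w
  have hpos : ∀ w : Fin N → ℝ, w ≠ 0 → 0 < w ⬝ᵥ P.mulVec w := fun w hw => by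
    simpa using hP.dotProduct_mulVec_pos hw
  have hab : 0 < b ⬝ᵥ P.mulVec b + a ⬝ᵥ P.mulVec a := by
    by_cases ha : a = 0
    · have hb : b ≠ 0 := fun hb => hu (funext fun i =>
        Complex.ext (congrFun ha i) (congrFun hb i))
      linarith [hpos b hb, hnonneg a]
    · linarith [hpos a ha, hnonneg b]
  have hmul : z.im * (b ⬝ᵥ P.mulVec b + a ⬝ᵥ P.mulVec a) = 0 := by linarith
  exact (mul_eq_zero.1 hmul).resolve_right hab.ne'

theorem hyperbolic_det_pencil {n : ℕ} {e : Fin (n + 1) → ℝ}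
    {A : Fin (n + 1) → Matrix (Fin N) (Fin N) ℝ} (hA : ∀ i, (A i).IsSymm)
    (hpos : (∑ i, e i • A i).PosDef) :
    Hyperbolic (Matrix.det (∑ i, (X i : MvPolynomial (Fin (n + 1)) ℝ) • (A i).map C)) e := by
  refine ⟨by rw [eval_det_pencil]; exact hpos.det_pos.ne', fun v z hz => ?_⟩
  have hS : (∑ i, v i • A i).IsSymm := by
    simp only [Matrix.IsSymm, Matrix.transpose_sum, Matrix.transpose_smul, (hA _).eq]
  refine hpos.im_eq_zero_of_det_eq_zero hS ?_
  rw [aeval_det_pencil] at hz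
  rw [← hz]
  congr 1
  ext a b
  simp [Matrix.sum_apply, add_mul, Finset.sum_add_distrib, Finset.mul_sum, mul_assoc]

theorem Hyperbolic.of_mul_left {n : ℕ} {q h : MvPolynomial (Fin (n + 1)) ℝ}
    {e : Fin (n + 1) → ℝ} (hqh : Hyperbolic (q * h) e) : Hyperbolic q e := by
  refine ⟨fun h0 => hqh.1 (by rw [map_mul, h0, zero_mul]), fun v z hz => hqh.2 v z ?_⟩
  rw [map_mul, hz, zero_mul]

end Determinant

/-- **Theorem (Main result).** If `h` is homogeneous of degree `d ≥ 1`, hyperbolic with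
respect to `e`, and has no real singularities, then there is a homogeneous polynomial `q`,
hyperbolic with respect to `e`, and real symmetric matrices `A₀, …, Aₙ` such that
`q·h = det(x₀A₀ + … + xₙAₙ)` and `e₀A₀ + … + eₙAₙ` is positive definite. -/
theorem statement0 {n d : ℕ} (hd : 1 ≤ d) (h : MvPolynomial (Fin (n + 1)) ℝ)
    (hhom : h.IsHomogeneous d) (e : Fin (n + 1) → ℝ) (hhyp : Hyperbolic h e)
    (hsmooth : ∀ v : Fin (n + 1) → ℝ, v ≠ 0 → ∃ i, eval v (pderiv i h) ≠ 0) :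
    ∃ (q : MvPolynomial (Fin (n + 1)) ℝ) (dq : ℕ), q.IsHomogeneous dq ∧ Hyperbolic q e ∧
      ∃ (N : ℕ) (A : Fin (n + 1) → Matrix (Fin N) (Fin N) ℝ),
        (∀ i, (A i).IsSymm) ∧
        q * h = Matrix.det (∑ i, (X i : MvPolynomial (Fin (n + 1)) ℝ) • (A i).map C) ∧
        (∑ i, e i • A i).PosDef := by
  obtain ⟨N, A, hpos, hA, hdvd⟩ := exists_posDef_dvd_det hd hhom hhyp hsmooth
  obtain ⟨q, hq, hqh⟩ := exists_isHomogeneous_of_dvd hhom (isHomogeneous_det_pencil A) hdvd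
  refine ⟨q, N - d, hq, Hyperbolic.of_mul_left (h := h) ?_, N, A, hA, hqh, hpos⟩
  rw [hqh]
  exact hyperbolic_det_pencil hA hpos
end

section
/- Let h ∈ ℝ[x₀,…,xₙ] be homogeneous of degree d ≥ 1 with h(e) ≠ 0 where e = (1,0,…,0), and assume h has no real singularities. Then the following are equivalent: (i) h is hyperbolic with respect to e; (ii) there exists a homogeneous polynomial p ∈ ℝ[x₀,…,xₙ] whose degree in x₀ is at most d−1, such that the symmetric d×d matrix Λ = (Λ_{ij})_{0≤i,j≤d−1} with entries in ℝ[x₁,…,xₙ] determined by the identity h(s,x₁,…,xₙ)·p(t,x₁,…,xₙ) − h(t,x₁,…,xₙ)·p(s,x₁,…,xₙ) = (s−t)·Σ_{i,j=0}^{d−1} Λ_{ij} s^i t^j in ℝ[x₁,…,xₙ][s,t] satisfies: the real matrix Λ(v), obtained by evaluating all entries at v, is positive definite for every 0 ≠ v ∈ ℝⁿ. -/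
open MvPolynomial

/-- Substituting the element `s` of `R[s,t] = (ℝ[x₁,…,xₙ])[X₀,X₁]` for `x₀` in a
polynomial `f ∈ ℝ[x₀,…,xₙ]` (the remaining variables `xⱼ₊₁` are sent to `xⱼ ∈ R`). -/
noncomputable def subs {n : ℕ} (s : MvPolynomial (Fin 2) (MvPolynomial (Fin n) ℝ))
    (f : MvPolynomial (Fin (n + 1)) ℝ) : MvPolynomial (Fin 2) (MvPolynomial (Fin n) ℝ) :=
  aeval (Fin.cases s (fun j => C (X j))) f

/-- The chain rule for substituting univariate polynomials into a multivariate one. -/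
theorem derivative_aeval_eq_sum {σ A : Type*} [Fintype σ] [CommRing A] [Algebra ℝ A]
    (g : σ → Polynomial A) (f : MvPolynomial σ ℝ) :
    Polynomial.derivative (aeval g f) =
      ∑ i, aeval g (pderiv i f) * Polynomial.derivative (g i) := by
  classical
  induction f using MvPolynomial.induction_on with
  | C a => simp [Polynomial.algebraMap_apply]
  | add p q hp hq => simp [hp, hq, add_mul, Finset.sum_add_distrib]
  | mul_X p i hp =>
    simp only [map_mul, aeval_X, Polynomial.derivative_mul, hp, Derivation.leibniz, smul_eq_mul,
      map_add, add_mul, Finset.sum_add_distrib, pderiv_X]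
    rw [add_comm]
    congr 1
    · rw [Finset.sum_eq_single i] <;> simp +contextual [eq_comm]
    · rw [Finset.sum_mul]
      exact Finset.sum_congr rfl fun j _ => by ring

theorem natDegree_prod_le_and_coeff_prod {ι A : Type*} [CommRing A] (s : Finset ι)
    (f : ι → Polynomial A) (k : ι → ℕ) (hf : ∀ i ∈ s, (f i).natDegree ≤ k i) :
    (∏ i ∈ s, f i).natDegree ≤ ∑ i ∈ s, k i ∧
      (∏ i ∈ s, f i).coeff (∑ i ∈ s, k i) = ∏ i ∈ s, (f i).coeff (k i) := by
  classical
  induction s using Finset.induction_on with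
  | empty => simp
  | insert a s ha ih =>
    obtain ⟨h1, h2⟩ := ih fun i hi => hf i (Finset.mem_insert_of_mem hi)
    have h3 := hf a (Finset.mem_insert_self a s)
    rw [Finset.prod_insert ha, Finset.sum_insert ha, Finset.prod_insert ha]
    exact ⟨Polynomial.natDegree_mul_le_of_le h3 h1, by
      rw [Polynomial.coeff_mul_add_eq_of_natDegree_le h3 h1, h2]⟩

/-- Restricting a homogeneous polynomial of degree `d` to the line `u + s e` gives a univariate
polynomial of degree at most `d` whose coefficient at `s ^ d` is the value at `e`. -/
theorem natDegree_le_and_coeff_aeval_line {σ : Type*} [Fintype σ] {d : ℕ}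
    {h : MvPolynomial σ ℝ} (hhom : h.IsHomogeneous d) (u e : σ → ℝ) :
    (aeval (fun j => Polynomial.C (u j) + Polynomial.C (e j) * Polynomial.X) h).natDegree ≤ d ∧
      (aeval (fun j => Polynomial.C (u j) + Polynomial.C (e j) * Polynomial.X) h).coeff d =
        eval e h := by
  have key : ∀ m ∈ h.support,
      (aeval (fun j => Polynomial.C (u j) + Polynomial.C (e j) * Polynomial.X)
        (monomial m (coeff m h))).natDegree ≤ d ∧
      (aeval (fun j => Polynomial.C (u j) + Polynomial.C (e j) * Polynomial.X)
        (monomial m (coeff m h))).coeff d = eval e (monomial m (coeff m h)) := by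
    intro m hm
    have hdeg : ∑ i, m i = d := by
      rw [← Finsupp.degree_eq_sum, Finsupp.degree_eq_weight_one]
      exact hhom (mem_support_iff.mp hm)
    have hlin : ∀ i, (Polynomial.C (u i) + Polynomial.C (e i) * Polynomial.X).natDegree ≤ 1 := by
      intro i
      compute_degree
    obtain ⟨h1, h2⟩ := natDegree_prod_le_and_coeff_prod Finset.univ
      (fun i => (Polynomial.C (u i) + Polynomial.C (e i) * Polynomial.X) ^ m i) (fun i => m i)
      (fun i _ => by simpa using Polynomial.natDegree_pow_le_of_le (m i) (hlin i))
    rw [hdeg] at h1 h2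
    rw [aeval_monomial, eval_monomial, Finsupp.prod_fintype _ _ (by simp),
      Finsupp.prod_fintype _ _ (by simp), Polynomial.algebraMap_eq]
    refine ⟨(Polynomial.natDegree_C_mul_le _ _).trans h1, ?_⟩
    rw [Polynomial.coeff_C_mul, h2]
    congr 1
    refine Finset.prod_congr rfl fun i _ => ?_
    have := Polynomial.coeff_pow_of_natDegree_le (m := m i) (hlin i)
    rw [mul_one] at this
    simp [this, Polynomial.coeff_C]
  rw [h.as_sum, map_sum, map_sum]
  refine ⟨Polynomial.natDegree_sum_le_of_forall_le _ _ fun m hm => (key m hm).1, ?_⟩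
  rw [Polynomial.finsetSum_coeff]
  exact Finset.sum_congr rfl fun m hm => (key m hm).2

/-- Adding a real root to a polynomial changes `a₁² - 2 a₀ a₂` by a square. -/
theorem coeff_one_sq_sub_X_sub_C_mul (r : ℝ) (g : Polynomial ℝ) :
    ((Polynomial.X - Polynomial.C r) * g).coeff 1 ^ 2 -
        2 * ((Polynomial.X - Polynomial.C r) * g).coeff 0 *
          ((Polynomial.X - Polynomial.C r) * g).coeff 2 =
      g.coeff 0 ^ 2 + r ^ 2 * (g.coeff 1 ^ 2 - 2 * g.coeff 0 * g.coeff 2) := by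
  simp [sub_mul, Polynomial.coeff_X_mul, Polynomial.coeff_X_mul]
  ring

theorem coeff_one_sq_sub_nonneg {f : Polynomial ℝ} (hf : f.Splits) :
    0 ≤ f.coeff 1 ^ 2 - 2 * f.coeff 0 * f.coeff 2 := by
  obtain ⟨s, hs⟩ : ∃ s : Multiset ℝ, f = Polynomial.C f.leadingCoeff *
      (s.map fun a => Polynomial.X - Polynomial.C a).prod := ⟨_, hf.eq_prod_roots⟩
  generalize f.leadingCoeff = L at hs
  induction s using Multiset.induction_on generalizing f with
  | empty => simp [hs, Polynomial.coeff_C]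
  | cons r s ih =>
    have h1 : f = (Polynomial.X - Polynomial.C r) * (Polynomial.C L *
        (s.map fun a => Polynomial.X - Polynomial.C a).prod) := by
      rw [hs, Multiset.map_cons, Multiset.prod_cons]; ring
    rw [h1, coeff_one_sq_sub_X_sub_C_mul]
    have h2 := ih (f := Polynomial.C L *
      (s.map fun a => Polynomial.X - Polynomial.C a).prod)
      (.C_mul (.multisetProd (by simp [Polynomial.Splits.X_sub_C])) L) rfl
    positivity

theorem coeff_zero_sq_le_of_isRoot {f : Polynomial ℝ} (hf : f.Splits) {r : ℝ} (hr : f.IsRoot r) :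
    f.coeff 0 ^ 2 ≤ r ^ 2 * (f.coeff 1 ^ 2 - 2 * f.coeff 0 * f.coeff 2) := by
  obtain ⟨g, rfl⟩ := Polynomial.dvd_iff_isRoot.mpr hr
  have hg : g.Splits := Polynomial.splits_X_sub_C_mul_iff.mp hf
  rw [coeff_one_sq_sub_X_sub_C_mul]
  have h0 : ((Polynomial.X - Polynomial.C r) * g).coeff 0 = -r * g.coeff 0 := by
    simp [sub_mul]
  rw [h0]
  nlinarith [coeff_one_sq_sub_nonneg hg, mul_nonneg (sq_nonneg (r ^ 2))
    (coeff_one_sq_sub_nonneg hg)]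

theorem leadingCoeff_sq_mul_le {f : Polynomial ℝ} (hf : f.Splits) :
    f.leadingCoeff ^ 2 * (f.coeff 0 ^ 2) ^ f.natDegree ≤
      f.coeff 0 ^ 2 * (f.coeff 1 ^ 2 - 2 * f.coeff 0 * f.coeff 2) ^ f.natDegree := by
  set Q := f.coeff 1 ^ 2 - 2 * f.coeff 0 * f.coeff 2 with hQ
  have h1 := Multiset.prod_map_le_prod_map₀ (s := f.roots) (fun _ => f.coeff 0 ^ 2)
    (fun r => r ^ 2 * Q) (fun _ _ => sq_nonneg _)
    fun r hr => coeff_zero_sq_le_of_isRoot hf (Polynomial.isRoot_of_mem_roots hr)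
  rw [Multiset.prod_map_mul, Multiset.map_const', Multiset.map_const', Multiset.prod_replicate,
    Multiset.prod_replicate, Multiset.prod_map_pow, Multiset.map_id',
    ← hf.natDegree_eq_card_roots] at h1
  have h2 : f.coeff 0 ^ 2 = f.leadingCoeff ^ 2 * f.roots.prod ^ 2 := by
    rw [hf.coeff_zero_eq_leadingCoeff_mul_prod_roots, mul_pow, mul_pow, ← pow_mul, mul_comm _ 2,
      pow_mul]
    simp
  calc f.leadingCoeff ^ 2 * (f.coeff 0 ^ 2) ^ f.natDegree
      ≤ f.leadingCoeff ^ 2 * (f.roots.prod ^ 2 * Q ^ f.natDegree) := by gcongr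
    _ = _ := by rw [← mul_assoc, ← h2]

/-- A real polynomial all of whose complex roots are real splits over `ℝ`. -/
theorem splits_of_forall_im_eq_zero {f : Polynomial ℝ}
    (hf : ∀ z : ℂ, Polynomial.aeval z f = 0 → z.im = 0) : f.Splits := by
  refine Polynomial.Splits.of_splits_map (algebraMap ℝ ℂ) (IsAlgClosed.splits _) fun z hz => ?_
  have := hf z (by
    rw [Polynomial.aeval_def, ← Polynomial.eval_map]
    exact Polynomial.isRoot_of_mem_roots hz)
  exact ⟨z.re, Complex.ext (by simp) (by simp [this])⟩

open Filter Topology in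
/-- A family of real-rooted polynomials of degree `d` with constant leading coefficient cannot
have constant term vanishing to first order and linear term vanishing at `y = 0`. -/
theorem false_of_forall_leadingCoeff_sq_mul_le {u w a b : Polynomial ℝ} {α L : ℝ} {d : ℕ}
    (hL : L ≠ 0) (hu : u.eval 0 ≠ 0) (hα : 0 ≤ u.eval 0 * α)
    (hb : a = Polynomial.C α + Polynomial.X * b)
    (hQ : ∀ y : ℝ, 0 ≤ (y * w.eval y) ^ 2 - 2 * (y * u.eval y) * a.eval y)
    (hle : ∀ y : ℝ, L ^ 2 * ((y * u.eval y) ^ 2) ^ d ≤ (y * u.eval y) ^ 2 *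
      ((y * w.eval y) ^ 2 - 2 * (y * u.eval y) * a.eval y) ^ d) : False := by
  obtain ⟨K, hK⟩ : ∃ K : ℝ, w.eval 0 ^ 2 - 2 * u.eval 0 * b.eval 0 < K * u.eval 0 ^ 2 := by
    refine ⟨(w.eval 0 ^ 2 - 2 * u.eval 0 * b.eval 0 + 1) / u.eval 0 ^ 2, ?_⟩
    rw [div_mul_cancel₀ _ (by positivity)]
    linarith
  have e1 : ∀ᶠ y in 𝓝 (0 : ℝ), w.eval y ^ 2 - 2 * u.eval y * b.eval y < K * u.eval y ^ 2 :=
    ContinuousAt.eventually_lt (by fun_prop) (by fun_prop) hK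
  have e2 : ∀ᶠ y in 𝓝 (0 : ℝ), 0 ≤ u.eval y * α := by
    rcases hα.eq_or_lt with h | h
    · have : α = 0 := by simpa [hu] using h.symm
      simp [this]
    · have : ∀ᶠ y in 𝓝 (0 : ℝ), 0 < u.eval y * α :=
        ContinuousAt.eventually_lt (by fun_prop) (by fun_prop) h
      exact this.mono fun _ => le_of_lt
  have e3 : ∀ᶠ y in 𝓝 (0 : ℝ), K ^ d * (y * u.eval y) ^ 2 < L ^ 2 :=
    ContinuousAt.eventually_lt (by fun_prop) (by fun_prop) (by simp; positivity)
  have e4 : ∀ᶠ y in 𝓝 (0 : ℝ), u.eval y ≠ 0 :=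
    ContinuousAt.eventually_ne (by fun_prop) hu
  have e5 : ∀ᶠ y in 𝓝[>] (0 : ℝ), 0 < y := self_mem_nhdsWithin
  obtain ⟨y, ⟨⟨⟨⟨h1, h2⟩, h3⟩, h4⟩, h5⟩⟩ :=
    ((((e1.and e2).and e3).and e4).filter_mono nhdsWithin_le_nhds |>.and e5).exists
  have hQle : (y * w.eval y) ^ 2 - 2 * (y * u.eval y) * a.eval y ≤ K * (y * u.eval y) ^ 2 := by
    have ha : a.eval y = α + y * b.eval y := by simp [hb]
    rw [ha]
    nlinarith [mul_nonneg h5.le h2, mul_le_mul_of_nonneg_left h1.le (sq_nonneg y)]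
  have hpow := pow_le_pow_left₀ (hQ y) hQle d
  have hp : 0 < (y * u.eval y) ^ 2 := by positivity
  have h6 : L ^ 2 * ((y * u.eval y) ^ 2) ^ d ≤
      (K ^ d * (y * u.eval y) ^ 2) * ((y * u.eval y) ^ 2) ^ d :=
    (hle y).trans ((mul_le_mul_of_nonneg_left hpow hp.le).trans_eq (by ring))
  exact absurd (le_of_mul_le_mul_right h6 (by positivity)) (not_le.mpr h3)

theorem Hyperbolic.splits_aeval_line {n : ℕ} {h : MvPolynomial (Fin (n + 1)) ℝ}
    {e : Fin (n + 1) → ℝ} (hyp : Hyperbolic h e) (u : Fin (n + 1) → ℝ) :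
    (aeval (fun j => Polynomial.C (u j) + Polynomial.C (e j) * Polynomial.X) h).Splits := by
  refine splits_of_forall_im_eq_zero fun z hz => hyp.2 u z ?_
  rw [comp_aeval_apply] at hz
  rw [← hz]
  congr 2
  ext j
  simp only [map_add, map_mul, Polynomial.aeval_C, Polynomial.aeval_X, Complex.coe_algebraMap]
  ring

/-- At a real point where a hyperbolic polynomial and its derivative in the hyperbolic direction
vanish, all directional derivatives vanish. -/
theorem Hyperbolic.sum_mul_eval_pderiv_eq_zero {n d : ℕ} {h : MvPolynomial (Fin (n + 1)) ℝ}
    {e : Fin (n + 1) → ℝ} (hyp : Hyperbolic h e) (hhom : h.IsHomogeneous d)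
    {x : Fin (n + 1) → ℝ} (hx : eval x h = 0) (hex : ∑ i, eval x (pderiv i h) * e i = 0)
    (w : Fin (n + 1) → ℝ) : ∑ i, eval x (pderiv i h) * w i = 0 := by
  by_contra hne
  -- The family `s ↦ h(x + y w + s e)`, whose coefficients are polynomials in `y`.
  let G (w : Fin (n + 1) → ℝ) : Polynomial (Polynomial ℝ) :=
    aeval (fun j => Polynomial.C (Polynomial.C (x j) + Polynomial.C (w j) * Polynomial.X) +
      Polynomial.C (Polynomial.C (e j)) * Polynomial.X) h
  have hG : ∀ w y, (G w).map (Polynomial.evalRingHom y) =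
      aeval (fun j => Polynomial.C (x j + y * w j) + Polynomial.C (e j) * Polynomial.X) h := by
    intro w y
    have h1 : (G w).map (Polynomial.evalRingHom y) =
        Polynomial.mapAlgHom (Polynomial.aeval (R := ℝ) y) (G w) := by
      rw [Polynomial.coe_mapAlgHom]
      rfl
    rw [h1, comp_aeval_apply]
    congr 2
    ext1 j
    simp [mul_comm y]
  have hcoeff : ∀ w y k, ((G w).coeff k).eval y = (aeval (fun j => Polynomial.C (x j + y * w j) +
      Polynomial.C (e j) * Polynomial.X) h : Polynomial ℝ).coeff k := by
    intro w y k
    rw [← hG, Polynomial.coeff_map, Polynomial.coe_evalRingHom]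
  have hG0 : ∀ w, (G w).coeff 0 =
      aeval (fun j => Polynomial.C (x j) + Polynomial.C (w j) * Polynomial.X) h := by
    intro w
    have h1 : (G w).coeff 0 =
        ((Polynomial.aeval (R := Polynomial ℝ) (0 : Polynomial ℝ)).restrictScalars ℝ) (G w) := by
      simp [Polynomial.coeff_zero_eq_aeval_zero]
    rw [h1, comp_aeval_apply]
    congr 2
    ext1 j
    simp
  have hev : ∀ (w : Fin (n + 1) → ℝ) (f : MvPolynomial (Fin (n + 1)) ℝ),
      (aeval (fun j => Polynomial.C (x j) + Polynomial.C (w j) * Polynomial.X) f).coeff 0 =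
        eval x f := by
    intro w f
    rw [Polynomial.coeff_zero_eq_aeval_zero, comp_aeval_apply]
    simp [aeval_eq_eval]
  have hder : ∀ w : Fin (n + 1) → ℝ,
      (aeval (fun j => Polynomial.C (x j) + Polynomial.C (w j) * Polynomial.X) h).coeff 1 =
        ∑ i, eval x (pderiv i h) * w i := by
    intro w
    have h1 := congrArg (fun q => Polynomial.coeff q 0) (derivative_aeval_eq_sum
      (fun j => Polynomial.C (x j) + Polynomial.C (w j) * Polynomial.X) h)
    simpa [Polynomial.coeff_derivative, Polynomial.mul_coeff_zero, hev] using h1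
  have hG1 : ∀ w, ((G w).coeff 1).coeff 0 = 0 := by
    intro w
    rw [Polynomial.coeff_zero_eq_eval_zero, hcoeff]
    simpa [hex] using hder e
  have key : ∀ w : Fin (n + 1) → ℝ, ∑ i, eval x (pderiv i h) * w i ≠ 0 →
      0 ≤ (∑ i, eval x (pderiv i h) * w i) * ((G w).coeff 2).coeff 0 → False := by
    intro w hw hα
    obtain ⟨u, hu⟩ := Polynomial.X_dvd_iff.mpr ((congrArg (fun q => Polynomial.coeff q 0)
      (hG0 w)).trans ((hev w h).trans hx))
    obtain ⟨v, hv⟩ := Polynomial.X_dvd_iff.mpr (hG1 w)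
    have hu0 : u.eval 0 = ∑ i, eval x (pderiv i h) * w i := by
      rw [← hder w, ← hG0, hu, ← Polynomial.coeff_zero_eq_eval_zero]
      simp
    have hdeg : ∀ y, (aeval (fun j => Polynomial.C (x j + y * w j) +
        Polynomial.C (e j) * Polynomial.X) h : Polynomial ℝ).natDegree = d := fun y =>
      Polynomial.natDegree_eq_of_le_of_coeff_ne_zero
        (natDegree_le_and_coeff_aeval_line hhom _ e).1
        (by rw [(natDegree_le_and_coeff_aeval_line hhom _ e).2]; exact hyp.1)
    have c0 : ∀ y, (aeval (fun j => Polynomial.C (x j + y * w j) +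
        Polynomial.C (e j) * Polynomial.X) h : Polynomial ℝ).coeff 0 = y * u.eval y := by
      intro y
      rw [← hcoeff, hu]; simp
    have c1 : ∀ y, (aeval (fun j => Polynomial.C (x j + y * w j) +
        Polynomial.C (e j) * Polynomial.X) h : Polynomial ℝ).coeff 1 = y * v.eval y := by
      intro y
      rw [← hcoeff, hv]; simp
    refine false_of_forall_leadingCoeff_sq_mul_le (u := u) (w := v) (a := (G w).coeff 2)
      (b := ((G w).coeff 2).divX) (d := d) hyp.1 (hu0 ▸ hw) (hu0 ▸ hα) ?_ ?_ ?_
    · rw [add_comm, Polynomial.X_mul_divX_add]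
    · intro y
      rw [hcoeff, ← c0, ← c1]
      exact coeff_one_sq_sub_nonneg (hyp.splits_aeval_line _)
    · intro y
      have := leadingCoeff_sq_mul_le (hyp.splits_aeval_line (fun j => x j + y * w j))
      rw [Polynomial.leadingCoeff, hdeg, (natDegree_le_and_coeff_aeval_line hhom _ e).2] at this
      rwa [hcoeff, ← c0, ← c1]
  have hneg : ∑ i, eval x (pderiv i h) * (-w) i = -∑ i, eval x (pderiv i h) * w i := by
    simp
  have h2 : ∀ w, ((G w).coeff 2).coeff 0 = ((G 0).coeff 2).coeff 0 := by
    intro w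
    rw [Polynomial.coeff_zero_eq_eval_zero, Polynomial.coeff_zero_eq_eval_zero, hcoeff, hcoeff]
    simp
  rcases le_total 0 ((∑ i, eval x (pderiv i h) * w i) * ((G 0).coeff 2).coeff 0) with hs | hs
  · exact key w hne (by rwa [h2])
  · exact key (-w) (by rwa [hneg, neg_ne_zero]) (by rw [hneg, h2]; linarith)

/-- The Bézoutian of two monomials is a symmetric matrix. -/
theorem exists_bezoutian_X_pow {R : Type*} [CommRing R] {d : ℕ} (m : ℕ) : ∀ a b : ℕ, a = b + m →
    a ≤ d → ∃ Λ : Matrix (Fin d) (Fin d) R, Λ.IsSymm ∧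
      (X 0 ^ a * X 1 ^ b - X 1 ^ a * X 0 ^ b : MvPolynomial (Fin 2) R) =
        (X 0 - X 1) * ∑ i : Fin d, ∑ j : Fin d, C (Λ i j) * X 0 ^ (i : ℕ) * X 1 ^ (j : ℕ) := by
  have single : ∀ i j : Fin d, ∑ k : Fin d, ∑ l : Fin d,
      (C (Matrix.single i j (1 : R) k l) * X 0 ^ (k : ℕ) * X 1 ^ (l : ℕ) :
        MvPolynomial (Fin 2) R) = X 0 ^ (i : ℕ) * X 1 ^ (j : ℕ) := by
    intro i j
    rw [Finset.sum_eq_single i, Finset.sum_eq_single j] <;>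
      simp +contextual [Matrix.single_apply, eq_comm]
  induction m using Nat.twoStepInduction with
  | zero =>
    rintro a b rfl -
    exact ⟨0, Matrix.isSymm_zero, by simp; ring⟩
  | one =>
    rintro a b rfl hb
    refine ⟨Matrix.single ⟨b, hb⟩ ⟨b, hb⟩ 1, by simp [Matrix.IsSymm], ?_⟩
    rw [single]
    ring
  | more m ih _ =>
    rintro a b rfl hb
    obtain ⟨Λ, hs, hΛ⟩ := ih (b + 1 + m) (b + 1) rfl (by omega)
    refine ⟨Matrix.single ⟨b + 1 + m, by omega⟩ ⟨b, by omega⟩ 1 +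
      Matrix.single ⟨b, by omega⟩ ⟨b + 1 + m, by omega⟩ 1 + Λ, ?_, ?_⟩
    · simp only [Matrix.IsSymm, Matrix.transpose_add, Matrix.transpose_single, hs.eq]
      rw [add_comm (Matrix.single _ _ _)]
    · simp only [Matrix.add_apply, map_add, add_mul, Finset.sum_add_distrib, single, mul_add]
      rw [← hΛ]
      ring

/-- The Bézoutian of two polynomials of degree at most `d` is a symmetric `d × d` matrix. -/
theorem exists_bezoutian {R : Type*} [CommRing R] {d : ℕ} {f g : Polynomial R}
    (hf : f.natDegree ≤ d) (hg : g.natDegree ≤ d) :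
    ∃ Λ : Matrix (Fin d) (Fin d) R, Λ.IsSymm ∧
      (Polynomial.aeval (X 0) f * Polynomial.aeval (X 1) g -
        Polynomial.aeval (X 1) f * Polynomial.aeval (X 0) g : MvPolynomial (Fin 2) R) =
        (X 0 - X 1) * ∑ i : Fin d, ∑ j : Fin d, C (Λ i j) * X 0 ^ (i : ℕ) * X 1 ^ (j : ℕ) := by
  have mono : ∀ a b : ℕ, a ≤ d → b ≤ d → ∃ Λ : Matrix (Fin d) (Fin d) R, Λ.IsSymm ∧
      (X 0 ^ a * X 1 ^ b - X 1 ^ a * X 0 ^ b : MvPolynomial (Fin 2) R) =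
        (X 0 - X 1) * ∑ i : Fin d, ∑ j : Fin d, C (Λ i j) * X 0 ^ (i : ℕ) * X 1 ^ (j : ℕ) := by
    intro a b ha hb
    rcases le_total b a with hab | hab
    · exact exists_bezoutian_X_pow (a - b) a b (by omega) ha
    · obtain ⟨Λ, hs, hΛ⟩ := exists_bezoutian_X_pow (R := R) (b - a) b a (by omega) hb
      refine ⟨-Λ, hs.neg, ?_⟩
      simp only [Matrix.neg_apply, map_neg, neg_mul, Finset.sum_neg_distrib, mul_neg, ← hΛ]
      ring
  have hmono : ∀ a b : ℕ, ∃ Λ : Matrix (Fin d) (Fin d) R, a ≤ d → b ≤ d → Λ.IsSymm ∧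
      (X 0 ^ a * X 1 ^ b - X 1 ^ a * X 0 ^ b : MvPolynomial (Fin 2) R) =
        (X 0 - X 1) * ∑ i : Fin d, ∑ j : Fin d, C (Λ i j) * X 0 ^ (i : ℕ) * X 1 ^ (j : ℕ) := by
    intro a b
    by_cases hab : a ≤ d ∧ b ≤ d
    · obtain ⟨Λ, hΛ⟩ := mono a b hab.1 hab.2
      exact ⟨Λ, fun _ _ => hΛ⟩
    · exact ⟨0, fun h1 h2 => absurd ⟨h1, h2⟩ hab⟩
  choose Λ hΛ using hmono
  refine ⟨∑ a ∈ Finset.range (d + 1), ∑ b ∈ Finset.range (d + 1),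
    (f.coeff a * g.coeff b) • Λ a b, ?_, ?_⟩
  · simp only [Matrix.IsSymm, Matrix.transpose_sum, Matrix.transpose_smul]
    refine Finset.sum_congr rfl fun a ha => Finset.sum_congr rfl fun b hb => ?_
    rw [(hΛ a b (by simpa [Nat.lt_succ_iff] using ha) (by simpa [Nat.lt_succ_iff] using hb)).1.eq]
  · have hR : (X 0 - X 1 : MvPolynomial (Fin 2) R) * ∑ i : Fin d, ∑ j : Fin d,
        C ((∑ a ∈ Finset.range (d + 1), ∑ b ∈ Finset.range (d + 1),
          (f.coeff a * g.coeff b) • Λ a b) i j) * X 0 ^ (i : ℕ) * X 1 ^ (j : ℕ) =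
        ∑ a ∈ Finset.range (d + 1), ∑ b ∈ Finset.range (d + 1), C (f.coeff a * g.coeff b) *
          ((X 0 - X 1) * ∑ i : Fin d, ∑ j : Fin d,
            C (Λ a b i j) * X 0 ^ (i : ℕ) * X 1 ^ (j : ℕ)) := by
      simp only [Matrix.sum_apply, Matrix.smul_apply, smul_eq_mul, map_sum, Finset.sum_mul,
        Finset.mul_sum]
      simp_rw [Finset.sum_comm (s := (Finset.univ : Finset (Fin d)))
        (t := Finset.range (d + 1))]
      refine Finset.sum_congr rfl fun a _ => Finset.sum_congr rfl fun b _ =>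
        Finset.sum_congr rfl fun i _ => Finset.sum_congr rfl fun j _ => ?_
      rw [C_mul (a := f.coeff a * g.coeff b)]
      ring
    rw [hR]
    simp only [Polynomial.aeval_eq_sum_range' (Nat.lt_succ_of_le hf),
      Polynomial.aeval_eq_sum_range' (Nat.lt_succ_of_le hg), Finset.sum_mul_sum,
      ← Finset.sum_sub_distrib]
    refine Finset.sum_congr rfl fun a ha => Finset.sum_congr rfl fun b hb => ?_
    rw [← (hΛ a b (by simpa [Nat.lt_succ_iff] using ha) (by simpa [Nat.lt_succ_iff] using hb)).2]
    simp only [smul_eq_C_mul, C_mul]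
    ring

theorem subs_eq_aeval_finSuccEquiv {n : ℕ} (s : MvPolynomial (Fin 2) (MvPolynomial (Fin n) ℝ))
    (f : MvPolynomial (Fin (n + 1)) ℝ) :
    subs s f = Polynomial.aeval s (finSuccEquiv ℝ n f) := by
  have : (aeval (Fin.cases s fun j => C (X j)) : MvPolynomial (Fin (n + 1)) ℝ →ₐ[ℝ] _) =
      ((Polynomial.aeval s).restrictScalars ℝ).comp (finSuccEquiv ℝ n).toAlgHom := by
    refine algHom_ext fun i => ?_
    refine Fin.cases ?_ (fun j => ?_) i <;>
      simp [finSuccEquiv_X_zero, finSuccEquiv_X_succ, MvPolynomial.algebraMap_eq]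
  exact AlgHom.congr_fun this f

theorem eval₂Hom_subs {n : ℕ} {A : Type*} [CommRing A] [Algebra ℝ A] (v : Fin n → ℝ)
    (g : Fin 2 → A) (k : Fin 2) (f : MvPolynomial (Fin (n + 1)) ℝ) :
    eval₂Hom ((algebraMap ℝ A).comp (eval v)) g (subs (X k) f) =
      aeval (Fin.cons (g k) fun j => algebraMap ℝ A (v j) : Fin (n + 1) → A) f := by
  unfold subs
  induction f using MvPolynomial.induction_on with
  | C a => simp [IsScalarTower.algebraMap_apply ℝ (MvPolynomial (Fin n) ℝ)
      (MvPolynomial (Fin 2) (MvPolynomial (Fin n) ℝ)), MvPolynomial.algebraMap_eq]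
  | add p q hp hq => simp only [map_add, hp, hq]
  | mul_X p i hp =>
    rw [map_mul, map_mul, hp, map_mul, aeval_X, aeval_X]
    congr 1
    refine Fin.cases ?_ (fun j => ?_) i <;> simp

/-- The Bézoutian identity specialised at points `s, t` of an `ℝ`-algebra. -/
theorem bezoutian_identity_eval {n d : ℕ} {h p : MvPolynomial (Fin (n + 1)) ℝ}
    {Λ : Matrix (Fin d) (Fin d) (MvPolynomial (Fin n) ℝ)}
    (hΛ : subs (X 0) h * subs (X 1) p - subs (X 1) h * subs (X 0) p =
      (X 0 - X 1) * ∑ i : Fin d, ∑ j : Fin d, C (Λ i j) * X 0 ^ (i : ℕ) * X 1 ^ (j : ℕ))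
    {A : Type*} [CommRing A] [Algebra ℝ A] (v : Fin n → ℝ) (s t : A) :
    aeval (Fin.cons s fun j => algebraMap ℝ A (v j) : Fin (n + 1) → A) h *
        aeval (Fin.cons t fun j => algebraMap ℝ A (v j) : Fin (n + 1) → A) p -
      aeval (Fin.cons t fun j => algebraMap ℝ A (v j) : Fin (n + 1) → A) h *
        aeval (Fin.cons s fun j => algebraMap ℝ A (v j) : Fin (n + 1) → A) p =
      (s - t) * ∑ i : Fin d, ∑ j : Fin d,
        algebraMap ℝ A (eval v (Λ i j)) * s ^ (i : ℕ) * t ^ (j : ℕ) := by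
  have := congrArg (eval₂Hom ((algebraMap ℝ A).comp (eval v)) ![s, t]) hΛ
  simp only [map_sub, map_mul, eval₂Hom_subs] at this
  simpa using this

/-- A symmetric matrix representing a form that is diagonal, with positive diagonal, at `d`
distinct nodes is positive definite. -/
theorem posDef_of_vandermonde {d : ℕ} {M : Matrix (Fin d) (Fin d) ℝ} {a : Fin d → ℝ}
    (ha : Function.Injective a)
    (hoff : ∀ k l, k ≠ l → ∑ i, ∑ j, M i j * a k ^ (i : ℕ) * a l ^ (j : ℕ) = 0)
    (hdiag : ∀ k, 0 < ∑ i, ∑ j, M i j * a k ^ (i : ℕ) * a k ^ (j : ℕ)) : M.PosDef := by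
  have hU : IsUnit (Matrix.vandermonde a) := by
    rw [Matrix.isUnit_iff_isUnit_det, isUnit_iff_ne_zero]
    exact Matrix.det_vandermonde_ne_zero_iff.mpr ha
  have hmul : Matrix.vandermonde a * M * star (Matrix.vandermonde a) =
      Matrix.diagonal fun k => ∑ i, ∑ j, M i j * a k ^ (i : ℕ) * a k ^ (j : ℕ) := by
    ext k l
    have : (Matrix.vandermonde a * M * star (Matrix.vandermonde a)) k l =
        ∑ i, ∑ j, M i j * a k ^ (i : ℕ) * a l ^ (j : ℕ) := by
      simp only [Matrix.mul_apply, Matrix.star_apply, Matrix.vandermonde_apply, star_trivial,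
        Finset.sum_mul]
      rw [Finset.sum_comm]
      exact Finset.sum_congr rfl fun i _ => Finset.sum_congr rfl fun j _ => by ring
    rw [this]
    rcases eq_or_ne k l with rfl | hkl
    · simp
    · rw [hoff k l hkl, Matrix.diagonal_apply_ne _ hkl]
  rw [← Matrix.IsUnit.posDef_star_right_conjugate_iff hU, hmul, Matrix.posDef_diagonal_iff]
  exact hdiag

theorem aeval_smul_of_isHomogeneous {σ A : Type*} [Fintype σ] [CommRing A] [Algebra ℝ A] {d : ℕ}
    {h : MvPolynomial σ ℝ} (hhom : h.IsHomogeneous d) (s : A) (g : σ → A) :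
    aeval (s • g) h = s ^ d * aeval g h := by
  rw [aeval_def, aeval_def, eval₂_eq', eval₂_eq', Finset.mul_sum]
  refine Finset.sum_congr rfl fun m hm => ?_
  have hdeg : ∑ i, m i = d := by
    rw [← Finsupp.degree_eq_sum, Finsupp.degree_eq_weight_one]
    exact hhom (mem_support_iff.mp hm)
  simp only [Pi.smul_apply, smul_eq_mul, mul_pow, Finset.prod_mul_distrib,
    Finset.prod_pow_eq_pow_sum, hdeg]
  ring

/-- If the Bézoutian of `h` and some `p` is positive definite away from the origin, then `h` is
hyperbolic. -/
theorem hyperbolic_of_bezoutian_posDef {n d : ℕ} (hd : 1 ≤ d)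
    {h p : MvPolynomial (Fin (n + 1)) ℝ} (hhom : h.IsHomogeneous d)
    (hne : eval (Fin.cons 1 0 : Fin (n + 1) → ℝ) h ≠ 0)
    {Λ : Matrix (Fin d) (Fin d) (MvPolynomial (Fin n) ℝ)}
    (hΛ : subs (X 0) h * subs (X 1) p - subs (X 1) h * subs (X 0) p =
      (X 0 - X 1) * ∑ i : Fin d, ∑ j : Fin d, C (Λ i j) * X 0 ^ (i : ℕ) * X 1 ^ (j : ℕ))
    (hpos : ∀ v : Fin n → ℝ, v ≠ 0 → (Λ.map (eval v)).PosDef) :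
    Hyperbolic h (Fin.cons 1 0) := by
  refine ⟨hne, fun v z hz => ?_⟩
  set w : Fin n → ℝ := fun j => v j.succ with hw
  set s : ℂ := z + v 0 with hs
  have hfun : (fun i => z * ((Fin.cons 1 0 : Fin (n + 1) → ℝ) i : ℂ) + (v i : ℂ)) =
      (Fin.cons s fun j => algebraMap ℝ ℂ (w j) : Fin (n + 1) → ℂ) := by
    ext i
    refine Fin.cases ?_ (fun j => ?_) i <;> simp [hs, hw]
  rw [hfun] at hz
  by_contra him
  have hsim : s.im ≠ 0 := by simpa [hs] using him
  rcases eq_or_ne w 0 with hw0 | hw0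
  · have h1 : (Fin.cons s fun j => algebraMap ℝ ℂ (w j) : Fin (n + 1) → ℂ) =
        s • (algebraMap ℝ ℂ ∘ (Fin.cons 1 0 : Fin (n + 1) → ℝ)) := by
      ext i
      refine Fin.cases ?_ (fun j => ?_) i <;> simp [hw0]
    rw [h1, aeval_smul_of_isHomogeneous hhom, aeval_algebraMap_apply, aeval_eq_eval] at hz
    have hs0 : s ≠ 0 := fun h0 => hsim (by simp [h0])
    simp [hs0, hne] at hz
  · have hconj : aeval (Fin.cons (starRingEnd ℂ s) fun j => algebraMap ℝ ℂ (w j) :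
        Fin (n + 1) → ℂ) h = 0 := by
      have h1 := congrArg Complex.conjAe hz
      rw [← AlgEquiv.coe_toAlgHom, comp_aeval_apply, map_zero] at h1
      rw [← h1]
      congr 2
      ext i
      refine Fin.cases ?_ (fun j => ?_) i <;> simp
    have hid := bezoutian_identity_eval hΛ w s (starRingEnd ℂ s)
    rw [hz, hconj, zero_mul, zero_mul, sub_zero, eq_comm, mul_eq_zero] at hid
    have hsub : s - starRingEnd ℂ s ≠ 0 := by
      intro h0
      have := congrArg Complex.im h0
      simp at this
      exact hsim this
    have hsum := congrArg Complex.re (hid.resolve_left hsub)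
    let a : Fin d → ℝ := fun i => (s ^ (i : ℕ)).re
    let b : Fin d → ℝ := fun i => (s ^ (i : ℕ)).im
    have ha : a ≠ 0 := fun h0 => by simpa [a] using congrFun h0 ⟨0, hd⟩
    have hpa := (hpos w hw0).dotProduct_mulVec_pos ha
    have hpb := (hpos w hw0).posSemidef.dotProduct_mulVec_nonneg b
    have hexp : (∑ i : Fin d, ∑ j : Fin d, algebraMap ℝ ℂ (eval w (Λ i j)) * s ^ (i : ℕ) *
        (starRingEnd ℂ s) ^ (j : ℕ)).re =
        star a ⬝ᵥ (Λ.map (eval w)).mulVec a + star b ⬝ᵥ (Λ.map (eval w)).mulVec b := by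
      simp only [dotProduct, Matrix.mulVec, Finset.mul_sum, ← Finset.sum_add_distrib,
        Complex.re_sum]
      refine Finset.sum_congr rfl fun i _ => Finset.sum_congr rfl fun j _ => ?_
      rw [← map_pow, mul_assoc, Complex.coe_algebraMap, Complex.re_ofReal_mul, Complex.mul_re,
        Complex.conj_re, Complex.conj_im]
      simp only [a, b, Pi.star_apply, star_trivial, Matrix.map_apply]
      ring
    rw [hexp, Complex.zero_re] at hsum
    linarith

/-- The Bézoutian of a smooth hyperbolic polynomial and its derivative in the hyperbolic direction
is positive definite away from the origin. -/
theorem Hyperbolic.posDef_bezoutian_pderiv {n d : ℕ} {h : MvPolynomial (Fin (n + 1)) ℝ}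
    (hyp : Hyperbolic h (Fin.cons 1 0)) (hhom : h.IsHomogeneous d)
    (hsmooth : ∀ v : Fin (n + 1) → ℝ, v ≠ 0 → ∃ i, eval v (pderiv i h) ≠ 0)
    {Λ : Matrix (Fin d) (Fin d) (MvPolynomial (Fin n) ℝ)}
    (hΛ : subs (X 0) h * subs (X 1) (pderiv 0 h) - subs (X 1) h * subs (X 0) (pderiv 0 h) =
      (X 0 - X 1) * ∑ i : Fin d, ∑ j : Fin d, C (Λ i j) * X 0 ^ (i : ℕ) * X 1 ^ (j : ℕ))
    {v : Fin n → ℝ} (hv : v ≠ 0) : (Λ.map (eval v)).PosDef := by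
  have hsimple : ∀ r : ℝ, eval (Fin.cons r v : Fin (n + 1) → ℝ) h = 0 →
      eval (Fin.cons r v : Fin (n + 1) → ℝ) (pderiv 0 h) ≠ 0 := by
    intro r hr hr'
    obtain ⟨i, hi⟩ := hsmooth (Fin.cons r v) fun h0 => hv (by
      ext j
      simpa using congrFun h0 j.succ)
    refine hi ?_
    have := hyp.sum_mul_eval_pderiv_eq_zero hhom hr (by simp [Fin.sum_univ_succ, hr'])
      (Pi.single i 1)
    simpa [Pi.single_apply] using this
  set f : Polynomial ℝ := aeval (Fin.cons Polynomial.X fun j => Polynomial.C (v j) :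
    Fin (n + 1) → Polynomial ℝ) h with hf
  have hline : f = aeval (fun j => Polynomial.C ((Fin.cons 0 v : Fin (n + 1) → ℝ) j) +
      Polynomial.C ((Fin.cons 1 0 : Fin (n + 1) → ℝ) j) * Polynomial.X) h := by
    rw [hf]
    congr 2
    ext1 i
    refine Fin.cases ?_ (fun j => ?_) i <;> simp
  have heval : ∀ (q : MvPolynomial (Fin (n + 1)) ℝ) (r : ℝ),
      (aeval (Fin.cons Polynomial.X fun j => Polynomial.C (v j) :
        Fin (n + 1) → Polynomial ℝ) q).eval r = eval (Fin.cons r v : Fin (n + 1) → ℝ) q := by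
    intro q r
    rw [← Polynomial.coe_aeval_eq_eval, comp_aeval_apply, ← aeval_eq_eval]
    congr 2
    ext i
    refine Fin.cases ?_ (fun j => ?_) i <;> simp
  have hderiv : Polynomial.derivative f = aeval (Fin.cons Polynomial.X fun j =>
      Polynomial.C (v j) : Fin (n + 1) → Polynomial ℝ) (pderiv 0 h) := by
    rw [hf, derivative_aeval_eq_sum]
    simp [Fin.sum_univ_succ]
  have hdeg : f.natDegree = d := by
    rw [hline]
    exact Polynomial.natDegree_eq_of_le_of_coeff_ne_zero
      (natDegree_le_and_coeff_aeval_line hhom _ _).1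
      (by rw [(natDegree_le_and_coeff_aeval_line hhom _ _).2]; exact hyp.1)
  have hsplits : f.Splits := hline ▸ hyp.splits_aeval_line _
  have hf0 : f ≠ 0 := by
    intro h0
    refine hyp.1 ?_
    rw [← (natDegree_le_and_coeff_aeval_line hhom (Fin.cons 0 v) _).2, ← hline, h0]
    simp
  have hnodup : f.roots.Nodup := by
    classical
    refine Multiset.nodup_iff_count_le_one.mpr fun r => ?_
    rw [Polynomial.count_roots]
    by_contra! hlt
    obtain ⟨h1, h2⟩ := (Polynomial.one_lt_rootMultiplicity_iff_isRoot hf0).mp hlt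
    rw [Polynomial.IsRoot, hderiv, heval] at h2
    rw [Polynomial.IsRoot, hf, heval] at h1
    exact hsimple r h1 h2
  have hcard : f.roots.toFinset.card = d := by
    rw [Multiset.toFinset_card_of_nodup hnodup, ← hsplits.natDegree_eq_card_roots, hdeg]
  let a := f.roots.toFinset.orderEmbOfFin hcard
  have ha : ∀ k, eval (Fin.cons (a k) v : Fin (n + 1) → ℝ) h = 0 := by
    intro k
    rw [← heval]
    have := Finset.orderEmbOfFin_mem f.roots.toFinset hcard k
    exact (Polynomial.isRoot_of_mem_roots (Multiset.mem_toFinset.mp this))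
  refine posDef_of_vandermonde (a := a) a.injective ?_ ?_
  · intro k l hkl
    have := bezoutian_identity_eval hΛ v (a k) (a l)
    simp only [Algebra.algebraMap_self, RingHom.id_apply, aeval_eq_eval] at this
    rw [ha, ha, zero_mul, zero_mul, sub_zero, eq_comm, mul_eq_zero, sub_eq_zero] at this
    exact this.resolve_left fun h0 => hkl (a.injective h0)
  · intro k
    have hid := congrArg (fun q => (Polynomial.derivative q).eval (a k))
      (bezoutian_identity_eval hΛ v Polynomial.X (Polynomial.C (a k)))
    have hC : ∀ q : MvPolynomial (Fin (n + 1)) ℝ,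
        aeval (Fin.cons (Polynomial.C (a k)) fun j => Polynomial.C (v j) :
          Fin (n + 1) → Polynomial ℝ) q =
        Polynomial.C (eval (Fin.cons (a k) v : Fin (n + 1) → ℝ) q) := by
      intro q
      rw [← aeval_eq_eval, ← Polynomial.algebraMap_eq, ← aeval_algebraMap_apply]
      congr 2
      ext1 i
      refine Fin.cases ?_ (fun j => ?_) i <;> simp
    simp only [Polynomial.algebraMap_eq, hC, ← hf, ha, map_zero, zero_mul, sub_zero,
      Polynomial.derivative_mul, hderiv, Polynomial.derivative_C, mul_zero, add_zero,
      Polynomial.eval_mul, heval, Polynomial.eval_C, Polynomial.derivative_sub,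
      Polynomial.derivative_X, Polynomial.eval_add, Polynomial.eval_sub, Polynomial.eval_X,
      sub_self, one_mul, Polynomial.eval_finsetSum,
      Polynomial.eval_pow] at hid
    have := hsimple _ (ha k)
    calc (0 : ℝ) < _ := mul_self_pos.mpr this
      _ = _ := hid

/-- **Theorem (Bézoutians and hyperbolicity).** Let `h` be homogeneous of degree `d ≥ 1`
with `h(e) ≠ 0` for `e = (1,0,…,0)` and without real singularities. Then `h` is hyperbolic
with respect to `e` iff there is a homogeneous polynomial `p` of degree `≤ d-1` in `x₀`
such that the symmetric `d×d` matrix `Λ` with entries in `ℝ[x₁,…,xₙ]` determined by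
`h(s)p(t) − h(t)p(s) = (s−t)·Σ_{i,j} Λᵢⱼ sⁱ tʲ` is positive definite at every `0 ≠ v ∈ ℝⁿ`. -/
theorem statement1 {n d : ℕ} (hd : 1 ≤ d) (h : MvPolynomial (Fin (n + 1)) ℝ)
    (hhom : h.IsHomogeneous d)
    (hne : eval (Fin.cons 1 0 : Fin (n + 1) → ℝ) h ≠ 0)
    (hsmooth : ∀ v : Fin (n + 1) → ℝ, v ≠ 0 → ∃ i, eval v (pderiv i h) ≠ 0) :
    Hyperbolic h (Fin.cons 1 0) ↔
      ∃ (p : MvPolynomial (Fin (n + 1)) ℝ) (dp : ℕ)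
        (Λ : Matrix (Fin d) (Fin d) (MvPolynomial (Fin n) ℝ)),
        p.IsHomogeneous dp ∧ p.degreeOf 0 ≤ d - 1 ∧ Λ.IsSymm ∧
        subs (X 0) h * subs (X 1) p - subs (X 1) h * subs (X 0) p =
          (X 0 - X 1) * ∑ i : Fin d, ∑ j : Fin d, C (Λ i j) * X 0 ^ (i : ℕ) * X 1 ^ (j : ℕ) ∧
        ∀ v : Fin n → ℝ, v ≠ 0 → (Λ.map (eval v)).PosDef := by
  constructor
  · intro hyp
    have hhom' : (pderiv 0 h).IsHomogeneous (d - 1) := hhom.pderiv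
    have hdeg : ∀ {q : MvPolynomial (Fin (n + 1)) ℝ} {k : ℕ}, q.IsHomogeneous k →
        q.degreeOf 0 ≤ k := fun hq =>
      (degreeOf_le_totalDegree _ _).trans hq.totalDegree_le
    obtain ⟨Λ, hs, hΛ⟩ := exists_bezoutian (d := d) (f := finSuccEquiv ℝ n h)
      (g := finSuccEquiv ℝ n (pderiv 0 h))
      ((natDegree_finSuccEquiv h).trans_le (hdeg hhom))
      ((natDegree_finSuccEquiv _).trans_le ((hdeg hhom').trans (Nat.sub_le d 1)))
    simp only [← subs_eq_aeval_finSuccEquiv] at hΛ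
    exact ⟨pderiv 0 h, d - 1, Λ, hhom', hdeg hhom', hs, hΛ,
      fun v hv => hyp.posDef_bezoutian_pderiv hhom hsmooth hΛ hv⟩
  · rintro ⟨p, -, Λ, -, -, -, hΛ, hpos⟩
    exact hyperbolic_of_bezoutian_posDef hd hhom hne hΛ hpos
end
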